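/- Let p, q ≥ 3 and r ≥ 1 be integers. If G is any simple graph whose signless Laplacian permanental polynomial equals that of d(p,q,r), i.e., per(xI − Q(G)) = per(xI − Q(d(p,q,r))) as polynomials in x, then G is isomorphic to d(p,q,r). -/

import Mathlib

open scoped Classical
open Polynomial

noncomputable section

/-- The signless Laplacian matrix `Q(G) = D(G) + A(G)` of a graph `G`. -/
def signlessLapMatrix {V : Type*} [Fintype V] (G : SimpleGraph V) : Matrix V V ℚ :=
  G.degMatrix ℚ + G.adjMatrix ℚ

/-- The signless Laplacian permanental polynomial `per(x·I − Q(G))` of a graph `G`. -/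
def qPermPoly {V : Type*} [Fintype V] (G : SimpleGraph V) : Polynomial ℚ :=
  Matrix.permanent
    (Matrix.diagonal (fun _ : V => (X : Polynomial ℚ)) - (signlessLapMatrix G).map Polynomial.C)

/-- The bicyclic graph `d(p,q,r)` on `p + q + r` vertices: vertices `0, …, p-1` form the
cycle `C_p`, vertices `p, …, p+q-1` form the cycle `C_q`, and vertices `p+q, …, p+q+r-1`
form a path of `r` internal vertices whose ends are joined to vertex `0` of `C_p` and to
vertex `p` of `C_q` (i.e. a path on `r + 2` vertices has each end vertex identified with a
vertex of one of the two cycles). -/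
def dGraph (p q r : ℕ) : SimpleGraph (Fin (p + q + r)) :=
  SimpleGraph.fromRel (fun i j =>
    (i.val + 1 = j.val ∧ j.val < p) ∨
    (i.val = p - 1 ∧ j.val = 0) ∨
    (i.val + 1 = j.val ∧ p ≤ i.val ∧ j.val < p + q) ∨
    (i.val = p + q - 1 ∧ j.val = p) ∨
    (i.val + 1 = j.val ∧ p + q ≤ i.val) ∨
    (i.val = 0 ∧ j.val = p + q) ∨
    (i.val = p + q + r - 1 ∧ j.val = p))

set_option linter.all false


/-! ### Permanents of row/column subsets -/

/-- Permanent of the submatrix with rows listed in a list and columns in a finset. -/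
def perL {V R : Type*} [CommRing R] (M : V → V → R) : List V → Finset V → R
  | [], B => if B = ∅ then 1 else 0
  | i :: l, B => ∑ j ∈ B, M i j * perL M l (B.erase j)

theorem perL_perm {V R : Type*} [CommRing R] (M : V → V → R) {l l' : List V} (h : l.Perm l') :
    ∀ B : Finset V, perL M l B = perL M l' B := by
  induction h with
  | nil => intro B; rfl
  | cons x h ih => intro B; simp only [perL]; exact Finset.sum_congr rfl fun j _ => by rw [ih]
  | swap x y l =>
    intro B
    simp only [perL, Finset.mul_sum]
    rw [Finset.sum_comm' (t' := B) (s' := fun j => B.erase j)]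
    · refine Finset.sum_congr rfl fun j _ => Finset.sum_congr rfl fun k _ => ?_
      rw [Finset.erase_right_comm]; ring
    · intro a b
      simp only [Finset.mem_erase]
      tauto
  | trans h1 h2 ih1 ih2 => intro B; rw [ih1, ih2]

/-- Permanent of the submatrix with rows `A` and columns `B`. -/
def Per {V R : Type*} [CommRing R] (M : V → V → R) (A B : Finset V) : R := perL M A.toList B

section
variable {V R : Type*} [CommRing R] (M : V → V → R)

theorem Per_empty (B : Finset V) : Per M ∅ B = if B = ∅ then 1 else 0 := by
  simp [Per, perL]

theorem Per_insert_row {i : V} {A : Finset V} (hi : i ∉ A) (B : Finset V) :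
    Per M (insert i A) B = ∑ j ∈ B, M i j * Per M A (B.erase j) := by
  unfold Per
  rw [perL_perm M (Finset.toList_insert hi)]
  rfl

theorem Per_insert_col (A : Finset V) : ∀ {j : V} {B : Finset V} (_ : j ∉ B),
    Per M A (insert j B) = ∑ i ∈ A, M i j * Per M (A.erase i) B := by
  induction A using Finset.induction_on with
  | empty => intro j B hj; simp [Per_empty]
  | insert a A ha ih =>
    intro j B hj
    rw [Per_insert_row M ha, Finset.sum_insert hj, Finset.sum_insert ha]
    congr 1
    · rw [Finset.erase_insert hj, Finset.erase_insert ha]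
    · have h1 : ∀ k ∈ B, M a k * Per M A ((insert j B).erase k) =
          ∑ i ∈ A, M a k * (M i j * Per M (A.erase i) (B.erase k)) := by
        intro k hk
        have : (insert j B).erase k = insert j (B.erase k) := by
          rw [Finset.erase_insert_of_ne]
          rintro rfl; exact hj hk
        rw [this, ih (by simp [hj]), Finset.mul_sum]
      have h2 : ∀ i ∈ A, M i j * Per M ((insert a A).erase i) B =
          ∑ k ∈ B, M a k * (M i j * Per M (A.erase i) (B.erase k)) := by
        intro i hi
        have : (insert a A).erase i = insert a (A.erase i) := by
          rw [Finset.erase_insert_of_ne]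
          rintro rfl; exact ha hi
        rw [this, Per_insert_row M (by simp [ha]), Finset.mul_sum]
        exact Finset.sum_congr rfl fun k _ => by ring
      rw [Finset.sum_congr rfl h1, Finset.sum_congr rfl h2, Finset.sum_comm]

theorem Per_symm (hM : ∀ i j, M i j = M j i) (A : Finset V) :
    ∀ B, Per M A B = Per M B A := by
  induction A using Finset.induction_on with
  | empty =>
    intro B
    rw [Per_empty]
    rcases B.eq_empty_or_nonempty with rfl | ⟨b, hb⟩
    · simp [Per_empty]
    · rw [← Finset.insert_erase hb, Per_insert_row M (Finset.notMem_erase b B)]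
      simp
  | insert a A ha ih =>
    intro B
    rw [Per_insert_row M ha, Per_insert_col M B ha]
    exact Finset.sum_congr rfl fun j _ => by rw [ih, hM]

theorem Per_eq_sum [Fintype V] (A : Finset V) : ∀ g : V → V, Set.InjOn g (Aᶜ : Finset V) →
    ∑ σ : Equiv.Perm V with (∀ i, i ∉ A → σ i = g i), ∏ i ∈ A, M i (σ i) =
      Per M A (Finset.univ \ Finset.image g Aᶜ) := by
  induction A using Finset.induction_on with
  | empty =>
    intro g hg
    have hg' : Function.Injective g := by
      intro a b hab; exact hg (by simp) (by simp) hab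
    have hb : Function.Bijective g := Finite.injective_iff_bijective.mp hg'
    have h1 : (Finset.univ.filter fun σ : Equiv.Perm V => ∀ i, i ∉ (∅ : Finset V) → σ i = g i)
        = {Equiv.ofBijective g hb} := by
      ext σ
      simp only [Finset.mem_filter, Finset.mem_univ, true_and, Finset.mem_singleton,
        Finset.notMem_empty, not_false_eq_true, forall_const]
      constructor
      · intro h; ext i; simp [h]
      · rintro rfl; simp
    have h2 : Finset.univ \ Finset.image g (∅ : Finset V)ᶜ = ∅ := by
      simp [Finset.image_univ_of_surjective hb.2]
    rw [h1, h2, Per_empty]; simp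
  | insert a A ha ih =>
    intro g hg
    set B := Finset.univ \ Finset.image g (insert a A)ᶜ with hB
    have key : ∀ j ∈ B, Per M A (B.erase j) =
        ∑ σ : Equiv.Perm V with (∀ i, i ∉ A → σ i = Function.update g a j i),
          ∏ i ∈ A, M i (σ i) := by
      intro j hj
      have hj' : ∀ i, i ∉ insert a A → g i ≠ j := by
        intro i hi hij
        simp only [hB, Finset.mem_sdiff, Finset.mem_univ, true_and, Finset.mem_image,
          Finset.mem_compl, not_exists, not_and] at hj
        exact hj i hi hij
      rw [ih]
      · congr 1
        ext z
        simp only [hB, Finset.mem_erase, Finset.mem_sdiff, Finset.mem_univ, true_and,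
          Finset.mem_image, Finset.mem_compl, not_exists, not_and]
        constructor
        · rintro ⟨hz, h⟩ i hi
          by_cases hia : i = a
          · subst hia; simpa using hz.symm
          · rw [Function.update_of_ne hia]; exact h i (by simp [hia, hi])
        · intro h
          refine ⟨?_, ?_⟩
          · have := h a ha; simpa [eq_comm] using this
          · intro i hi
            have hia : i ≠ a := by rintro rfl; simp at hi
            have := h i (fun h => hi (by simp [h]))
            rwa [Function.update_of_ne hia] at this
      · intro i hi i' hi' h
        simp only [Finset.coe_compl, Set.mem_compl_iff, Finset.mem_coe] at hi hi'
        by_cases h1 : i = a <;> by_cases h2 : i' = a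
        · rw [h1, h2]
        · subst h1
          rw [Function.update_self, Function.update_of_ne h2] at h
          exact absurd h.symm (hj' i' (by simp [h2, hi']))
        · subst h2
          rw [Function.update_self, Function.update_of_ne h1] at h
          exact absurd h (hj' i (by simp [h1, hi]))
        · rw [Function.update_of_ne h1, Function.update_of_ne h2] at h
          exact hg (by simp [h1, hi]) (by simp [h2, hi']) h
    rw [Per_insert_row M ha]
    have hmap : ∀ σ ∈ (Finset.univ.filter fun σ : Equiv.Perm V =>
        ∀ i, i ∉ insert a A → σ i = g i), σ a ∈ B := by
      intro σ hσ
      simp only [Finset.mem_filter, Finset.mem_univ, true_and] at hσ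
      simp only [hB, Finset.mem_sdiff, Finset.mem_univ, true_and, Finset.mem_image,
          Finset.mem_compl, not_exists, not_and]
      intro i hi h
      rw [← hσ i hi] at h
      have := σ.injective h
      subst this; simp at hi
    rw [← Finset.sum_fiberwise_of_maps_to hmap]
    refine Finset.sum_congr rfl fun j hj => ?_
    rw [key j hj, Finset.mul_sum]
    refine Finset.sum_congr ?_ ?_
    · ext σ
      simp only [Finset.mem_filter, Finset.mem_univ, true_and]
      constructor
      · rintro ⟨h1, h2⟩ i hi
        by_cases hia : i = a
        · subst hia; simpa using h2
        · rw [Function.update_of_ne hia]; exact h1 i (by simp [hia, hi])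
      · intro h
        refine ⟨fun i hi => ?_, ?_⟩
        · have hia : i ≠ a := by rintro rfl; simp at hi
          have := h i (fun h => hi (by simp [h]))
          rwa [Function.update_of_ne hia] at this
        · have := h a ha; simpa using this
    · intro σ hσ
      simp only [Finset.mem_filter, Finset.mem_univ, true_and] at hσ
      have := hσ a ha
      rw [Function.update_self] at this
      rw [Finset.prod_insert ha, this]

theorem permanent_eq_Per [Fintype V] (N : Matrix V V R) (hN : ∀ i j, N i j = N j i) :
    N.permanent = Per (fun i j => N i j) Finset.univ Finset.univ := by
  have := Per_eq_sum (fun i j => N i j) Finset.univ (id : V → V) (by simp)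
  simp only [Finset.mem_univ, not_true_eq_false, false_imp_iff, implies_true, Finset.filter_true,
    Finset.compl_univ, Finset.image_empty, Finset.sdiff_empty] at this
  rw [← this, Matrix.permanent]
  refine Finset.sum_congr rfl fun σ _ => Finset.prod_congr rfl fun i _ => hN _ _

end


/-! ### Eliminating an arc from a permanent -/

/-- Minor with row `a` and column `b` removed (zero when not available). -/
def Qm {V R : Type*} [CommRing R] (M : V → V → R) (a b : V) (A B : Finset V) : R :=
  if a ∈ A ∧ b ∈ B then Per M (A.erase a) (B.erase b) else 0

/-- Interior of an arc `x 1, …, x k`. -/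
def arcI {V : Type*} (x : ℕ → V) (k : ℕ) : Finset V := (Finset.range k).image fun i => x (i + 1)

/-- Shifted sequence. -/
def shf {V : Type*} (x : ℕ → V) : ℕ → V := fun i => x (i + 1)

/-- Path permanents: `pp D w (k+1)` belongs to the path with `k` vertices. -/
def pp {R : Type*} [CommRing R] (D w : R) : ℕ → R
  | 0 => 0
  | 1 => 1
  | (n + 2) => D * pp D w (n + 1) + w ^ 2 * pp D w n

structure MArc {V R : Type*} [CommRing R] (M : V → V → R) (D w : R) (x : ℕ → V) (k : ℕ) :
    Prop where
  inj : ∀ i j, i < k → j ≤ k + 1 → x (i + 1) = x j → i + 1 = j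
  diag : ∀ i, i < k → M (x (i + 1)) (x (i + 1)) = D
  off : ∀ i, i ≤ k → M (x i) (x (i + 1)) = w
  zero : ∀ i, i < k → ∀ z, z ≠ x (i + 1) → z ≠ x i → z ≠ x (i + 2) → M (x (i + 1)) z = 0

section
variable {V R : Type*} [CommRing R] {M : V → V → R} {D w : R}

theorem mem_arcI {x : ℕ → V} {k : ℕ} {z : V} : z ∈ arcI x k ↔ ∃ i, i < k ∧ x (i + 1) = z := by
  simp [arcI]

theorem arcI_succ (x : ℕ → V) (k : ℕ) : arcI x (k + 1) = insert (x 1) (arcI (shf x) k) := by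
  ext z
  simp only [mem_arcI, Finset.mem_insert, shf]
  constructor
  · rintro ⟨i, hi, rfl⟩
    rcases i with _ | i
    · simp
    · right; exact ⟨i, by omega, rfl⟩
  · rintro (rfl | ⟨i, hi, rfl⟩)
    · exact ⟨0, by omega, rfl⟩
    · exact ⟨i + 1, by omega, rfl⟩

theorem MArc.shift {x : ℕ → V} {k : ℕ} (h : MArc M D w x (k + 1)) : MArc M D w (shf x) k where
  inj i j hi hj e := by have := h.inj (i + 1) (j + 1) (by omega) (by omega) e; omega
  diag i hi := h.diag (i + 1) (by omega)
  off i hi := h.off (i + 1) (by omega)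
  zero i hi := h.zero (i + 1) (by omega)

theorem sum_supp (f : V → R) (B C : Finset V) (h : ∀ z ∈ B, z ∉ C → f z = 0) :
    ∑ z ∈ B, f z = ∑ z ∈ C, if z ∈ B then f z else 0 := by
  rw [← Finset.sum_filter]
  symm
  refine Finset.sum_subset_zero_on_sdiff (fun z hz => (Finset.mem_filter.mp hz).2) ?_ (fun _ _ => rfl)
  intro z hz
  simp only [Finset.mem_sdiff, Finset.mem_filter, not_and] at hz
  exact h z hz.1 (fun hc => hz.2 hc hz.1)

/-- `x j ∉ arcI` of the tail for the relevant indices. -/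
theorem MArc.notMem {x : ℕ → V} {k j : ℕ} (h : MArc M D w x k) (hj : j = 0 ∨ j = k + 1) :
    x j ∉ arcI x k := by
  rw [mem_arcI]
  rintro ⟨i, hi, e⟩
  have := h.inj i j hi (by omega) e
  omega

theorem MArc.head_notMem {x : ℕ → V} {k : ℕ} (h : MArc M D w x (k + 1)) :
    x 1 ∉ arcI (shf x) k := by
  have := h.shift.notMem (j := 0) (Or.inl rfl)
  exact this

theorem erase_union_of_notMem {z : V} {I B : Finset V} (hz : z ∉ I) :
    (I ∪ B).erase z = I ∪ B.erase z := by
  rw [Finset.erase_union_distrib, Finset.erase_eq_of_notMem hz]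

/-- Expansion along row `x 1`. -/
theorem row_head (hM : ∀ i j, M i j = M j i) {x : ℕ → V} {k : ℕ} (h : MArc M D w x (k + 1))
    {A B : Finset V} (hA : x 1 ∉ A) :
    Per M (insert (x 1) A) B =
      ∑ z ∈ ({x 0, x 1, x 2} : Finset V), if z ∈ B then M (x 1) z * Per M A (B.erase z) else 0 := by
  rw [Per_insert_row M hA, sum_supp]
  intro z _ hz
  simp only [Finset.mem_insert, Finset.mem_singleton, not_or] at hz
  rw [h.zero 0 (by omega) z hz.2.1 hz.1 hz.2.2, zero_mul]

theorem col_head (hM : ∀ i j, M i j = M j i) {x : ℕ → V} {k : ℕ} (h : MArc M D w x (k + 1))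
    {A B : Finset V} (hB : x 1 ∉ B) :
    Per M A (insert (x 1) B) =
      ∑ z ∈ ({x 0, x 1, x 2} : Finset V), if z ∈ A then M (x 1) z * Per M (A.erase z) B else 0 := by
  rw [Per_insert_col M A hB, sum_supp]
  · refine Finset.sum_congr rfl fun z _ => ?_
    rw [hM]
  · intro z _ hz
    simp only [Finset.mem_insert, Finset.mem_singleton, not_or] at hz
    rw [hM, h.zero 0 (by omega) z hz.2.1 hz.1 hz.2.2, zero_mul]

theorem MArc.ne01 {x : ℕ → V} {k : ℕ} (h : MArc M D w x (k + 1)) : x 0 ≠ x 1 := by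
  intro e; have := h.inj 0 0 (by omega) (by omega) e.symm; omega

theorem MArc.ne12 {x : ℕ → V} {k : ℕ} (h : MArc M D w x (k + 1)) : x 1 ≠ x 2 := by
  intro e; have := h.inj 0 2 (by omega) (by omega) e; omega

theorem MArc.ne02 {x : ℕ → V} {k : ℕ} (h : MArc M D w x (k + 2)) : x 0 ≠ x 2 := by
  intro e; have := h.inj 1 0 (by omega) (by omega) e.symm; omega

theorem sum_three (f : V → R) {a b c : V} (h1 : a ≠ b) (h2 : b ≠ c) (h3 : a ≠ c) :
    ∑ z ∈ ({a, b, c} : Finset V), f z = f a + f b + f c := by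
  rw [Finset.sum_insert (by simp [h1, h3]), Finset.sum_insert (by simp [h2]),
    Finset.sum_singleton, add_assoc]

theorem sum_three' (f : V → R) {a b c : V} (h1 : a ≠ b) (h2 : b ≠ c) (h : f a = 0) :
    ∑ z ∈ ({a, b, c} : Finset V), f z = f b + f c := by
  by_cases h3 : a = c
  · subst h3
    have : ({a, b, a} : Finset V) = {b, a} := by ext; simp
    rw [this, Finset.sum_pair h2]
  · rw [sum_three f h1 h2 h3, h, zero_add]

theorem Per_dangling (hM : ∀ i j, M i j = M j i) (k : ℕ) : ∀ (x : ℕ → V) (A B : Finset V),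
    MArc M D w x k → (∀ i, i ≤ k → x i ∉ A) → (∀ i, i ≤ k → x i ∉ B) →
    Per M (arcI x k ∪ A) (arcI x k ∪ B) =
      pp D w (k + 1) * Per M A B + w ^ 2 * pp D w k * Qm M (x (k + 1)) (x (k + 1)) A B := by
  induction k using Nat.twoStepInduction with
  | zero => intro x A B _ _ _; simp [arcI, pp]
  | one =>
    intro x A B h hA hB
    have e : arcI x 1 = {x 1} := by simp [arcI]
    rw [e, ← Finset.insert_eq, ← Finset.insert_eq, row_head hM h (hA 1 (by omega)),
      sum_three' _ h.ne01 h.ne12 (by rw [if_neg]; simp [hB 0, h.ne01])]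
    have hd := h.diag 0 (by omega)
    have ho := h.off 1 (by omega)
    norm_num at hd ho
    rw [if_pos (by simp), Finset.erase_insert (hB 1 (by omega)), hd, ho]
    simp only [pp, Qm]
    have e1 : ∀ S : Finset V, (x 2 ∈ insert (x 1) S) ↔ x 2 ∈ S := by
      intro S; simp [h.ne12.symm]
    simp only [e1]
    by_cases hb : x 2 ∈ B
    · rw [if_pos hb, Finset.erase_insert_of_ne h.ne12,
        col_head hM h (by simp [hB 1]), sum_three' _ h.ne01 h.ne12 (by rw [if_neg]; simp [hA 0]),
        if_neg (by simp [hA 1]), ho]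
      by_cases ha : x 2 ∈ A
      · simp [ha, hb]; ring
      · simp [ha]
    · simp [hb]
  | more k ih1 ih2 =>
    intro x A B h hA hB
    have hs := h.shift
    have hss := hs.shift
    rw [arcI_succ, Finset.insert_union, Finset.insert_union,
      row_head hM h (by simp [hA 1, h.head_notMem]), sum_three' _ h.ne01 h.ne12 ?_]
    swap
    · rw [if_neg]
      have := h.notMem (j := 0) (Or.inl rfl)
      rw [arcI_succ] at this
      rw [← Finset.insert_union, Finset.mem_union, not_or]
      exact ⟨this, hB 0 (by omega)⟩
    have hd := h.diag 0 (by omega)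
    have ho := h.off 1 (by omega)
    norm_num at hd ho
    rw [if_pos (by simp), Finset.erase_insert (by simp [hB 1, h.head_notMem]), hd, ho]
    rw [ih2 (shf x) A B hs (fun i hi => hA (i + 1) (by omega)) (fun i hi => hB (i + 1) (by omega))]
    have hx2 : x 2 ∈ arcI (shf x) (k + 1) := by rw [mem_arcI]; exact ⟨0, by omega, rfl⟩
    have hx2' : x 2 ∉ arcI (shf (shf x)) k := hs.head_notMem
    have hx1' : x 1 ∉ arcI (shf (shf x)) k := by
      have := h.head_notMem
      rw [arcI_succ] at this
      simp only [Finset.mem_insert, not_or] at this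
      exact this.2
    have e2 : ∀ S : Finset V, x 2 ∉ S →
        (arcI (shf x) (k + 1) ∪ S).erase (x 2) = arcI (shf (shf x)) k ∪ S := by
      intro S hS
      rw [arcI_succ]
      change (insert (x 2) _ ∪ S).erase (x 2) = _
      rw [Finset.insert_union, Finset.erase_insert (by simp [hS, hx2'])]
    rw [if_pos (by simp [hx2]), Finset.erase_insert_of_ne h.ne12, e2 B (hB 2 (by omega)),
      col_head hM h (by simp [hB 1, hx1']), sum_three' _ h.ne01 h.ne12 ?_]
    swap
    · rw [if_neg]
      have := h.notMem (j := 0) (Or.inl rfl)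
      rw [arcI_succ] at this
      simp only [Finset.mem_insert, not_or] at this
      simp [this, hA 0]
    rw [if_neg (by simp [hA 1, h.head_notMem]), if_pos (by simp [hx2]), e2 A (hA 2 (by omega)),
      ih1 (shf (shf x)) A B hss (fun i hi => hA (i + 2) (by omega))
        (fun i hi => hB (i + 2) (by omega)), ho]
    simp only [pp, shf]
    ring

theorem Per_forced (hM : ∀ i j, M i j = M j i) (k : ℕ) : ∀ (x : ℕ → V) (A B : Finset V),
    MArc M D w x (k + 1) → (∀ i, i ≤ k + 1 → i ≠ 0 → x i ∉ A) → (∀ i, i ≤ k + 1 → x i ∉ B) →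
    Per M (arcI x (k + 1) ∪ A) (arcI (shf x) k ∪ B) =
      w ^ (k + 1) * (if x (k + 2) ∈ B then Per M A (B.erase (x (k + 2))) else 0) := by
  induction k with
  | zero =>
    intro x A B h hA hB
    have ho := h.off 1 (by omega)
    norm_num at ho
    have e : arcI x 1 = {x 1} := by simp [arcI]
    have e' : arcI (shf x) 0 = ∅ := by simp [arcI]
    simp only [zero_add]
    rw [e, e', ← Finset.insert_eq, Finset.empty_union, row_head hM h (hA 1 (by omega) (by omega)),
      sum_three' _ h.ne01 h.ne12 (by rw [if_neg]; simp [hB 0]), if_neg (by simp [hB 1]), ho]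
    split_ifs <;> ring
  | succ k ih =>
    intro x A B h hA hB
    have ho := h.off 1 (by omega)
    norm_num at ho
    have hs := h.shift
    have hx2 : x 2 ∈ arcI (shf x) (k + 1) := by rw [mem_arcI]; exact ⟨0, by omega, rfl⟩
    have hx2' : x 2 ∉ arcI (shf (shf x)) k := hs.head_notMem
    have e2 : ∀ S : Finset V, x 2 ∉ S →
        (arcI (shf x) (k + 1) ∪ S).erase (x 2) = arcI (shf (shf x)) k ∪ S := by
      intro S hS
      rw [arcI_succ]
      change (insert (x 2) _ ∪ S).erase (x 2) = _
      rw [Finset.insert_union, Finset.erase_insert (by simp [hS, hx2'])]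
    have h0 := h.notMem (j := 0) (Or.inl rfl)
    rw [arcI_succ] at h0
    simp only [Finset.mem_insert, not_or] at h0
    rw [arcI_succ x, Finset.insert_union, row_head hM h (by simp [hA 1, h.head_notMem]),
      sum_three' _ h.ne01 h.ne12 (by rw [if_neg]; simp [hB 0, h0]),
      if_neg (by simp [hB 1, h.head_notMem]), if_pos (by simp [hx2]), e2 B (hB 2 (by omega)),
      ih (shf x) A B hs (fun i hi _ => hA (i + 1) (by omega) (by omega))
        (fun i hi => hB (i + 1) (by omega)), ho]
    simp only [shf]
    ring

theorem Per_arc (hM : ∀ i j, M i j = M j i) (m : ℕ) (x : ℕ → V) (A B : Finset V)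
    (h : MArc M D w x (m + 1)) (hab : x 0 ≠ x (m + 2) ∨ 1 ≤ m)
    (hA : ∀ z ∈ arcI x (m + 1), z ∉ A) (hB : ∀ z ∈ arcI x (m + 1), z ∉ B) :
    Per M (arcI x (m + 1) ∪ A) (arcI x (m + 1) ∪ B) =
      pp D w (m + 2) * Per M A B +
      w ^ 2 * pp D w (m + 1) * (Qm M (x 0) (x 0) A B + Qm M (x (m + 2)) (x (m + 2)) A B) +
      w ^ 4 * pp D w m * (if x 0 ∈ A ∧ x 0 ∈ B then
        Qm M (x (m + 2)) (x (m + 2)) (A.erase (x 0)) (B.erase (x 0)) else 0) +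
      w ^ (m + 2) * (Qm M (x 0) (x (m + 2)) A B + Qm M (x (m + 2)) (x 0) A B) := by
  have hA' : ∀ i, i ≤ m + 1 → i ≠ 0 → x i ∉ A := fun i hi h0 => hA _ (by
    rw [mem_arcI]; exact ⟨i - 1, by omega, by congr 1; omega⟩)
  have hB' : ∀ i, i ≤ m + 1 → i ≠ 0 → x i ∉ B := fun i hi h0 => hB _ (by
    rw [mem_arcI]; exact ⟨i - 1, by omega, by congr 1; omega⟩)
  have hd := h.diag 0 (by omega)
  have ho := h.off 1 (by omega)
  have ho0 := h.off 0 (by omega)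
  norm_num at hd ho ho0
  rw [hM] at ho0
  rcases m with _ | k
  · have h02 : x 0 ≠ x 2 := by
      rcases hab with h | h
      · exact h
      · omega
    have e : arcI x 1 = {x 1} := by simp [arcI]
    simp only [zero_add] at *
    have e1 : ∀ S : Finset V, (x 2 ∈ insert (x 1) S) ↔ x 2 ∈ S := by
      intro S; simp [h.ne12.symm]
    have e0 : ∀ S : Finset V, (x 0 ∈ insert (x 1) S) ↔ x 0 ∈ S := by
      intro S; simp [h.ne01]
    have c1 := fun j => col_head hM h (A := A) (B := B.erase j)
      (fun hx => hB' 1 (by omega) (by omega) (Finset.mem_of_mem_erase hx))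
    rw [e, ← Finset.insert_eq, ← Finset.insert_eq, row_head hM h (hA' 1 (by omega) (by omega)),
      sum_three _ h.ne01 h.ne12 h02, hd, ho, ho0, if_pos (Finset.mem_insert_self _ _),
      Finset.erase_insert (hB' 1 (by omega) (by omega)),
      Finset.erase_insert_of_ne h.ne01.symm, Finset.erase_insert_of_ne h.ne12,
      c1, c1, sum_three _ h.ne01 h.ne12 h02, sum_three _ h.ne01 h.ne12 h02, ho, ho0,
      if_neg (hA' 1 (by omega) (by omega))]
    have hA1 := hA' 1 (by omega) (by omega)
    simp only [pp, Qm, e0, e1]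
    by_cases a1 : x 0 ∈ A <;> by_cases a2 : x 0 ∈ B <;> by_cases a3 : x 2 ∈ A <;>
      by_cases a4 : x 2 ∈ B <;> simp [a1, a2, a3, a4, hA1] <;> ring
  · have hs := h.shift
    have hss := hs.shift
    have h02 := h.ne02
    have hx2 : x 2 ∈ arcI (shf x) (k + 1) := by rw [mem_arcI]; exact ⟨0, by omega, rfl⟩
    have hx2' : x 2 ∉ arcI (shf (shf x)) k := hs.head_notMem
    have hx1' : x 1 ∉ arcI (shf (shf x)) k := by
      have := h.head_notMem
      rw [arcI_succ] at this
      simp only [Finset.mem_insert, not_or] at this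
      exact this.2
    have e2 : ∀ S : Finset V, x 2 ∉ S →
        (arcI (shf x) (k + 1) ∪ S).erase (x 2) = arcI (shf (shf x)) k ∪ S := by
      intro S hS
      rw [arcI_succ]
      change (insert (x 2) _ ∪ S).erase (x 2) = _
      rw [Finset.insert_union, Finset.erase_insert (by simp [hS, hx2'])]
    have h0 := h.notMem (j := 0) (Or.inl rfl)
    rw [arcI_succ] at h0
    simp only [Finset.mem_insert, not_or] at h0
    have hh0 := h0.2
    have h0' : x 0 ∉ arcI (shf (shf x)) k := by
      have := hh0
      rw [arcI_succ] at this
      simp only [Finset.mem_insert, not_or] at this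
      exact this.2
    have e0 : ∀ S : Finset V, (arcI (shf x) (k + 1) ∪ S).erase (x 0) =
        arcI (shf x) (k + 1) ∪ S.erase (x 0) := fun S => erase_union_of_notMem hh0
    have m0 : ∀ S : Finset V, (x 0 ∈ arcI (shf x) (k + 1) ∪ S) ↔ x 0 ∈ S := by
      intro S; simp [hh0]
    have hA1 := hA' 1 (by omega) (by omega)
    have hB1 := hB' 1 (by omega) (by omega)
    have hA2 := hA' 2 (by omega) (by omega)
    have hB2 := hB' 2 (by omega) (by omega)
    have c1 := col_head hM h (A := arcI (shf x) (k + 1) ∪ A)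
      (B := arcI (shf x) (k + 1) ∪ B.erase (x 0)) (by simp [hB1, h.head_notMem])
    have c2 := col_head hM h (A := arcI (shf x) (k + 1) ∪ A)
      (B := arcI (shf (shf x)) k ∪ B) (by simp [hB1, hx1'])
    rw [sum_three _ h.ne01 h.ne12 h02] at c1 c2
    simp only [m0] at c1 c2
    have n1 : x 1 ∉ arcI (shf x) (k + 1) ∪ A := by simp [hA1, h.head_notMem]
    have n2 : x 2 ∈ arcI (shf x) (k + 1) ∪ A := by simp [hx2]
    rw [e0, e2 A hA2, if_neg n1, if_pos n2, ho, ho0] at c1 c2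
    -- dangling and forced pieces
    have d1 := Per_dangling hM (k + 1) (shf x) A B hs (fun i hi => hA' (i + 1) (by omega) (by omega))
      (fun i hi => hB' (i + 1) (by omega) (by omega))
    have d2 := Per_dangling hM (k + 1) (shf x) (A.erase (x 0)) (B.erase (x 0)) hs
      (fun i hi hm => hA' (i + 1) (by omega) (by omega) (Finset.mem_of_mem_erase hm))
      (fun i hi hm => hB' (i + 1) (by omega) (by omega) (Finset.mem_of_mem_erase hm))
    have d3 := Per_dangling hM k (shf (shf x)) A B hss
      (fun i hi => hA' (i + 2) (by omega) (by omega))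
      (fun i hi => hB' (i + 2) (by omega) (by omega))
    have f1 := Per_forced hM k (shf x) (A.erase (x 0)) B hs
      (fun i hi _ hm => hA' (i + 1) (by omega) (by omega) (Finset.mem_of_mem_erase hm))
      (fun i hi hm => hB' (i + 1) (by omega) (by omega) hm)
    have f2 := Per_forced hM k (shf x) (B.erase (x 0)) A hs
      (fun i hi _ hm => hB' (i + 1) (by omega) (by omega) (Finset.mem_of_mem_erase hm))
      (fun i hi hm => hA' (i + 1) (by omega) (by omega) hm)
    rw [Per_symm M hM, Per_symm M hM (B.erase (x 0))] at f2
    rw [d2, f2] at c1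
    rw [d3, f1] at c2
    rw [arcI_succ, Finset.insert_union, Finset.insert_union,
      row_head hM h (by simp [hA1, h.head_notMem]), sum_three _ h.ne01 h.ne12 h02,
      if_pos (Finset.mem_insert_self _ _), hd, ho, ho0,
      Finset.erase_insert (by simp [hB1, h.head_notMem]), d1,
      if_pos (by simp [hx2] : x 2 ∈ insert (x 1) (arcI (shf x) (k + 1) ∪ B)),
      Finset.erase_insert_of_ne h.ne12, e2 B hB2, c2,
      Finset.erase_insert_of_ne h.ne01.symm, e0, c1]
    have m0' : (x 0 ∈ insert (x 1) (arcI (shf x) (k + 1) ∪ B)) ↔ x 0 ∈ B := by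
      simp [hh0, h.ne01]
    simp only [m0']
    simp only [pp, Qm, shf]
    by_cases a1 : x 0 ∈ A <;> by_cases a2 : x 0 ∈ B <;> by_cases a3 : x (k + 1 + 2) ∈ A <;>
      by_cases a4 : x (k + 1 + 2) ∈ B <;> by_cases a5 : x (k + 1 + 2) = x 0 <;>
      simp [a1, a2, a3, a4, a5] <;> ring
end


/-! ### Arcs in graphs -/

/-- The transformed matrix, over `ℤ[X]`. -/
def gM {V : Type*} [Fintype V] (G : SimpleGraph V) : V → V → ℤ[X] := fun i j =>
  if i = j then 1 - X ^ 2 + X * ((G.degree i : ℤ[X]) - 2) else if G.Adj i j then X else 0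

theorem gM_symm {V : Type*} [Fintype V] (G : SimpleGraph V) (i j : V) : gM G i j = gM G j i := by
  unfold gM
  by_cases h : i = j
  · subst h; rfl
  · simp [h, Ne.symm h, G.adj_comm]

structure GArc {V : Type*} [Fintype V] (G : SimpleGraph V) (x : ℕ → V) (k : ℕ) : Prop where
  inj : ∀ i j, i < k → j ≤ k + 1 → x (i + 1) = x j → i + 1 = j
  deg : ∀ i, i < k → G.degree (x (i + 1)) = 2
  nb : ∀ i, i < k → ∀ z, G.Adj (x (i + 1)) z ↔ z = x i ∨ z = x (i + 2)
  adj : ∀ i, i ≤ k → G.Adj (x i) (x (i + 1))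

section
variable {V : Type*} [Fintype V] {G : SimpleGraph V}

theorem GArc.toMArc {x : ℕ → V} {k : ℕ} (h : GArc G x k) : MArc (gM G) (1 - X ^ 2) X x k where
  inj := h.inj
  diag i hi := by simp [gM, h.deg i hi]
  off i hi := by
    have := h.adj i hi
    simp [gM, this, this.ne]
  zero i hi z h1 h2 h3 := by
    have : ¬ G.Adj (x (i + 1)) z := by rw [h.nb i hi]; tauto
    simp [gM, this, h1.symm]

theorem card_arcI {x : ℕ → V} {k : ℕ} (h : GArc G x k) : (arcI x k).card = k := by
  unfold arcI
  rw [Finset.card_image_of_injOn]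
  · simp
  · intro i hi j hj e
    simp at hi hj
    have := h.inj i (j + 1) hi (by omega) e
    omega

theorem other_nb {c y : V} (hd : G.degree c = 2) (hy : G.Adj c y) :
    ∃ z, z ≠ y ∧ ∀ t, G.Adj c t ↔ t = y ∨ t = z := by
  rw [← SimpleGraph.card_neighborFinset_eq_degree, Finset.card_eq_two] at hd
  obtain ⟨a, b, hab, e⟩ := hd
  have key : ∀ t, G.Adj c t ↔ t = a ∨ t = b := by
    intro t
    rw [← SimpleGraph.mem_neighborFinset, e]; simp
  rcases (key y).1 hy with rfl | rfl
  · exact ⟨b, hab.symm, key⟩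
  · exact ⟨a, hab, fun t => by rw [key]; tauto⟩

theorem GArc.loop_two {x : ℕ → V} {k : ℕ} (h : GArc G x k) (hk : 1 ≤ k) (e : x (k + 1) = x 0) :
    2 ≤ k := by
  by_contra hc
  obtain rfl : k = 1 := by omega
  have hd := h.deg 0 (by omega)
  have hn := h.nb 0 (by omega)
  obtain ⟨z, hz, hz'⟩ := other_nb hd (h.adj 0 (by omega)).symm
  have := (hn z).1 ((hz' z).2 (Or.inr rfl))
  simp only [zero_add] at this e
  rw [e] at this
  tauto

theorem trace_step {C T : Finset V} (hCT : ∀ c ∈ C, c ∉ T)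
    (hC : ∀ c ∈ C, G.degree c = 2 ∧ ∀ z, G.Adj c z → z ∈ C ∨ z ∈ T)
    {a n : V} (ha : a ∈ T) (hn : n ∈ C) (han : G.Adj a n) (m : ℕ) :
    (∃ k x, 1 ≤ k ∧ GArc G x k ∧ x 0 = a ∧ x (k + 1) ∈ T ∧ ∀ i, i < k → x (i + 1) ∈ C) ∨
    (∃ x : ℕ → V, x 0 = a ∧ (∀ i, i ≤ m → x (i + 1) ∈ C) ∧
      (∀ i j, i ≤ m → j ≤ m → x (i + 1) = x (j + 1) → i = j) ∧
      (∀ i, i < m → ∀ z, G.Adj (x (i + 1)) z ↔ z = x i ∨ z = x (i + 2)) ∧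
      (∀ i, i ≤ m → G.Adj (x i) (x (i + 1)))) := by
  induction m with
  | zero =>
    right
    refine ⟨fun i => if i = 0 then a else n, rfl, ?_, ?_, ?_, ?_⟩
    · intro i _; simpa using hn
    · intro i j hi hj _; omega
    · intro i hi; omega
    · intro i hi
      obtain rfl : i = 0 := by omega
      simpa using han
  | succ m ih =>
    rcases ih with h | ⟨x, x0, hxC, hinj, hnb, hadj⟩
    · exact Or.inl h
    have hm := hxC m le_rfl
    obtain ⟨y, hy, hyn⟩ := other_nb (hC _ hm).1 (hadj m le_rfl).symm
    have hya : G.Adj (x (m + 1)) y := (hyn y).2 (Or.inr rfl)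
    set x' : ℕ → V := fun i => if i = m + 2 then y else x i with hx'
    have ex : ∀ i, i ≤ m + 1 → x' i = x i := fun i hi => by simp only [hx']; rw [if_neg (by omega)]
    have ey : x' (m + 2) = y := by simp [hx']
    have nb' : ∀ i, i < m + 1 → ∀ z, G.Adj (x' (i + 1)) z ↔ z = x' i ∨ z = x' (i + 2) := by
      intro i hi z
      rw [ex (i + 1) (by omega), ex i (by omega)]
      rcases Nat.lt_or_ge i m with h | h
      · rw [ex (i + 2) (by omega)]; exact hnb i h z
      · obtain rfl : i = m := by omega
        rw [ey]; exact hyn z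
    have adj' : ∀ i, i ≤ m + 1 → G.Adj (x' i) (x' (i + 1)) := by
      intro i hi
      rw [ex i (by omega)]
      rcases Nat.lt_or_ge i (m + 1) with h | h
      · rw [ex (i + 1) (by omega)]; exact hadj i (by omega)
      · obtain rfl : i = m + 1 := by omega
        rw [ey]; exact hya
    by_cases hyT : y ∈ T
    · left
      refine ⟨m + 1, x', by omega, ⟨?_, ?_, nb', adj'⟩, ?_, ?_, ?_⟩
      · intro i j hi hj e
        rw [ex (i + 1) (by omega)] at e
        rcases Nat.lt_or_ge j (m + 2) with h | h
        · rw [ex j (by omega)] at e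
          rcases j with _ | j
          · rw [x0] at e
            have := hxC i (by omega)
            rw [e] at this
            exact absurd ha (hCT _ this)
          · have := hinj i j (by omega) (by omega) e
            omega
        · obtain rfl : j = m + 2 := by omega
          rw [ey] at e
          have := hxC i (by omega)
          rw [e] at this
          exact absurd hyT (hCT _ this)
      · intro i hi
        rw [ex (i + 1) (by omega)]; exact (hC _ (hxC i (by omega))).1
      · rw [ex 0 (by omega), x0]
      · rw [ey]; exact hyT
      · intro i hi; rw [ex (i + 1) (by omega)]; exact hxC i (by omega)
    · right
      have hyC : y ∈ C := ((hC _ hm).2 y hya).resolve_right hyT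
      have hne : ∀ j, j ≤ m → x (j + 1) ≠ y := by
        intro j hj e
        rcases Nat.lt_or_ge j m with h | h
        · have h1 : G.Adj (x (j + 1)) (x (m + 1)) := by rw [e]; exact hya.symm
          rcases (hnb j h _).1 h1 with e1 | e1
          · rcases j with _ | j
            · rw [x0] at e1; rw [e1] at hm; exact hCT _ hm ha
            · have := hinj m j le_rfl (by omega) e1; omega
          · have := hinj m (j + 1) le_rfl (by omega) e1
            subst this
            exact hy e.symm
        · obtain rfl : j = m := by omega
          exact hya.ne e
      refine ⟨x', by rw [ex 0 (by omega), x0], ?_, ?_, nb', adj'⟩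
      · intro i hi
        rcases Nat.lt_or_ge i (m + 1) with h | h
        · rw [ex (i + 1) (by omega)]; exact hxC i (by omega)
        · obtain rfl : i = m + 1 := by omega
          rw [ey]; exact hyC
      · intro i j hi hj e
        rcases Nat.lt_or_ge i (m + 1) with h | h <;> rcases Nat.lt_or_ge j (m + 1) with h' | h'
        · rw [ex (i + 1) (by omega), ex (j + 1) (by omega)] at e
          exact hinj i j (by omega) (by omega) e
        · obtain rfl : j = m + 1 := by omega
          rw [ex (i + 1) (by omega), ey] at e
          exact absurd e (hne i (by omega))
        · obtain rfl : i = m + 1 := by omega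
          rw [ex (j + 1) (by omega), ey] at e
          exact absurd e.symm (hne j (by omega))
        · omega

theorem trace_arc {C T : Finset V} (hCT : ∀ c ∈ C, c ∉ T)
    (hC : ∀ c ∈ C, G.degree c = 2 ∧ ∀ z, G.Adj c z → z ∈ C ∨ z ∈ T)
    {a n : V} (ha : a ∈ T) (hn : n ∈ C) (han : G.Adj a n) :
    ∃ k x, 1 ≤ k ∧ GArc G x k ∧ x 0 = a ∧ x (k + 1) ∈ T ∧ ∀ i, i < k → x (i + 1) ∈ C := by
  rcases trace_step hCT hC ha hn han C.card with h | ⟨x, x0, hxC, hinj, -, -⟩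
  · exact h
  · exfalso
    have : (Finset.range (C.card + 1)).card ≤ C.card := by
      refine Finset.card_le_card_of_injOn (fun i => x (i + 1)) ?_ ?_
      · intro i hi
        simp at hi
        exact hxC i (by omega)
      · intro i hi j hj e
        simp at hi hj
        exact hinj i j (by omega) (by omega) e
    simp at this
end


/-! ### Transfer of permanents along arcs -/

theorem pp_closed (n : ℕ) : (1 + X ^ 2) * pp (1 - X ^ 2 : ℤ[X]) X n = 1 - (-X ^ 2) ^ n := by
  induction n using Nat.twoStepInduction with
  | zero => simp [pp]
  | one => simp [pp]
  | more n h1 h2 =>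
    have : pp (1 - X ^ 2 : ℤ[X]) X (n + 2) =
      (1 - X ^ 2) * pp (1 - X ^ 2 : ℤ[X]) X (n + 1) + X ^ 2 * pp (1 - X ^ 2 : ℤ[X]) X n := rfl
    rw [this]
    linear_combination (1 - X ^ 2) * h2 + X ^ 2 * h1

/-- `I` is the interior of an arc from `a` to `b` with `k` interior vertices. -/
def UArc {V : Type*} [Fintype V] (G : SimpleGraph V) (a b : V) (k : ℕ) (I : Finset V) : Prop :=
  ∃ x : ℕ → V, GArc G x k ∧ x 0 = a ∧ x (k + 1) = b ∧ arcI x k = I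

@[ext] structure V5 where
  a1 : ℤ[X]
  a2 : ℤ[X]
  a3 : ℤ[X]
  a4 : ℤ[X]
  a5 : ℤ[X]

def V5.mul (c : ℤ[X]) (b : V5) : V5 := ⟨c * b.a1, c * b.a2, c * b.a3, c * b.a4, c * b.a5⟩

/-- Transfer for an arc joining the two branch vertices. -/
def tUV (E F : ℤ[X]) (b : V5) : V5 where
  a1 := (1 + X ^ 2 * E) * b.a1 + X ^ 2 * (1 - E) * (b.a2 + b.a3) + (X ^ 4 + X ^ 2 * E) * b.a4 +
    2 * (1 + X ^ 2) * F * b.a5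
  a2 := (1 + X ^ 2 * E) * b.a2 + X ^ 2 * (1 - E) * b.a4
  a3 := (1 + X ^ 2 * E) * b.a3 + X ^ 2 * (1 - E) * b.a4
  a4 := (1 + X ^ 2 * E) * b.a4
  a5 := (1 + X ^ 2 * E) * b.a5 + (1 + X ^ 2) * F * b.a4

def tU (E F : ℤ[X]) (b : V5) : V5 where
  a1 := (1 + X ^ 2 * E) * b.a1 + 2 * (X ^ 2 * (1 - E) + (1 + X ^ 2) * F) * b.a2
  a2 := (1 + X ^ 2 * E) * b.a2
  a3 := (1 + X ^ 2 * E) * b.a3 + 2 * (X ^ 2 * (1 - E) + (1 + X ^ 2) * F) * b.a4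
  a4 := (1 + X ^ 2 * E) * b.a4
  a5 := (1 + X ^ 2 * E) * b.a5

def tV (E F : ℤ[X]) (b : V5) : V5 where
  a1 := (1 + X ^ 2 * E) * b.a1 + 2 * (X ^ 2 * (1 - E) + (1 + X ^ 2) * F) * b.a3
  a2 := (1 + X ^ 2 * E) * b.a2 + 2 * (X ^ 2 * (1 - E) + (1 + X ^ 2) * F) * b.a4
  a3 := (1 + X ^ 2 * E) * b.a3
  a4 := (1 + X ^ 2 * E) * b.a4
  a5 := (1 + X ^ 2 * E) * b.a5

section
variable {V : Type*} [Fintype V] {G : SimpleGraph V}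

theorem UArc.Per_eq {a b : V} {k : ℕ} {I : Finset V} (h : UArc G a b k I) (hk : 1 ≤ k)
    (A B : Finset V) (hA : ∀ z ∈ I, z ∉ A) (hB : ∀ z ∈ I, z ∉ B) :
    (1 + X ^ 2) * Per (gM G) (I ∪ A) (I ∪ B) =
      (1 + X ^ 2 * (-X ^ 2) ^ k) * Per (gM G) A B +
      X ^ 2 * (1 - (-X ^ 2) ^ k) * (Qm (gM G) a a A B + Qm (gM G) b b A B) +
      (X ^ 4 + X ^ 2 * (-X ^ 2) ^ k) * (if a ∈ A ∧ a ∈ B then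
        Qm (gM G) b b (A.erase a) (B.erase a) else 0) +
      (1 + X ^ 2) * X ^ (k + 1) * (Qm (gM G) a b A B + Qm (gM G) b a A B) := by
  obtain ⟨x, hx, rfl, rfl, rfl⟩ := h
  obtain ⟨m, rfl⟩ : ∃ m, k = m + 1 := ⟨k - 1, by omega⟩
  have hab : x 0 ≠ x (m + 2) ∨ 1 ≤ m := by
    by_cases e : x (m + 2) = x 0
    · right; have := hx.loop_two hk e; omega
    · left; exact Ne.symm e
  rw [Per_arc (gM_symm G) m x A B hx.toMArc hab hA hB]
  have p0 := pp_closed m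
  have p1 := pp_closed (m + 1)
  have p2 := pp_closed (m + 2)
  linear_combination Per (gM G) A B * p2 +
    X ^ 2 * (Qm (gM G) (x 0) (x 0) A B + Qm (gM G) (x (m + 2)) (x (m + 2)) A B) * p1 +
    X ^ 4 * (if x 0 ∈ A ∧ x 0 ∈ B then
        Qm (gM G) (x (m + 2)) (x (m + 2)) (A.erase (x 0)) (B.erase (x 0)) else 0) * p0

variable (G) in
def vec (u v : V) (C : Finset V) : V5 where
  a1 := Per (gM G) (insert u (insert v C)) (insert u (insert v C))
  a2 := Per (gM G) (insert v C) (insert v C)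
  a3 := Per (gM G) (insert u C) (insert u C)
  a4 := Per (gM G) C C
  a5 := Per (gM G) (insert v C) (insert u C)

theorem ins_union (u : V) (I C : Finset V) : insert u (I ∪ C) = I ∪ insert u C := by
  ext; simp

theorem vec_UV {u v : V} (huv : u ≠ v) {k : ℕ} {I C : Finset V} (h : UArc G u v k I) (hk : 1 ≤ k)
    (uI : u ∉ I) (vI : v ∉ I) (uC : u ∉ C) (vC : v ∉ C) (hIC : Disjoint I C) :
    (vec G u v (I ∪ C)).mul (1 + X ^ 2) = tUV ((-X ^ 2) ^ k) (X ^ (k + 1)) (vec G u v C) := by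
  have hd : ∀ z ∈ I, z ∉ C := fun z hz => Finset.disjoint_left.1 hIC hz
  have hu : ∀ z ∈ I, z ≠ u := fun z hz e => uI (e ▸ hz)
  have hv : ∀ z ∈ I, z ≠ v := fun z hz e => vI (e ▸ hz)
  have h1 : ∀ z ∈ I, z ∉ insert u C := fun z hz => by simp [hu z hz, hd z hz]
  have h2 : ∀ z ∈ I, z ∉ insert v C := fun z hz => by simp [hv z hz, hd z hz]
  have h3 : ∀ z ∈ I, z ∉ insert u (insert v C) := fun z hz => by simp [hu z hz, h2 z hz, hd z hz, hv z hz]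
  have e1 : (insert u (insert v C)).erase v = insert u C := by
    rw [Finset.erase_insert_of_ne huv, Finset.erase_insert vC]
  have e2 : (insert u (insert v C)).erase u = insert v C := by
    rw [Finset.erase_insert (by simp [huv, uC])]
  have e3 : (insert u C).erase u = C := Finset.erase_insert uC
  have e4 : (insert v C).erase v = C := Finset.erase_insert vC
  have s5 : Per (gM G) (insert u C) (insert v C) = Per (gM G) (insert v C) (insert u C) :=
    Per_symm _ (gM_symm G) _ _
  ext1 <;> simp only [vec, V5.mul, tUV, ins_union]
  · rw [h.Per_eq hk _ _ h3 h3]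
    simp [Qm, e1, e2, e4, s5]; ring
  · rw [h.Per_eq hk _ _ h2 h2]
    simp [Qm, e4, huv, uC]
  · rw [h.Per_eq hk _ _ h1 h1]
    simp [Qm, e3, huv.symm, vC]
  · rw [h.Per_eq hk _ _ hd hd]
    simp [Qm, uC, vC]
  · rw [h.Per_eq hk _ _ h2 h1]
    simp [Qm, uC, vC, e3, e4, huv, huv.symm]

theorem vec_U {u v : V} (huv : u ≠ v) {k : ℕ} {I C : Finset V} (h : UArc G u u k I) (hk : 1 ≤ k)
    (uI : u ∉ I) (vI : v ∉ I) (uC : u ∉ C) (vC : v ∉ C) (hIC : Disjoint I C) :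
    (vec G u v (I ∪ C)).mul (1 + X ^ 2) = tU ((-X ^ 2) ^ k) (X ^ (k + 1)) (vec G u v C) := by
  have hd : ∀ z ∈ I, z ∉ C := fun z hz => Finset.disjoint_left.1 hIC hz
  have hu : ∀ z ∈ I, z ≠ u := fun z hz e => uI (e ▸ hz)
  have hv : ∀ z ∈ I, z ≠ v := fun z hz e => vI (e ▸ hz)
  have h1 : ∀ z ∈ I, z ∉ insert u C := fun z hz => by simp [hu z hz, hd z hz]
  have h2 : ∀ z ∈ I, z ∉ insert v C := fun z hz => by simp [hv z hz, hd z hz]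
  have h3 : ∀ z ∈ I, z ∉ insert u (insert v C) := fun z hz => by simp [hu z hz, h2 z hz, hd z hz, hv z hz]
  have e2 : (insert u (insert v C)).erase u = insert v C := by
    rw [Finset.erase_insert (by simp [huv, uC])]
  have e3 : (insert u C).erase u = C := Finset.erase_insert uC
  have e4 : (insert v C).erase v = C := Finset.erase_insert vC
  ext1 <;> simp only [vec, V5.mul, tU, ins_union]
  · rw [h.Per_eq hk _ _ h3 h3]
    simp [Qm, e2, huv, uC]; ring
  · rw [h.Per_eq hk _ _ h2 h2]
    simp [Qm, huv, uC]
  · rw [h.Per_eq hk _ _ h1 h1]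
    simp [Qm, e3, uC]; ring
  · rw [h.Per_eq hk _ _ hd hd]
    simp [Qm, uC]
  · rw [h.Per_eq hk _ _ h2 h1]
    simp [Qm, uC, huv]

theorem vec_V {u v : V} (huv : u ≠ v) {k : ℕ} {I C : Finset V} (h : UArc G v v k I) (hk : 1 ≤ k)
    (uI : u ∉ I) (vI : v ∉ I) (uC : u ∉ C) (vC : v ∉ C) (hIC : Disjoint I C) :
    (vec G u v (I ∪ C)).mul (1 + X ^ 2) = tV ((-X ^ 2) ^ k) (X ^ (k + 1)) (vec G u v C) := by
  have hd : ∀ z ∈ I, z ∉ C := fun z hz => Finset.disjoint_left.1 hIC hz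
  have hu : ∀ z ∈ I, z ≠ u := fun z hz e => uI (e ▸ hz)
  have hv : ∀ z ∈ I, z ≠ v := fun z hz e => vI (e ▸ hz)
  have h1 : ∀ z ∈ I, z ∉ insert u C := fun z hz => by simp [hu z hz, hd z hz]
  have h2 : ∀ z ∈ I, z ∉ insert v C := fun z hz => by simp [hv z hz, hd z hz]
  have h3 : ∀ z ∈ I, z ∉ insert u (insert v C) := fun z hz => by simp [hu z hz, h2 z hz, hd z hz, hv z hz]
  have e1 : (insert u (insert v C)).erase v = insert u C := by
    rw [Finset.erase_insert_of_ne huv, Finset.erase_insert vC]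
  have e3 : (insert u C).erase u = C := Finset.erase_insert uC
  have e4 : (insert v C).erase v = C := Finset.erase_insert vC
  ext1 <;> simp only [vec, V5.mul, tV, ins_union]
  · rw [h.Per_eq hk _ _ h3 h3]
    simp [Qm, e1, huv.symm, vC]; ring
  · rw [h.Per_eq hk _ _ h2 h2]
    simp [Qm, e4, vC]; ring
  · rw [h.Per_eq hk _ _ h1 h1]
    simp [Qm, huv.symm, vC]
  · rw [h.Per_eq hk _ _ hd hd]
    simp [Qm, vC]
  · rw [h.Per_eq hk _ _ h2 h1]
    simp [Qm, vC, huv.symm]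

theorem Per_isol {z : V} {A B : Finset V} (hA : z ∉ A) (hB : z ∉ B)
    (h : ∀ c ∈ B, ¬ G.Adj z c) :
    Per (gM G) (insert z A) (insert z B) = gM G z z * Per (gM G) A B := by
  rw [Per_insert_row _ hA, Finset.sum_insert hB, Finset.erase_insert hB, Finset.sum_eq_zero,
    add_zero]
  intro c hc
  have : gM G z c = 0 := by
    have : z ≠ c := fun e => hB (e ▸ hc)
    simp [gM, this, h c hc]
  rw [this, zero_mul]

theorem vec_base {u v : V} (huv : u ≠ v) {C : Finset V} (uC : u ∉ C) (vC : v ∉ C)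
    (hu : ∀ c ∈ C, ¬ G.Adj u c) (hv : ∀ c ∈ C, ¬ G.Adj v c)
    (du : G.degree u = 3) (dv : G.degree v = 3) :
    vec G u v C = V5.mul (Per (gM G) C C)
      ⟨(1 - X ^ 2 + X) ^ 2 + gM G u v ^ 2, 1 - X ^ 2 + X, 1 - X ^ 2 + X, 1, gM G u v⟩ := by
  have du' : gM G u u = 1 - X ^ 2 + X := by simp [gM, du]; ring
  have dv' : gM G v v = 1 - X ^ 2 + X := by simp [gM, dv]; ring
  have h5 : Per (gM G) (insert v C) (insert u C) = gM G u v * Per (gM G) C C := by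
    rw [Per_insert_row _ vC, Finset.sum_insert uC, Finset.erase_insert uC, Finset.sum_eq_zero,
      add_zero, gM_symm]
    intro c hc
    have : gM G v c = 0 := by
      have : v ≠ c := fun e => vC (e ▸ hc)
      simp [gM, this, hv c hc]
    rw [this, zero_mul]
  have h2 := Per_isol (G := G) vC vC hv
  have h3 := Per_isol (G := G) uC uC hu
  have e1 : (insert u (insert v C)).erase v = insert u C := by
    rw [Finset.erase_insert_of_ne huv, Finset.erase_insert vC]
  have uvC : u ∉ insert v C := by simp [huv, uC]
  ext1 <;> simp only [vec, V5.mul]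
  · rw [Per_insert_row _ uvC, Finset.sum_insert uvC, Finset.erase_insert uvC,
      Finset.sum_insert vC, e1, Finset.sum_eq_zero, h2, h5, du', dv']
    · ring
    intro c hc
    have : gM G u c = 0 := by
      have : u ≠ c := fun e => uC (e ▸ hc)
      simp [gM, this, hu c hc]
    rw [this, zero_mul]
  · rw [h2, dv']; ring
  · rw [h3, du']; ring
  · ring
  · rw [h5]; ring
end

/-! ### Decompositions -/

def Link {V : Type*} [Fintype V] (G : SimpleGraph V) (u v : V) (L : ℕ) (I : Finset V) : Prop :=
  (L = 1 ∧ G.Adj u v ∧ I = ∅) ∨ (2 ≤ L ∧ ¬ G.Adj u v ∧ UArc G u v (L - 1) I)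

def Closed2 {V : Type*} [Fintype V] (G : SimpleGraph V) (C : Finset V) : Prop :=
  ∀ c ∈ C, G.degree c = 2 ∧ ∀ z, G.Adj c z → z ∈ C

structure Split {V : Type*} [Fintype V] (G : SimpleGraph V) (u v : V)
    (I1 I2 I3 C : Finset V) : Prop where
  ne : u ≠ v
  du : G.degree u = 3
  dv : G.degree v = 3
  u1 : u ∉ I1 ∪ (I2 ∪ (I3 ∪ C))
  v1 : v ∉ I1 ∪ (I2 ∪ (I3 ∪ C))
  d1 : Disjoint I1 (I2 ∪ (I3 ∪ C))
  d2 : Disjoint I2 (I3 ∪ C)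
  d3 : Disjoint I3 C
  all : insert u (insert v (I1 ∪ (I2 ∪ (I3 ∪ C)))) = Finset.univ
  closed : Closed2 G C

def bvec : V5 := ⟨(1 - X ^ 2 + X) ^ 2, 1 - X ^ 2 + X, 1 - X ^ 2 + X, 1, 0⟩

section
variable {V : Type*} [Fintype V] {G : SimpleGraph V} {u v : V} {I1 I2 I3 C : Finset V}

theorem V5.mul_mul (a b : ℤ[X]) (c : V5) : V5.mul a (V5.mul b c) = V5.mul (a * b) c := by
  ext1 <;> simp only [V5.mul] <;> ring

theorem tUV_mul (E F a : ℤ[X]) (c : V5) : tUV E F (V5.mul a c) = V5.mul a (tUV E F c) := by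
  ext1 <;> simp only [V5.mul, tUV] <;> ring
theorem tU_mul (E F a : ℤ[X]) (c : V5) : tU E F (V5.mul a c) = V5.mul a (tU E F c) := by
  ext1 <;> simp only [V5.mul, tU] <;> ring
theorem tV_mul (E F a : ℤ[X]) (c : V5) : tV E F (V5.mul a c) = V5.mul a (tV E F c) := by
  ext1 <;> simp only [V5.mul, tV] <;> ring

theorem Split.link (h : Split G u v I1 I2 I3 C) {L : ℕ} (hL : Link G u v L I3) :
    (vec G u v (I3 ∪ C)).mul (1 + X ^ 2) =
      V5.mul (Per (gM G) C C) (tUV ((-X ^ 2) ^ (L - 1)) (X ^ L) bvec) := by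
  have hu := h.u1
  have hv := h.v1
  simp only [Finset.mem_union, not_or] at hu hv
  have nu : ∀ c ∈ C, ¬ G.Adj u c := fun c hc ha => hu.2.2.2 ((h.closed c hc).2 _ ha.symm)
  have nv : ∀ c ∈ C, ¬ G.Adj v c := fun c hc ha => hv.2.2.2 ((h.closed c hc).2 _ ha.symm)
  have hb := vec_base h.ne hu.2.2.2 hv.2.2.2 nu nv h.du h.dv
  rcases hL with ⟨rfl, ha, rfl⟩ | ⟨h2, ha, hA⟩
  · have : gM G u v = X := by simp [gM, h.ne, ha]
    rw [Finset.empty_union, hb, this]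
    ext1 <;> simp only [V5.mul, tUV, bvec, Nat.sub_self, pow_zero] <;> ring
  · have : gM G u v = 0 := by simp [gM, h.ne, ha]
    rw [vec_UV h.ne hA (by omega) hu.2.2.1 hv.2.2.1 hu.2.2.2 hv.2.2.2 h.d3, hb, this, tUV_mul]
    congr 2
    · congr 1; omega
    · simp [bvec]

/-- `d`-type decomposition. -/
def DDec (G : SimpleGraph V) (u v : V) (p q L : ℕ) (I1 I2 I3 C : Finset V) : Prop :=
  Split G u v I1 I2 I3 C ∧ 3 ≤ p ∧ 3 ≤ q ∧ UArc G u u (p - 1) I1 ∧ UArc G v v (q - 1) I2 ∧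
    Link G u v L I3

/-- `θ`-type decomposition. -/
def TDec (G : SimpleGraph V) (u v : V) (l1 l2 l3 : ℕ) (I1 I2 I3 C : Finset V) : Prop :=
  Split G u v I1 I2 I3 C ∧ 2 ≤ l1 ∧ 2 ≤ l2 ∧ UArc G u v (l1 - 1) I1 ∧ UArc G u v (l2 - 1) I2 ∧
    Link G u v l3 I3

end

def hA (p : ℕ) : ℤ[X] := (1 + X + 2 * X ^ 2) + 2 * (1 + X ^ 2) * X ^ p + (1 - X) * (-X ^ 2) ^ p
def hB (p : ℕ) : ℤ[X] := X * (1 + X) + 2 * (1 + X ^ 2) * X ^ p + (2 - X + X ^ 2) * (-X ^ 2) ^ p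
def hD (p q L : ℕ) : ℤ[X] := hA p * hA q - (-X ^ 2) ^ L * (hB p * hB q)
def hT (a b c : ℕ) : ℤ[X] := (1 + X + 2 * X ^ 2) ^ 2
  - X ^ 2 * (1 + X) ^ 2 * ((-X ^ 2) ^ a + (-X ^ 2) ^ b + (-X ^ 2) ^ c)
  + (1 - X) ^ 2 * ((-X ^ 2) ^ (a + b) + (-X ^ 2) ^ (a + c) + (-X ^ 2) ^ (b + c))
  - (2 - X + X ^ 2) ^ 2 * (-X ^ 2) ^ (a + b + c)
  + 2 * (1 + X ^ 2) ^ 2 * (X ^ (a + b) * (1 - (-X ^ 2) ^ c) + X ^ (a + c) * (1 - (-X ^ 2) ^ b)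
    + X ^ (b + c) * (1 - (-X ^ 2) ^ a))

section
variable {V : Type*} [Fintype V] {G : SimpleGraph V} {u v : V} {I1 I2 I3 C : Finset V}

theorem Link.pos {L : ℕ} (h : Link G u v L I3) : 1 ≤ L := by
  rcases h with h | h <;> omega

theorem DDec.formula {p q L : ℕ} (h : DDec G u v p q L I1 I2 I3 C) :
    (1 + X ^ 2) ^ 3 * Per (gM G) Finset.univ Finset.univ = hD p q L * Per (gM G) C C := by
  obtain ⟨h, hp, hq, a1, a2, hL⟩ := h
  have hu := h.u1
  have hv := h.v1
  simp only [Finset.mem_union, not_or] at hu hv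
  have hl := h.link hL
  have e2 := vec_V h.ne a2 (by omega) hu.2.1 hv.2.1 (C := I3 ∪ C) (by simp [hu]) (by simp [hv]) h.d2
  have e1 := vec_U h.ne a1 (by omega) hu.1 hv.1 (C := I2 ∪ (I3 ∪ C)) (by simp [hu]) (by simp [hv]) h.d1
  have e3 : V5.mul ((1 + X ^ 2) ^ 3) (vec G u v (I1 ∪ (I2 ∪ (I3 ∪ C)))) =
      V5.mul (Per (gM G) C C) (tU ((-X ^ 2) ^ (p - 1)) (X ^ (p - 1 + 1)) (tV ((-X ^ 2) ^ (q - 1)) (X ^ (q - 1 + 1))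
        (tUV ((-X ^ 2) ^ (L - 1)) (X ^ L) bvec))) := by
    rw [show ((1 + X ^ 2 : ℤ[X]) ^ 3) = (1 + X ^ 2) * ((1 + X ^ 2) * (1 + X ^ 2)) by ring,
      ← V5.mul_mul, ← V5.mul_mul, e1, ← tU_mul, e2, ← tU_mul, ← tV_mul, hl, tV_mul, tU_mul]
  have e4 := congrArg V5.a1 e3
  simp only [vec, V5.mul, h.all] at e4
  rw [e4, mul_comm]
  congr 1
  obtain ⟨L, rfl⟩ : ∃ m, L = m + 1 := ⟨L - 1, by have := hL.pos; omega⟩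
  obtain ⟨p, rfl⟩ : ∃ m, p = m + 1 := ⟨p - 1, by omega⟩
  obtain ⟨q, rfl⟩ : ∃ m, q = m + 1 := ⟨q - 1, by omega⟩
  simp only [tU, tV, tUV, bvec, Nat.add_sub_cancel, hD, hA, hB]
  ring

theorem TDec.formula {a b c : ℕ} (h : TDec G u v a b c I1 I2 I3 C) :
    (1 + X ^ 2) ^ 3 * Per (gM G) Finset.univ Finset.univ = hT a b c * Per (gM G) C C := by
  obtain ⟨h, hp, hq, a1, a2, hL⟩ := h
  have hu := h.u1
  have hv := h.v1
  simp only [Finset.mem_union, not_or] at hu hv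
  have hl := h.link hL
  have e2 := vec_UV h.ne a2 (by omega) hu.2.1 hv.2.1 (C := I3 ∪ C) (by simp [hu]) (by simp [hv]) h.d2
  have e1 := vec_UV h.ne a1 (by omega) hu.1 hv.1 (C := I2 ∪ (I3 ∪ C)) (by simp [hu]) (by simp [hv]) h.d1
  have e3 : V5.mul ((1 + X ^ 2) ^ 3) (vec G u v (I1 ∪ (I2 ∪ (I3 ∪ C)))) =
      V5.mul (Per (gM G) C C) (tUV ((-X ^ 2) ^ (a - 1)) (X ^ (a - 1 + 1)) (tUV ((-X ^ 2) ^ (b - 1)) (X ^ (b - 1 + 1))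
        (tUV ((-X ^ 2) ^ (c - 1)) (X ^ c) bvec))) := by
    rw [show ((1 + X ^ 2 : ℤ[X]) ^ 3) = (1 + X ^ 2) * ((1 + X ^ 2) * (1 + X ^ 2)) by ring,
      ← V5.mul_mul, ← V5.mul_mul, e1, ← tUV_mul, e2, ← tUV_mul, ← tUV_mul, hl, tUV_mul, tUV_mul]
  have e4 := congrArg V5.a1 e3
  simp only [vec, V5.mul, h.all] at e4
  rw [e4, mul_comm]
  congr 1
  obtain ⟨c, rfl⟩ : ∃ m, c = m + 1 := ⟨c - 1, by have := hL.pos; omega⟩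
  obtain ⟨a, rfl⟩ : ∃ m, a = m + 1 := ⟨a - 1, by omega⟩
  obtain ⟨b, rfl⟩ : ∃ m, b = m + 1 := ⟨b - 1, by omega⟩
  simp only [tUV, bvec, Nat.add_sub_cancel, hT]
  ring
end


/-- Factor of an isolated cycle. -/
def cy (k : ℕ) : ℤ[X] := 1 + 2 * X ^ k + (-X ^ 2) ^ k

section
variable {V : Type*} [Fintype V] {G : SimpleGraph V}

theorem GArc.adj_int {x : ℕ → V} {k : ℕ} (h : GArc G x k) {z : V} (hz : z ∉ arcI x k)
    {t : V} (ht : t ∈ arcI x k) (ha : G.Adj z t) :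
    (z = x 0 ∧ t = x 1) ∨ (z = x (k + 1) ∧ t = x k) := by
  rw [mem_arcI] at ht
  obtain ⟨i, hi, rfl⟩ := ht
  rcases (h.nb i hi z).1 ha.symm with e | e
  · rcases i with _ | i
    · exact Or.inl ⟨e, rfl⟩
    · exact absurd (mem_arcI.2 ⟨i, by omega, e.symm⟩) hz
  · rcases Nat.lt_or_ge (i + 1) k with h1 | h1
    · exact absurd (mem_arcI.2 ⟨i + 1, h1, e.symm⟩) hz
    · obtain rfl : k = i + 1 := by omega
      exact Or.inr ⟨e, rfl⟩

theorem one_add_ne : (1 + X ^ 2 : ℤ[X]) ≠ 0 := by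
  intro h
  have := congrArg (eval 0) h
  simp at this

theorem closed_Per (n : ℕ) : ∀ C : Finset V, C.card = n → Closed2 G C →
    ∃ K : Multiset ℕ, (∀ k ∈ K, 3 ≤ k) ∧ K.sum = C.card ∧
      Per (gM G) C C = (K.map cy).prod := by
  induction n using Nat.strong_induction_on with
  | _ n ih =>
  intro C hn hC
  rcases C.eq_empty_or_nonempty with rfl | ⟨a, ha⟩
  · exact ⟨0, by simp, by simp, by simp [Per_empty]⟩
  obtain ⟨y, hy⟩ : ∃ y, G.Adj a y := by
    have : (G.neighborFinset a).Nonempty := by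
      rw [← Finset.card_pos, SimpleGraph.card_neighborFinset_eq_degree, (hC a ha).1]; omega
    obtain ⟨y, hy⟩ := this
    exact ⟨y, by simpa using hy⟩
  have hyC : y ∈ C.erase a := by
    simp [hy.ne', (hC a ha).2 y hy]
  obtain ⟨k, x, hk, hx, x0, xT, xC⟩ := trace_arc (G := G) (C := C.erase a) (T := {a})
    (by simp; tauto) (fun c hc => ⟨(hC c (Finset.mem_of_mem_erase hc)).1, fun z hz => by
      have := (hC c (Finset.mem_of_mem_erase hc)).2 z hz
      by_cases e : z = a <;> simp [e, this]⟩) (Finset.mem_singleton_self a) hyC hy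
  have xe : x (k + 1) = x 0 := by simpa [x0] using xT
  have hk2 := hx.loop_two hk xe
  have hI : ∀ z ∈ arcI x k, z ∈ C ∧ z ≠ a := by
    intro z hz
    obtain ⟨i, hi, rfl⟩ := mem_arcI.1 hz
    have := xC i hi
    simp at this
    exact ⟨this.2, this.1⟩
  have aI : a ∉ arcI x k := fun h => (hI a h).2 rfl
  set C' := C \ insert a (arcI x k) with hC'
  have aC' : a ∉ C' := by simp [hC']
  have nb_a : ∀ z, G.Adj a z → z ∈ arcI x k := by
    have h1 : x 1 ≠ x k := fun e => by
      have := hx.inj 0 k (by omega) (by omega) e; omega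
    have m1 : x 1 ∈ arcI x k := mem_arcI.2 ⟨0, by omega, rfl⟩
    have mk : x k ∈ arcI x k := mem_arcI.2 ⟨k - 1, by omega, by congr 1; omega⟩
    obtain ⟨z, hz, hz'⟩ := other_nb (hC a ha).1 (y := x 1) (by rw [← x0]; exact hx.adj 0 (by omega))
    have : x k = x 1 ∨ x k = z := (hz' (x k)).1 (by rw [← x0, ← xe]; exact (hx.adj k le_rfl).symm)
    have hzk : z = x k := (this.resolve_left h1.symm).symm
    intro t ht
    rcases (hz' t).1 ht with rfl | rfl
    · exact m1
    · rw [hzk]; exact mk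
  have hclosed : Closed2 G C' := by
    intro c hc
    have hc' : c ∈ C ∧ c ≠ a ∧ c ∉ arcI x k := by simpa [hC', not_or] using hc
    refine ⟨(hC c hc'.1).1, fun z hz => ?_⟩
    have hzC := (hC c hc'.1).2 z hz
    have z1 : z ≠ a := by rintro rfl; exact hc'.2.2 (nb_a c hz.symm)
    have z2 : z ∉ arcI x k := by
      intro h
      rcases hx.adj_int hc'.2.2 h hz with e | e
      · exact hc'.2.1 (e.1.trans x0)
      · exact hc'.2.1 (e.1.trans (xe.trans x0))
    simp [hC', hzC, z1, z2]
  have hCeq : C = arcI x k ∪ insert a C' := by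
    ext z
    simp only [hC', Finset.mem_union, Finset.mem_insert, Finset.mem_sdiff, not_or]
    constructor
    · intro h; tauto
    · rintro (h | rfl | h)
      · exact (hI z h).1
      · exact ha
      · exact h.1
  have hdis : ∀ z ∈ arcI x k, z ∉ insert a C' := by
    intro z hz; simp [hC', hz, (hI z hz).2]
  have hcard : C.card = k + 1 + C'.card := by
    rw [hCeq, Finset.card_union_of_disjoint (Finset.disjoint_left.2 hdis),
      Finset.card_insert_of_notMem aC', card_arcI hx]
    omega
  obtain ⟨K, hK3, hKs, hKp⟩ := ih C'.card (by omega) C' rfl hclosed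
  refine ⟨(k + 1) ::ₘ K, ?_, ?_, ?_⟩
  · intro j hj
    rcases Multiset.mem_cons.1 hj with rfl | hj
    · omega
    · exact hK3 j hj
  · rw [Multiset.sum_cons, hKs, hcard]
  · rw [Multiset.map_cons, Multiset.prod_cons, ← hKp]
    have hU : UArc G a a k (arcI x k) := ⟨x, hx, x0, xe.trans x0, rfl⟩
    have e := hU.Per_eq hk _ _ hdis hdis
    rw [← hCeq] at e
    have hi : Per (gM G) (insert a C') (insert a C') = (1 - X ^ 2) * Per (gM G) C' C' := by
      rw [Per_isol aC' aC']
      · simp [gM, (hC a ha).1]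
      · intro c hc h
        have := nb_a c h
        simp [hC', this] at hc
    simp only [Qm, Finset.mem_insert_self, true_and, and_self, if_true, Finset.erase_insert aC',
      aC', and_false, if_false, hi] at e
    apply mul_left_cancel₀ one_add_ne
    rw [e, cy]
    ring

/-! ### Peeling -/

/-- number of neighbours in a set -/
def nC (G : SimpleGraph V) (C : Finset V) (z : V) : ℕ := (C.filter (G.Adj z)).card

structure St (G : SimpleGraph V) (u v : V) (C : Finset V) : Prop where
  ne : u ≠ v
  uC : u ∉ C
  vC : v ∉ C
  nb : ∀ c ∈ C, G.degree c = 2 ∧ ∀ z, G.Adj c z → z ∈ C ∨ z = u ∨ z = v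

theorem St.swap {u v : V} {C : Finset V} (h : St G u v C) : St G v u C :=
  ⟨h.ne.symm, h.vC, h.uC, fun c hc => ⟨(h.nb c hc).1, fun z hz => by
    have := (h.nb c hc).2 z hz; tauto⟩⟩

theorem St.closed {u v : V} {C : Finset V} (h : St G u v C) (hu : nC G C u = 0)
    (hv : nC G C v = 0) : Closed2 G C := by
  intro c hc
  refine ⟨(h.nb c hc).1, fun z hz => ?_⟩
  simp only [nC, Finset.card_eq_zero, Finset.filter_eq_empty_iff] at hu hv
  rcases (h.nb c hc).2 z hz with h | rfl | rfl
  · exact h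
  · exact absurd hz.symm (hu hc)
  · exact absurd hz.symm (hv hc)

theorem nC_sdiff {C I : Finset V} (hI : I ⊆ C) (z : V) : nC G (C \ I) z + nC G I z = nC G C z := by
  unfold nC
  rw [← Finset.card_union_of_disjoint, ← Finset.filter_union, Finset.sdiff_union_of_subset hI]
  exact Finset.disjoint_filter_filter Finset.sdiff_disjoint

theorem St.peel {u v : V} {C : Finset V} (h : St G u v C) (hu : 1 ≤ nC G C u) :
    (∃ k I, 1 ≤ k ∧ I ⊆ C ∧ UArc G u v k I ∧ St G u v (C \ I) ∧
      nC G (C \ I) u + 1 = nC G C u ∧ nC G (C \ I) v + 1 = nC G C v) ∨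
    (∃ k I, 2 ≤ k ∧ I ⊆ C ∧ UArc G u u k I ∧ St G u v (C \ I) ∧
      nC G (C \ I) u + 2 = nC G C u ∧ nC G (C \ I) v = nC G C v) := by
  obtain ⟨y, hy⟩ := Finset.card_pos.1 (show 0 < (C.filter (G.Adj u)).card from hu)
  rw [Finset.mem_filter] at hy
  obtain ⟨k, x, hk, hx, x0, xT, xC⟩ := trace_arc (G := G) (C := C) (T := {u, v})
    (by
      intro c hc
      simp only [Finset.mem_insert, Finset.mem_singleton, not_or]
      exact ⟨fun e => h.uC (e ▸ hc), fun e => h.vC (e ▸ hc)⟩)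
    (fun c hc => ⟨(h.nb c hc).1, fun z hz => by
      have := (h.nb c hc).2 z hz; simpa using this⟩) (by simp) hy.1 hy.2
  have hI : arcI x k ⊆ C := by
    intro z hz
    obtain ⟨i, hi, rfl⟩ := mem_arcI.1 hz
    exact xC i hi
  have uI : u ∉ arcI x k := fun e => h.uC (hI e)
  have vI : v ∉ arcI x k := fun e => h.vC (hI e)
  simp only [Finset.mem_insert, Finset.mem_singleton] at xT
  have m1 : x 1 ∈ arcI x k := mem_arcI.2 ⟨0, by omega, rfl⟩
  have mk : x k ∈ arcI x k := mem_arcI.2 ⟨k - 1, by omega, by congr 1; omega⟩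
  have a1 : G.Adj u (x 1) := by rw [← x0]; exact hx.adj 0 (by omega)
  have hst : St G u v (C \ arcI x k) := by
    refine ⟨h.ne, fun e => h.uC (Finset.mem_sdiff.1 e).1, fun e => h.vC (Finset.mem_sdiff.1 e).1, ?_⟩
    intro c hc
    rw [Finset.mem_sdiff] at hc
    refine ⟨(h.nb c hc.1).1, fun z hz => ?_⟩
    rcases (h.nb c hc.1).2 z hz with h1 | h1
    · left
      rw [Finset.mem_sdiff]
      refine ⟨h1, fun h2 => ?_⟩
      have cu : c ≠ u := fun e => h.uC (e ▸ hc.1)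
      have cv : c ≠ v := fun e => h.vC (e ▸ hc.1)
      rcases hx.adj_int hc.2 h2 hz with e | e
      · exact cu (e.1.trans x0)
      · rcases xT with e' | e'
        · exact cu (e.1.trans e')
        · exact cv (e.1.trans e')
    · exact Or.inr h1
  have su := nC_sdiff (G := G) hI u
  have sv := nC_sdiff (G := G) hI v
  rcases xT with xe | xe
  · right
    have hk2 := hx.loop_two hk (xe.trans x0.symm)
    have h1 : x 1 ≠ x k := fun e => by
      have := hx.inj 0 k (by omega) (by omega) e; omega
    have ak : G.Adj u (x k) := by rw [← xe]; exact (hx.adj k le_rfl).symm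
    have f1 : nC G (arcI x k) u = 2 := by
      unfold nC
      rw [Finset.card_eq_two]
      refine ⟨x 1, x k, h1, ?_⟩
      ext t
      simp only [Finset.mem_filter, Finset.mem_insert, Finset.mem_singleton]
      constructor
      · rintro ⟨ht, ha⟩
        rcases hx.adj_int uI ht ha with e | e
        · exact Or.inl e.2
        · exact Or.inr e.2
      · rintro (rfl | rfl)
        · exact ⟨m1, a1⟩
        · exact ⟨mk, ak⟩
    have f2 : nC G (arcI x k) v = 0 := by
      unfold nC
      rw [Finset.card_eq_zero, Finset.filter_eq_empty_iff]
      intro t ht ha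
      rcases hx.adj_int vI ht ha with e | e
      · exact h.ne (e.1.trans x0).symm
      · exact h.ne (e.1.trans xe).symm
    exact ⟨k, _, hk2, hI, ⟨x, hx, x0, xe, rfl⟩, hst, by omega, by omega⟩
  · left
    have ak : G.Adj v (x k) := by rw [← xe]; exact (hx.adj k le_rfl).symm
    have f1 : nC G (arcI x k) u = 1 := by
      unfold nC
      rw [Finset.card_eq_one]
      refine ⟨x 1, ?_⟩
      ext t
      simp only [Finset.mem_filter, Finset.mem_singleton]
      constructor
      · rintro ⟨ht, ha⟩
        rcases hx.adj_int uI ht ha with e | e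
        · exact e.2
        · exact absurd (e.1.trans xe) h.ne
      · rintro rfl
        exact ⟨m1, a1⟩
    have f2 : nC G (arcI x k) v = 1 := by
      unfold nC
      rw [Finset.card_eq_one]
      refine ⟨x k, ?_⟩
      ext t
      simp only [Finset.mem_filter, Finset.mem_singleton]
      constructor
      · rintro ⟨ht, ha⟩
        rcases hx.adj_int vI ht ha with e | e
        · exact absurd (e.1.trans x0).symm h.ne
        · exact e.2
      · rintro rfl
        exact ⟨mk, ak⟩
    exact ⟨k, _, hk, hI, ⟨x, hx, x0, xe, rfl⟩, hst, by omega, by omega⟩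

theorem St.peelVV {u v : V} {C : Finset V} (h : St G u v C) (hu : nC G C u = 0)
    (hv : nC G C v = 2) : ∃ k I, 2 ≤ k ∧ I ⊆ C ∧ UArc G v v k I ∧ Closed2 G (C \ I) := by
  rcases h.swap.peel (by omega) with ⟨k, I, hk, hI, hA, hst, h1, h2⟩ | ⟨k, I, hk, hI, hA, hst, h1, h2⟩
  · omega
  · exact ⟨k, I, hk, hI, hA, hst.swap.closed (by omega) (by omega)⟩

theorem St.peel22 {u v : V} {C : Finset V} (h : St G u v C) (hu : nC G C u = 2)
    (hv : nC G C v = 2) :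
    (∃ k I l J, 2 ≤ k ∧ 2 ≤ l ∧ I ⊆ C ∧ J ⊆ C \ I ∧ UArc G u u k I ∧ UArc G v v l J ∧
      Closed2 G ((C \ I) \ J)) ∨
    (∃ k I l J, 1 ≤ k ∧ 1 ≤ l ∧ I ⊆ C ∧ J ⊆ C \ I ∧ UArc G u v k I ∧ UArc G u v l J ∧
      Closed2 G ((C \ I) \ J)) := by
  rcases h.peel (by omega) with ⟨k, I, hk, hI, hA, hst, h1, h2⟩ | ⟨k, I, hk, hI, hA, hst, h1, h2⟩
  · right
    rcases hst.peel (by omega) with ⟨l, J, hl, hJ, hB, hst', h3, h4⟩ | ⟨l, J, hl, hJ, hB, hst', h3, h4⟩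
    · exact ⟨k, I, l, J, hk, hl, hI, hJ, hA, hB, hst'.closed (by omega) (by omega)⟩
    · omega
  · left
    obtain ⟨l, J, hl, hJ, hB, hc⟩ := hst.peelVV (by omega) (by omega)
    exact ⟨k, I, l, J, hk, hl, hI, hJ, hA, hB, hc⟩

theorem mkSplit {u v : V} (huv : u ≠ v) (du : G.degree u = 3) (dv : G.degree v = 3)
    {C I1 I2 I3 C0 : Finset V} (hC : C = Finset.univ \ {u, v})
    (h1 : I1 ⊆ C) (h2 : I2 ⊆ C) (h3 : I3 ⊆ C)
    (d12 : Disjoint I1 I2) (d13 : Disjoint I1 I3) (d23 : Disjoint I2 I3)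
    (h0 : C0 = C \ (I1 ∪ I2 ∪ I3)) (hc : Closed2 G C0) : Split G u v I1 I2 I3 C0 := by
  subst h0
  have key : ∀ z, z ∈ I1 ∪ (I2 ∪ (I3 ∪ C \ (I1 ∪ I2 ∪ I3))) ↔ z ∈ C := by
    intro z
    have := @h1 z; have := @h2 z; have := @h3 z
    simp only [Finset.mem_union, Finset.mem_sdiff, not_or]
    tauto
  have g : ∀ A B : Finset V, A ⊆ B → Disjoint A (C \ B) := fun A B hAB => by
    rw [Finset.disjoint_left]; intro z hz; simp [hAB hz]
  refine ⟨huv, du, dv, ?_, ?_, ?_, ?_, ?_, ?_, hc⟩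
  · rw [key, hC]; simp
  · rw [key, hC]; simp
  · rw [Finset.disjoint_union_right, Finset.disjoint_union_right]
    exact ⟨d12, d13, g _ _ (by intro z hz; simp [hz])⟩
  · rw [Finset.disjoint_union_right]
    exact ⟨d23, g _ _ (by intro z hz; simp [hz])⟩
  · exact g _ _ (by intro z hz; simp [hz])
  · ext z
    rw [Finset.mem_insert, Finset.mem_insert, key, hC]
    simp; tauto

theorem exists_dec {u v : V} (huv : u ≠ v) (du : G.degree u = 3) (dv : G.degree v = 3)
    (hd : ∀ c, c ≠ u → c ≠ v → G.degree c = 2) :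
    (∃ p q L I1 I2 I3 C, DDec G u v p q L I1 I2 I3 C) ∨
    (∃ a b c I1 I2 I3 C, TDec G u v a b c I1 I2 I3 C) := by
  obtain ⟨C, hC⟩ : ∃ C, C = Finset.univ \ {u, v} := ⟨_, rfl⟩
  have hst : St G u v C := by
    refine ⟨huv, by simp [hC], by simp [hC], ?_⟩
    intro c hc
    have : c ≠ u ∧ c ≠ v := by simpa [hC] using hc
    refine ⟨hd c this.1 this.2, fun z _ => ?_⟩
    simp [hC]; tauto
  have cnt : ∀ a b : V, a ≠ b → C = Finset.univ \ {a, b} →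
      nC G C a + (if G.Adj a b then 1 else 0) = G.degree a := by
    intro a b hab hC
    rw [← SimpleGraph.card_neighborFinset_eq_degree]
    have e : C.filter (G.Adj a) = (G.neighborFinset a).erase b := by
      ext z
      simp only [hC, Finset.mem_filter, Finset.mem_sdiff, Finset.mem_univ, true_and,
        Finset.mem_insert, Finset.mem_singleton, not_or, Finset.mem_erase,
        SimpleGraph.mem_neighborFinset]
      constructor
      · tauto
      · rintro ⟨h1, h2⟩; exact ⟨⟨h2.ne', h1⟩, h2⟩
    unfold nC
    rw [e]
    split_ifs with h
    · exact Finset.card_erase_add_one (by simpa using h)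
    · rw [Finset.erase_eq_of_notMem (by simpa using h)]; rfl
  have cu := cnt u v huv hC
  have cv := cnt v u huv.symm (by rw [hC, Finset.pair_comm])
  rw [du] at cu
  rw [dv, G.adj_comm] at cv
  have sd : ∀ {I J : Finset V}, J ⊆ C \ I → J ⊆ C := fun h => h.trans Finset.sdiff_subset
  have dj : ∀ {A I J : Finset V}, J ⊆ A \ I → Disjoint I J := fun h =>
    (Finset.disjoint_of_subset_left h Finset.sdiff_disjoint).symm
  by_cases ha : G.Adj u v
  · rw [if_pos ha] at cu cv
    rcases hst.peel22 (by omega) (by omega) with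
      ⟨k, I, l, J, hk, hl, hI, hJ, hA, hB, hc⟩ | ⟨k, I, l, J, hk, hl, hI, hJ, hA, hB, hc⟩
    · left
      exact ⟨k + 1, l + 1, 1, I, J, ∅, _, mkSplit huv du dv hC hI (sd hJ) (by simp) (dj hJ)
        (by simp) (by simp) (by ext; simp; tauto) hc, by omega, by omega, hA, hB,
        Or.inl ⟨rfl, ha, rfl⟩⟩
    · right
      exact ⟨k + 1, l + 1, 1, I, J, ∅, _, mkSplit huv du dv hC hI (sd hJ) (by simp) (dj hJ)
        (by simp) (by simp) (by ext; simp; tauto) hc, by omega, by omega, hA, hB,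
        Or.inl ⟨rfl, ha, rfl⟩⟩
  · rw [if_neg ha] at cu cv
    rcases hst.peel (by omega) with ⟨m, S, hm, hS, hM, hst1, h1, h2⟩ | ⟨m, S, hm, hS, hM, hst1, h1, h2⟩
    · rcases hst1.peel22 (by omega) (by omega) with
        ⟨k, I, l, J, hk, hl, hI, hJ, hA, hB, hc⟩ | ⟨k, I, l, J, hk, hl, hI, hJ, hA, hB, hc⟩
      · left
        exact ⟨k + 1, l + 1, m + 1, I, J, S, _, mkSplit huv du dv hC (sd hI)
          (sd (hJ.trans Finset.sdiff_subset)) hS (dj hJ)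
          (dj hI).symm (dj (hJ.trans Finset.sdiff_subset)).symm (by ext; simp; tauto) hc,
          by omega, by omega, hA, hB, Or.inr ⟨by omega, ha, hM⟩⟩
      · right
        exact ⟨k + 1, l + 1, m + 1, I, J, S, _, mkSplit huv du dv hC (sd hI)
          (sd (hJ.trans Finset.sdiff_subset)) hS (dj hJ)
          (dj hI).symm (dj (hJ.trans Finset.sdiff_subset)).symm (by ext; simp; tauto) hc,
          by omega, by omega, hA, hB, Or.inr ⟨by omega, ha, hM⟩⟩
    · rcases hst1.peel (by omega) with ⟨k, I, hk, hI, hA, hst2, h3, h4⟩ | ⟨k, I, hk, hI, hA, hst2, h3, h4⟩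
      · obtain ⟨l, J, hl, hJ, hB, hc⟩ := hst2.peelVV (by omega) (by omega)
        left
        exact ⟨m + 1, l + 1, k + 1, S, J, I, _, mkSplit huv du dv hC hS
          (sd (hJ.trans Finset.sdiff_subset)) (sd hI) (dj (hJ.trans Finset.sdiff_subset))
          (dj hI) (dj hJ).symm (by ext; simp; tauto) hc,
          by omega, by omega, hM, hB, Or.inr ⟨by omega, ha, hA⟩⟩
      · omega
end

/-! ### From the permanental polynomial to the transformed permanent -/

section
variable {V : Type*} [Fintype V] (G : SimpleGraph V)

theorem map_permanent' {R S : Type*} [CommRing R] [CommRing S] (f : R →+* S) (M : Matrix V V R) :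
    f M.permanent = (M.map f).permanent := by
  simp [Matrix.permanent, map_sum, map_prod]

theorem qPermPoly_natDegree : (qPermPoly G).natDegree = Fintype.card V := by
  have hdeg : ∀ i j : V, ((Matrix.diagonal (fun _ : V => (X : Polynomial ℚ)) -
      (signlessLapMatrix G).map Polynomial.C) i j).natDegree ≤ 1 := by
    intro i j
    rw [Matrix.sub_apply, Matrix.map_apply, Matrix.diagonal_apply]
    refine (natDegree_sub_le _ _).trans ?_
    split_ifs <;> simp
  have hc : (qPermPoly G).coeff (Fintype.card V) = 1 := by
    unfold qPermPoly Matrix.permanent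
    rw [finset_sum_coeff]
    have : ∀ σ : Equiv.Perm V, (∏ i, (Matrix.diagonal (fun _ : V => (X : Polynomial ℚ)) -
      (signlessLapMatrix G).map Polynomial.C) (σ i) i).coeff (Fintype.card V) =
        ∏ i, (1 : Matrix V V ℚ) (σ i) i := by
      intro σ
      have := coeff_prod_of_natDegree_le (s := Finset.univ) (fun i =>
        (Matrix.diagonal (fun _ : V => (X : Polynomial ℚ)) -
          (signlessLapMatrix G).map Polynomial.C) (σ i) i) 1 (fun i _ => hdeg _ _)
      rw [mul_one, Finset.card_univ] at this
      rw [this]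
      refine Finset.prod_congr rfl fun i _ => ?_
      rw [Matrix.sub_apply, Matrix.map_apply, Matrix.diagonal_apply, Matrix.one_apply]
      split_ifs <;> simp [coeff_C]
    rw [Finset.sum_congr rfl fun σ _ => this σ]
    exact Matrix.permanent_one
  refine le_antisymm ?_ (le_natDegree_of_ne_zero (by rw [hc]; exact one_ne_zero))
  unfold qPermPoly Matrix.permanent
  refine natDegree_sum_le_of_forall_le _ _ fun σ _ => ?_
  refine (natDegree_prod_le _ _).trans ?_
  refine (Finset.sum_le_sum fun i _ => hdeg (σ i) i).trans ?_
  simp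

theorem eval_gM (c : ℚ) (hc : c ≠ 0) :
    eval₂ (Int.castRingHom ℚ) c (Per (gM G) Finset.univ Finset.univ) =
      (-c) ^ Fintype.card V * eval (2 + c - 1 / c) (qPermPoly G) := by
  have h1 := permanent_eq_Per (Matrix.of (gM G)) (fun i j => gM_symm G i j)
  have h2 : Per (gM G) Finset.univ Finset.univ = (Matrix.of (gM G)).permanent := h1.symm
  rw [h2]
  have h3 := map_permanent' (eval₂RingHom (Int.castRingHom ℚ) c) (Matrix.of (gM G))
  have h4 := map_permanent' (evalRingHom (2 + c - 1 / c)) (Matrix.diagonal (fun _ : V => (X : Polynomial ℚ)) -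
      (signlessLapMatrix G).map Polynomial.C)
  rw [coe_eval₂RingHom] at h3
  rw [coe_evalRingHom] at h4
  rw [h3, qPermPoly, h4, ← Matrix.permanent_smul]
  congr 1
  ext i j
  by_cases hij : i = j
  · subst hij
    simp [gM, signlessLapMatrix, SimpleGraph.degMatrix, SimpleGraph.adjMatrix]
    field_simp
    ring
  · by_cases ha : G.Adj i j <;>
    simp [gM, signlessLapMatrix, SimpleGraph.degMatrix, SimpleGraph.adjMatrix, hij, ha]

theorem qPerm_transfer {W : Type*} [Fintype W] (H : SimpleGraph W)
    (h : qPermPoly G = qPermPoly H) : Fintype.card V = Fintype.card W ∧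
    Per (gM G) Finset.univ Finset.univ = Per (gM H) Finset.univ Finset.univ := by
  have hn : Fintype.card V = Fintype.card W := by
    rw [← qPermPoly_natDegree G, h, qPermPoly_natDegree]
  refine ⟨hn, ?_⟩
  apply Polynomial.map_injective (Int.castRingHom ℚ) Int.cast_injective
  apply Polynomial.eq_of_infinite_eval_eq
  refine Set.Infinite.mono (s := {c : ℚ | c ≠ 0}) ?_ ?_
  · intro c hc
    simp only [Set.mem_setOf_eq, eval_map]
    rw [eval_gM G c hc, eval_gM H c hc, h, hn]
  · exact (Set.finite_singleton (0 : ℚ)).infinite_compl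

/-! ### First coefficients -/

theorem X_dvd_off {i j : V} (h : i ≠ j) : gM G i j = (if G.Adj i j then 1 else 0) * X := by
  unfold gM
  rw [if_neg h]
  split_ifs <;> simp

theorem X_dvd_Per {A B : Finset V} {i : V} (hi : i ∈ A) (hB : i ∉ B) :
    ∃ r, Per (gM G) A B = X * r := by
  change (X : ℤ[X]) ∣ _
  rw [← Finset.insert_erase hi, Per_insert_row _ (Finset.notMem_erase i A)]
  refine Finset.dvd_sum fun j hj => ?_
  have : i ≠ j := fun e => hB (e ▸ hj)
  rw [X_dvd_off G this]
  exact Dvd.dvd.mul_right (Dvd.intro_left _ rfl) _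

def aD (i : V) : ℤ := (G.degree i : ℤ) - 2

theorem Per_coeff (S : Finset V) : ∃ (c1 c2 : ℤ) (r : ℤ[X]),
    Per (gM G) S S = 1 + C c1 * X + C c2 * X ^ 2 + X ^ 3 * r ∧
    c1 = ∑ i ∈ S, aD G i ∧
    2 * c2 = (∑ i ∈ S, aD G i) ^ 2 - ∑ i ∈ S, aD G i ^ 2 - 2 * S.card +
      ∑ i ∈ S, ∑ j ∈ S, if G.Adj i j then 1 else 0 := by
  induction S using Finset.strongInduction with
  | H S ih =>
  rcases S.eq_empty_or_nonempty with rfl | ⟨i, hi⟩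
  · exact ⟨0, 0, 0, by simp [Per_empty], by simp, by simp⟩
  obtain ⟨T, hT⟩ : ∃ T, T = S.erase i := ⟨_, rfl⟩
  have iT : i ∉ T := by simp [hT]
  have hS : S = insert i T := by rw [hT, Finset.insert_erase hi]
  obtain ⟨c1, c2, r, h0, h1, h2⟩ := ih T (by rw [hT]; exact Finset.erase_ssubset hi)
  have key : ∀ j ∈ T, ∃ s, gM G i j * Per (gM G) T ((insert i T).erase j) =
      (if G.Adj i j then 1 else 0) * X ^ 2 + X ^ 3 * s := by
    intro j hj
    have hij : i ≠ j := fun e => iT (e ▸ hj)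
    obtain ⟨d1, d2, r', h0', -, -⟩ := ih (T.erase j)
      ((Finset.erase_ssubset hj).trans (by rw [hT]; exact Finset.erase_ssubset hi))
    rw [Finset.erase_insert_of_ne hij,
      Per_insert_col _ _ (fun h => iT (Finset.mem_of_mem_erase h)),
      ← Finset.add_sum_erase _ _ hj, gM_symm G j i, h0', X_dvd_off G hij]
    have : X ^ 2 ∣ ∑ k ∈ T.erase j, gM G k i * Per (gM G) (T.erase k) (T.erase j) := by
      refine Finset.dvd_sum fun k hk => ?_
      have hk' : k ≠ j ∧ k ∈ T := by simpa using hk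
      obtain ⟨t, ht⟩ := X_dvd_Per G (A := T.erase k) (B := T.erase j) (i := j)
        (by simp [hk'.1.symm, hj]) (by simp)
      rw [ht, X_dvd_off G (show k ≠ i from fun e => iT (e ▸ hk'.2))]
      exact ⟨(if G.Adj k i then 1 else 0) * t, by ring⟩
    obtain ⟨t, ht⟩ := this
    rw [ht]
    refine ⟨(if G.Adj i j then 1 else 0) * (C d1 + C d2 * X + X ^ 2 * r' + t), ?_⟩
    split_ifs <;> ring
  choose! s hs using key
  have hii : gM G i i = 1 + C (aD G i) * X - X ^ 2 := by
    simp [gM, aD]; ring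
  refine ⟨aD G i + c1, c2 + aD G i * c1 - 1 + ∑ j ∈ T, if G.Adj i j then 1 else 0,
    r * (1 + C (aD G i) * X - X ^ 2) + C (aD G i) * C c2 - C c1 - C c2 * X + ∑ j ∈ T, s j, ?_, ?_, ?_⟩
  · rw [hS, Per_insert_row _ iT, Finset.sum_insert iT, Finset.erase_insert iT,
      Finset.sum_congr rfl hs, Finset.sum_add_distrib, ← Finset.sum_mul, ← Finset.mul_sum, h0, hii]
    have : (C (∑ j ∈ T, if G.Adj i j then (1 : ℤ) else 0) : ℤ[X]) =
        ∑ j ∈ T, if G.Adj i j then (1 : ℤ[X]) else 0 := by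
      rw [map_sum]
      refine Finset.sum_congr rfl fun j _ => ?_
      split_ifs <;> simp
    simp only [C_add, C_mul, C_sub, this, C_1]
    ring
  · rw [hS, Finset.sum_insert iT, h1]
  · rw [hS, Finset.sum_insert iT, Finset.sum_insert iT, Finset.sum_insert iT,
      Finset.sum_insert iT, Finset.card_insert_of_notMem iT]
    have e1 : ∑ k ∈ T, ∑ j ∈ insert i T, (if G.Adj k j then (1 : ℤ) else 0) =
        (∑ j ∈ T, if G.Adj i j then (1 : ℤ) else 0) +
        ∑ k ∈ T, ∑ j ∈ T, if G.Adj k j then (1 : ℤ) else 0 := by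
      rw [← Finset.sum_add_distrib]
      refine Finset.sum_congr rfl fun k _ => ?_
      rw [Finset.sum_insert iT, G.adj_comm]
    rw [e1, if_neg (G.loopless.irrefl i)]
    push_cast
    rw [h1]
    linear_combination h2

theorem coeff_aux (c1 c2 : ℤ) (r : ℤ[X]) :
    (1 + C c1 * X + C c2 * X ^ 2 + X ^ 3 * r).coeff 1 = c1 ∧
    (1 + C c1 * X + C c2 * X ^ 2 + X ^ 3 * r).coeff 2 = c2 := by
  constructor
  · simp only [coeff_add, coeff_one, coeff_X_pow, coeff_X_pow_mul', coeff_C_mul, coeff_X]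
    norm_num
  · simp only [coeff_add, coeff_one, coeff_X_pow, coeff_X_pow_mul', coeff_C_mul, coeff_X]
    norm_num

theorem degs_transfer {W : Type*} [Fintype W] (H : SimpleGraph W)
    (h : qPermPoly G = qPermPoly H) :
    ∑ i, aD G i = ∑ i, aD H i ∧ ∑ i, aD G i ^ 2 = ∑ i, aD H i ^ 2 := by
  obtain ⟨hn, hF⟩ := qPerm_transfer G H h
  obtain ⟨c1, c2, r, h0, h1, h2⟩ := Per_coeff G Finset.univ
  obtain ⟨d1, d2, s, k0, k1, k2⟩ := Per_coeff H Finset.univ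
  rw [h0, k0] at hF
  have e1 := congrArg (fun P => coeff P 1) hF
  have e2 := congrArg (fun P => coeff P 2) hF
  simp only [(coeff_aux _ _ _).1, (coeff_aux _ _ _).2] at e1 e2
  have dg : ∀ {U : Type _} [Fintype U] (K : SimpleGraph U),
      ∑ i, ∑ j, (if K.Adj i j then (1 : ℤ) else 0) = ∑ i, aD K i + 2 * Fintype.card U := by
    intro U _ K
    have : ∀ i, ∑ j, (if K.Adj i j then (1 : ℤ) else 0) = aD K i + 2 := by
      intro i
      rw [← Finset.sum_filter, Finset.sum_const, aD, ← SimpleGraph.card_neighborFinset_eq_degree,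
        SimpleGraph.neighborFinset_eq_filter]
      simp
    rw [Finset.sum_congr rfl fun i _ => this i, Finset.sum_add_distrib]
    simp [mul_comm]
  have dg' : ∑ i, ∑ j, (if H.Adj i j then (1 : ℤ) else 0) = ∑ i, aD H i + 2 * Fintype.card W := by
    have : ∀ i, ∑ j, (if H.Adj i j then (1 : ℤ) else 0) = aD H i + 2 := by
      intro i
      rw [← Finset.sum_filter, Finset.sum_const, aD, ← SimpleGraph.card_neighborFinset_eq_degree,
        SimpleGraph.neighborFinset_eq_filter]
      simp
    rw [Finset.sum_congr rfl fun i _ => this i, Finset.sum_add_distrib]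
    simp [mul_comm]
  have f : ∑ i, aD G i = ∑ i, aD H i := by rw [← h1, ← k1, e1]
  refine ⟨f, ?_⟩
  rw [dg G] at h2
  rw [dg'] at k2
  rw [e2, k2, f, Finset.card_univ, Finset.card_univ, hn] at h2
  linarith

theorem degs_exist (h1 : ∑ i, aD G i = 2) (h2 : ∑ i, aD G i ^ 2 = 2) :
    ∃ u v, u ≠ v ∧ G.degree u = 3 ∧ G.degree v = 3 ∧ ∀ c, c ≠ u → c ≠ v → G.degree c = 2 := by
  have h3 : ∑ i, (aD G i ^ 2 - aD G i) = 0 := by rw [Finset.sum_sub_distrib, h1, h2]; rfl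
  have h4 : ∀ i, aD G i = 0 ∨ aD G i = 1 := by
    have nn : ∀ i ∈ Finset.univ, 0 ≤ aD G i ^ 2 - aD G i := by
      intro i _
      rcases le_or_gt (aD G i) 0 with h | h <;> nlinarith
    intro i
    have := (Finset.sum_eq_zero_iff_of_nonneg nn).1 h3 i (Finset.mem_univ i)
    have : aD G i * (aD G i - 1) = 0 := by linear_combination this
    rcases mul_eq_zero.1 this with h | h
    · exact Or.inl h
    · right; linarith
  have h5 : ∑ i, aD G i = ((Finset.univ.filter fun i => aD G i = 1).card : ℤ) := by
    rw [Finset.card_filter]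
    push_cast
    refine Finset.sum_congr rfl fun i _ => ?_
    rcases h4 i with h | h <;> simp [h]
  have h6 : (Finset.univ.filter fun i => aD G i = 1).card = 2 := by
    rw [h1] at h5; exact_mod_cast h5.symm
  obtain ⟨u, v, huv, e⟩ := Finset.card_eq_two.1 h6
  have hu : aD G u = 1 := by
    have : u ∈ Finset.univ.filter fun i => aD G i = 1 := by rw [e]; simp
    simpa using this
  have hv : aD G v = 1 := by
    have : v ∈ Finset.univ.filter fun i => aD G i = 1 := by rw [e]; simp
    simpa using this
  refine ⟨u, v, huv, by unfold aD at hu; omega, by unfold aD at hv; omega, ?_⟩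
  intro c h1 h2
  have : aD G c ≠ 1 := by
    intro h
    have : c ∈ Finset.univ.filter fun i => aD G i = 1 := by simp [h]
    rw [e] at this
    simp [h1, h2] at this
  have := (h4 c).resolve_right this
  unfold aD at this; omega
end


/-! ### The graph `d(p,q,r)` -/

theorem mkGArc {V : Type*} [Fintype V] {G : SimpleGraph V} {x : ℕ → V} {k : ℕ}
    (inj : ∀ i j, i < k → j ≤ k + 1 → x (i + 1) = x j → i + 1 = j)
    (ne : ∀ i, i < k → x i ≠ x (i + 2))
    (nb : ∀ i, i < k → ∀ z, G.Adj (x (i + 1)) z → z = x i ∨ z = x (i + 2))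
    (adj : ∀ i, i ≤ k → G.Adj (x i) (x (i + 1))) : GArc G x k := by
  have nb' : ∀ i, i < k → ∀ z, G.Adj (x (i + 1)) z ↔ z = x i ∨ z = x (i + 2) := by
    intro i hi z
    refine ⟨nb i hi z, ?_⟩
    rintro (rfl | rfl)
    · exact (adj i (by omega)).symm
    · exact adj (i + 1) (by omega)
  refine ⟨inj, fun i hi => ?_, nb', adj⟩
  rw [← SimpleGraph.card_neighborFinset_eq_degree, Finset.card_eq_two]
  refine ⟨_, _, ne i hi, ?_⟩
  ext z
  rw [SimpleGraph.mem_neighborFinset, nb' i hi]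
  simp

def dv (p q r : ℕ) (h : 0 < p + q + r) (i : ℕ) : Fin (p + q + r) :=
  if hi : i < p + q + r then ⟨i, hi⟩ else ⟨0, h⟩

theorem dv_val {p q r : ℕ} (h : 0 < p + q + r) {i : ℕ} (hi : i < p + q + r) :
    (dv p q r h i).val = i := by
  simp [dv, hi]

theorem dG_adj {p q r : ℕ} (i j : Fin (p + q + r)) : (dGraph p q r).Adj i j ↔ i.val ≠ j.val ∧
    (((i.val + 1 = j.val ∧ j.val < p) ∨
    (i.val = p - 1 ∧ j.val = 0) ∨
    (i.val + 1 = j.val ∧ p ≤ i.val ∧ j.val < p + q) ∨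
    (i.val = p + q - 1 ∧ j.val = p) ∨
    (i.val + 1 = j.val ∧ p + q ≤ i.val) ∨
    (i.val = 0 ∧ j.val = p + q) ∨
    (i.val = p + q + r - 1 ∧ j.val = p)) ∨
    ((j.val + 1 = i.val ∧ i.val < p) ∨
    (j.val = p - 1 ∧ i.val = 0) ∨
    (j.val + 1 = i.val ∧ p ≤ j.val ∧ i.val < p + q) ∨
    (j.val = p + q - 1 ∧ i.val = p) ∨
    (j.val + 1 = i.val ∧ p + q ≤ j.val) ∨
    (j.val = 0 ∧ i.val = p + q) ∨
    (j.val = p + q + r - 1 ∧ i.val = p))) := by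
  rw [dGraph, SimpleGraph.fromRel_adj]
  simp only [ne_eq, Fin.ext_iff]

def f1 (p i : ℕ) : ℕ := if i < p then i else 0
def f2 (p q i : ℕ) : ℕ := if i < q then p + i else p
def f3 (p q r i : ℕ) : ℕ := if i = 0 then 0 else if i ≤ r then p + q + i - 1 else p

section
variable {p q r : ℕ}

theorem f1_lt (hp : 3 ≤ p) (hq : 3 ≤ q) (hr : 1 ≤ r) (i : ℕ) : f1 p i < p + q + r := by unfold f1; split_ifs <;> omega
theorem f2_lt (hp : 3 ≤ p) (hq : 3 ≤ q) (hr : 1 ≤ r) (i : ℕ) : f2 p q i < p + q + r := by unfold f2; split_ifs <;> omega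
theorem f3_lt (hp : 3 ≤ p) (hq : 3 ≤ q) (hr : 1 ≤ r) (i : ℕ) : f3 p q r i < p + q + r := by unfold f3; split_ifs <;> omega

theorem dU1 (hp : 3 ≤ p) (hq : 3 ≤ q) (hr : 1 ≤ r) (h0 : 0 < p + q + r) : UArc (dGraph p q r) (dv p q r h0 0) (dv p q r h0 0) (p - 1)
    (Finset.univ.filter fun z => 1 ≤ z.val ∧ z.val < p) := by
  have hv : ∀ i, (dv p q r h0 (f1 p i)).val = f1 p i := fun i => dv_val h0 (f1_lt hp hq hr i)
  refine ⟨fun i => dv p q r h0 (f1 p i), mkGArc ?_ ?_ ?_ ?_, ?_, ?_, ?_⟩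
  · intro i j hi hj
    simp only [Fin.ext_iff, hv]
    unfold f1
    intro h
    split_ifs at h <;> omega
  · intro i hi
    simp only [ne_eq, Fin.ext_iff, hv]
    unfold f1
    intro h
    split_ifs at h <;> omega
  · intro i hi z
    have := z.2
    rw [dG_adj]
    simp only [Fin.ext_iff, hv]
    unfold f1
    rw [if_pos (show i + 1 < p by omega), if_pos (show i < p by omega)]
    rintro ⟨h, (h|h|h|h|h|h|h)|(h|h|h|h|h|h|h)⟩ <;> split_ifs <;> omega
  · intro i hi
    rw [dG_adj]
    simp only [hv]
    unfold f1
    rcases lt_or_ge (i + 1) p with h | h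
    · rw [if_pos (by omega), if_pos h]
      exact ⟨by omega, Or.inl (Or.inl ⟨rfl, h⟩)⟩
    · rw [if_pos (by omega), if_neg (by omega)]
      exact ⟨by omega, Or.inl (Or.inr (Or.inl ⟨by omega, rfl⟩))⟩
  · simp [f1]
  · simp only [f1]; rw [if_neg (by omega)]
  · ext z
    simp only [mem_arcI, Finset.mem_filter, Finset.mem_univ, true_and, Fin.ext_iff, hv]
    unfold f1
    constructor
    · rintro ⟨i, hi, h⟩
      split_ifs at h <;> omega
    · intro h
      exact ⟨z.val - 1, by omega, by rw [if_pos] <;> omega⟩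

theorem dU2 (hp : 3 ≤ p) (hq : 3 ≤ q) (hr : 1 ≤ r) (h0 : 0 < p + q + r) : UArc (dGraph p q r) (dv p q r h0 p) (dv p q r h0 p) (q - 1)
    (Finset.univ.filter fun z => p + 1 ≤ z.val ∧ z.val < p + q) := by
  have hv : ∀ i, (dv p q r h0 (f2 p q i)).val = f2 p q i := fun i => dv_val h0 (f2_lt hp hq hr i)
  refine ⟨fun i => dv p q r h0 (f2 p q i), mkGArc ?_ ?_ ?_ ?_, ?_, ?_, ?_⟩
  · intro i j hi hj
    simp only [Fin.ext_iff, hv]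
    unfold f2
    intro h
    split_ifs at h <;> omega
  · intro i hi
    simp only [ne_eq, Fin.ext_iff, hv]
    unfold f2
    intro h
    split_ifs at h <;> omega
  · intro i hi z
    have := z.2
    rw [dG_adj]
    simp only [Fin.ext_iff, hv]
    unfold f2
    rw [if_pos (show i + 1 < q by omega), if_pos (show i < q by omega)]
    rintro ⟨h, (h|h|h|h|h|h|h)|(h|h|h|h|h|h|h)⟩ <;> split_ifs <;> omega
  · intro i hi
    rw [dG_adj]
    simp only [hv]
    unfold f2
    rcases lt_or_ge (i + 1) q with h | h
    · rw [if_pos (by omega), if_pos h]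
      exact ⟨by omega, Or.inl (Or.inr (Or.inr (Or.inl ⟨rfl, by omega, by omega⟩)))⟩
    · rw [if_pos (by omega), if_neg (by omega)]
      exact ⟨by omega, Or.inl (Or.inr (Or.inr (Or.inr (Or.inl ⟨by omega, rfl⟩))))⟩
  · simp [f2]
  · simp only [f2]; rw [if_neg (by omega)]
  · ext z
    simp only [mem_arcI, Finset.mem_filter, Finset.mem_univ, true_and, Fin.ext_iff, hv]
    unfold f2
    constructor
    · rintro ⟨i, hi, h⟩
      split_ifs at h <;> omega
    · intro h
      exact ⟨z.val - p - 1, by omega, by rw [if_pos] <;> omega⟩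

theorem dU3 (hp : 3 ≤ p) (hq : 3 ≤ q) (hr : 1 ≤ r) (h0 : 0 < p + q + r) : UArc (dGraph p q r) (dv p q r h0 0) (dv p q r h0 p) r
    (Finset.univ.filter fun z => p + q ≤ z.val) := by
  have hv : ∀ i, (dv p q r h0 (f3 p q r i)).val = f3 p q r i :=
    fun i => dv_val h0 (f3_lt hp hq hr i)
  refine ⟨fun i => dv p q r h0 (f3 p q r i), mkGArc ?_ ?_ ?_ ?_, ?_, ?_, ?_⟩
  · intro i j hi hj
    simp only [Fin.ext_iff, hv]
    unfold f3
    rw [if_neg (show ¬ i + 1 = 0 by omega), if_pos (show i + 1 ≤ r by omega)]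
    intro h
    split_ifs at h <;> omega
  · intro i hi
    simp only [ne_eq, Fin.ext_iff, hv]
    unfold f3
    intro h
    split_ifs at h <;> omega
  · intro i hi z
    have := z.2
    rw [dG_adj]
    simp only [Fin.ext_iff, hv]
    unfold f3
    rw [if_neg (show ¬ i + 1 = 0 by omega), if_pos (show i + 1 ≤ r by omega), if_pos (show i ≤ r by omega), if_neg (show ¬ i + 2 = 0 by omega)]
    rintro ⟨h, (h|h|h|h|h|h|h)|(h|h|h|h|h|h|h)⟩ <;> split_ifs <;> omega
  · intro i hi
    rw [dG_adj]
    simp only [hv]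
    unfold f3
    rcases Nat.eq_zero_or_pos i with h0 | h0
    · rw [if_pos h0, if_neg (by omega), if_pos (by omega)]
      exact ⟨by omega, Or.inl (Or.inr (Or.inr (Or.inr (Or.inr (Or.inr (Or.inl ⟨rfl, by omega⟩))))))⟩
    rw [if_neg (by omega), if_pos hi, if_neg (by omega)]
    rcases lt_or_ge i r with h | h
    · rw [if_pos (by omega)]
      exact ⟨by omega, Or.inl (Or.inr (Or.inr (Or.inr (Or.inr (Or.inl ⟨by omega, by omega⟩)))))⟩
    · rw [if_neg (by omega)]
      exact ⟨by omega, Or.inl (Or.inr (Or.inr (Or.inr (Or.inr (Or.inr (Or.inr ⟨by omega, rfl⟩))))))⟩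
  · simp [f3]
  · simp only [f3]; rw [if_neg (by omega), if_neg (by omega)]
  · ext z
    have := z.2
    simp only [mem_arcI, Finset.mem_filter, Finset.mem_univ, true_and, Fin.ext_iff, hv]
    unfold f3
    constructor
    · rintro ⟨i, hi, h⟩
      rw [if_neg (show ¬ i + 1 = 0 by omega), if_pos (show i + 1 ≤ r by omega)] at h
      omega
    · intro h
      exact ⟨z.val - p - q, by omega, by rw [if_neg, if_pos] <;> omega⟩

set_option maxHeartbeats 800000 in
theorem dG_dec (hp : 3 ≤ p) (hq : 3 ≤ q) (hr : 1 ≤ r) (h0 : 0 < p + q + r) : ∃ I1 I2 I3, DDec (dGraph p q r) (dv p q r h0 0) (dv p q r h0 p) p q (r + 1)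
    I1 I2 I3 ∅ := by
  have v0 : (dv p q r h0 0).val = 0 := dv_val h0 h0
  have vp : (dv p q r h0 p).val = p := dv_val h0 (by omega)
  refine ⟨_, _, _, ?_, hp, hq, dU1 hp hq hr h0, dU2 hp hq hr h0, Or.inr ⟨by omega, ?_, 
    dU3 hp hq hr h0⟩⟩
  · refine mkSplit (C := Finset.univ.filter fun z => z.val ≠ 0 ∧ z.val ≠ p) ?_ ?_ ?_
      (by ext z; simp [Fin.ext_iff, v0, vp]) ?_ ?_ ?_ ?_ ?_ ?_ ?_ ?_
    · rw [ne_eq, Fin.ext_iff, v0, vp]; omega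
    · rw [← SimpleGraph.card_neighborFinset_eq_degree, Finset.card_eq_three]
      have e1 : (dv p q r h0 1).val = 1 := dv_val h0 (by omega)
      have e2 : (dv p q r h0 (p-1)).val = p-1 := dv_val h0 (by omega)
      have e3 : (dv p q r h0 (p+q)).val = p+q := dv_val h0 (by omega)
      refine ⟨dv p q r h0 1, dv p q r h0 (p - 1), dv p q r h0 (p + q), ?_, ?_, ?_, ?_⟩
      · rw [ne_eq, Fin.ext_iff]; omega
      · rw [ne_eq, Fin.ext_iff]; omega
      · rw [ne_eq, Fin.ext_iff]; omega
      · ext z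
        have := z.2
        rw [SimpleGraph.mem_neighborFinset, dG_adj]
        simp only [Finset.mem_insert, Finset.mem_singleton, Fin.ext_iff, v0, e1, e2, e3]
        constructor
        · rintro ⟨h, (h|h|h|h|h|h|h)|(h|h|h|h|h|h|h)⟩ <;> omega
        · rintro (h | h | h)
          · exact ⟨by omega, Or.inl (Or.inl ⟨by omega, by omega⟩)⟩
          · exact ⟨by omega, Or.inr (Or.inr (Or.inl ⟨by omega, by first | trivial | omega⟩))⟩
          · exact ⟨by omega, Or.inl (Or.inr (Or.inr (Or.inr (Or.inr (Or.inr (Or.inl ⟨by first | trivial | omega, by first | trivial | omega⟩))))))⟩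
    · rw [← SimpleGraph.card_neighborFinset_eq_degree, Finset.card_eq_three]
      have e1 : (dv p q r h0 (p+1)).val = p+1 := dv_val h0 (by omega)
      have e2 : (dv p q r h0 (p+q-1)).val = p+q-1 := dv_val h0 (by omega)
      have e3 : (dv p q r h0 (p+q+r-1)).val = p+q+r-1 := dv_val h0 (by omega)
      refine ⟨dv p q r h0 (p+1), dv p q r h0 (p +q- 1), dv p q r h0 (p + q+r-1), ?_, ?_, ?_, ?_⟩
      · rw [ne_eq, Fin.ext_iff]; omega
      · rw [ne_eq, Fin.ext_iff]; omega
      · rw [ne_eq, Fin.ext_iff]; omega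
      · ext z
        have := z.2
        rw [SimpleGraph.mem_neighborFinset, dG_adj]
        simp only [Finset.mem_insert, Finset.mem_singleton, Fin.ext_iff, vp, e1, e2, e3]
        constructor
        · rintro ⟨h, (h|h|h|h|h|h|h)|(h|h|h|h|h|h|h)⟩ <;> omega
        · rintro (h | h | h)
          · exact ⟨by omega, Or.inl (Or.inr (Or.inr (Or.inl ⟨by omega, by omega, by omega⟩)))⟩
          · exact ⟨by omega, Or.inr (Or.inr (Or.inr (Or.inr (Or.inl ⟨by omega, by first | trivial | omega⟩))))⟩
          · exact ⟨by omega, Or.inr (Or.inr (Or.inr (Or.inr (Or.inr (Or.inr (Or.inr ⟨by omega, by first | trivial | omega⟩))))))⟩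
    · intro z; simp [Fin.ext_iff, v0, vp]; omega
    · intro z; simp [Fin.ext_iff, v0, vp]; omega
    · intro z; simp [Fin.ext_iff, v0, vp]; omega
    · rw [Finset.disjoint_left]; intro z; simp; omega
    · rw [Finset.disjoint_left]; intro z; simp; omega
    · rw [Finset.disjoint_left]; intro z; simp
    · ext z
      have := z.2
      simp [Fin.ext_iff, v0, vp]; omega
    · intro c hc; simp at hc
  · rw [dG_adj, v0, vp]
    rintro ⟨h, (h|h|h|h|h|h|h)|(h|h|h|h|h|h|h)⟩ <;> omega
end

section
variable {V : Type*} [Fintype V] {G : SimpleGraph V} {u v : V} {I1 I2 I3 C : Finset V}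

theorem UArc.card {a b : V} {k : ℕ} {I : Finset V} (h : UArc G a b k I) : I.card = k := by
  obtain ⟨x, hx, -, -, rfl⟩ := h
  exact card_arcI hx

theorem UArc.degI {a b : V} {k : ℕ} {I : Finset V} (h : UArc G a b k I) {z : V} (hz : z ∈ I) :
    G.degree z = 2 := by
  obtain ⟨x, hx, -, -, rfl⟩ := h
  obtain ⟨i, hi, rfl⟩ := mem_arcI.1 hz
  exact hx.deg i hi

theorem Link.card {L : ℕ} (h : Link G u v L I3) : I3.card = L - 1 := by
  rcases h with ⟨rfl, -, rfl⟩ | ⟨h, -, h'⟩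
  · simp
  · exact h'.card

theorem Link.degI {L : ℕ} (h : Link G u v L I3) {z : V} (hz : z ∈ I3) : G.degree z = 2 := by
  rcases h with ⟨rfl, -, rfl⟩ | ⟨h, -, h'⟩
  · simp at hz
  · exact h'.degI hz

theorem Split.card (h : Split G u v I1 I2 I3 C) :
    Fintype.card V = 2 + I1.card + I2.card + I3.card + C.card := by
  have hv := h.v1
  have hu : u ∉ insert v (I1 ∪ (I2 ∪ (I3 ∪ C))) := by
    rw [Finset.mem_insert, not_or]; exact ⟨h.ne, h.u1⟩
  rw [← Finset.card_univ, ← h.all, Finset.card_insert_of_notMem hu, Finset.card_insert_of_notMem hv,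
    Finset.card_union_of_disjoint h.d1, Finset.card_union_of_disjoint h.d2,
    Finset.card_union_of_disjoint h.d3]
  ring

theorem sum_aD (huv : u ≠ v) (du : G.degree u = 3) (dv : G.degree v = 3)
    (hd : ∀ c, c ≠ u → c ≠ v → G.degree c = 2) :
    ∑ i, aD G i = 2 ∧ ∑ i, aD G i ^ 2 = 2 := by
  have : ∀ i, aD G i = (if i = u then 1 else 0) + (if i = v then 1 else 0) ∧
      aD G i ^ 2 = (if i = u then 1 else 0) + (if i = v then 1 else 0) := by
    intro i
    unfold aD
    by_cases h1 : i = u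
    · subst h1; simp [du, huv]
    · by_cases h2 : i = v
      · subst h2; simp [dv, h1]
      · simp [hd i h1 h2, h1, h2]
  constructor
  · rw [Finset.sum_congr rfl fun i _ => (this i).1, Finset.sum_add_distrib]; simp
  · rw [Finset.sum_congr rfl fun i _ => (this i).2, Finset.sum_add_distrib]; simp

theorem DDec.degs {p q L : ℕ} (h : DDec G u v p q L I1 I2 I3 C) :
    ∀ c, c ≠ u → c ≠ v → G.degree c = 2 := by
  obtain ⟨h, hp, hq, a1, a2, hL⟩ := h
  intro c h1 h2
  have : c ∈ insert u (insert v (I1 ∪ (I2 ∪ (I3 ∪ C)))) := by rw [h.all]; simp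
  simp only [Finset.mem_insert, h1, h2, Finset.mem_union, false_or] at this
  rcases this with t | t | t | t
  · exact a1.degI t
  · exact a2.degI t
  · exact hL.degI t
  · exact (h.closed c t).1
end


/-! ### Arithmetic of the polynomials: preliminaries -/

theorem eps_pow {R : Type*} [CommRing R] (x : R) (k : ℕ) :
    (-x ^ 2) ^ k = (-1) ^ k * x ^ (2 * k) := by
  rw [neg_pow, ← pow_mul]

/-- Truncated polynomials. -/
abbrev Qt (S : Type) [CommRing S] (m : ℕ) : Type := S[X] ⧸ Ideal.span {(X : S[X]) ^ m}

def qm (S : Type) [CommRing S] (m : ℕ) : S[X] →+* Qt S m := Ideal.Quotient.mk _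

section
variable {S : Type} [CommRing S] {m : ℕ}

theorem qm_eq {P Q : S[X]} : qm S m P = qm S m Q ↔ ∀ d, d < m → P.coeff d = Q.coeff d := by
  unfold qm
  rw [Ideal.Quotient.eq, Ideal.mem_span_singleton, X_pow_dvd_iff]
  simp only [coeff_sub, sub_eq_zero]

theorem qm_zero {P : S[X]} (h : X ^ m ∣ P) : qm S m P = 0 := by
  unfold qm
  rwa [Ideal.Quotient.eq_zero_iff_mem, Ideal.mem_span_singleton]

theorem qm_dvd {P : S[X]} (h : qm S m P = 0) : X ^ m ∣ P := by
  unfold qm at h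
  rwa [Ideal.Quotient.eq_zero_iff_mem, Ideal.mem_span_singleton] at h

theorem qm_pow {k : ℕ} (h : m ≤ k) : (qm S m X) ^ k = 0 := by
  rw [← map_pow]
  exact qm_zero (pow_dvd_pow X h)

theorem qm_eps {k : ℕ} (h : m ≤ 2 * k) : (-(qm S m X) ^ 2) ^ k = 0 := by
  rw [eps_pow, qm_pow h, mul_zero]

theorem qm_cancel [IsDomain S] {A P : S[X]} (hA : A.coeff 0 ≠ 0) (h : qm S m (A * P) = 0) :
    qm S m P = 0 := by
  refine qm_zero ?_
  refine (prime_X (R := S)).pow_dvd_of_dvd_mul_left m ?_ (qm_dvd h)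
  rwa [X_dvd_iff]

theorem mul_coeffs (A P : S[X]) {e : ℕ} (h : ∀ d, d < e → P.coeff d = 0) :
    (A * P).coeff e = A.coeff 0 * P.coeff e ∧
    (A * P).coeff (e + 1) = A.coeff 0 * P.coeff (e + 1) + A.coeff 1 * P.coeff e ∧
    (A * P).coeff (e + 2) = A.coeff 0 * P.coeff (e + 2) + A.coeff 1 * P.coeff (e + 1) +
      A.coeff 2 * P.coeff e ∧
    (A * P).coeff (e + 3) = A.coeff 0 * P.coeff (e + 3) + A.coeff 1 * P.coeff (e + 2) +
      A.coeff 2 * P.coeff (e + 1) + A.coeff 3 * P.coeff e := by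
  obtain ⟨R, rfl⟩ := X_pow_dvd_iff.2 h
  have e1 : A * (X ^ e * R) = X ^ e * (A * R) := by ring
  have e2 : ∀ (B : S[X]) i, (X ^ e * B).coeff (e + i) = B.coeff i := by
    intro B i; rw [add_comm, coeff_X_pow_mul]
  have e3 : ∀ (B : S[X]), (X ^ e * B).coeff e = B.coeff 0 := fun B => e2 B 0
  rw [e1]
  simp only [e2, e3, coeff_mul]
  refine ⟨?_, ?_, ?_, ?_⟩ <;>
  simp [Finset.Nat.antidiagonal_succ] <;> ring
end

/-- The sum of the monomials `X^k`. -/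
def Tm (K : Multiset ℕ) : ℤ[X] := (K.map fun k => X ^ k).sum

theorem Tm_coeff (K : Multiset ℕ) (j : ℕ) : (Tm K).coeff j = K.count j := by
  unfold Tm
  induction K using Multiset.induction with
  | empty => simp
  | cons a K ih =>
    rw [Multiset.map_cons, Multiset.sum_cons, coeff_add, ih, coeff_X_pow, Multiset.count_cons]
    push_cast
    ring

theorem Tm_low {K : Multiset ℕ} {e : ℕ} (h : ∀ k ∈ K, e ≤ k) (d : ℕ) (hd : d < e) :
    (Tm K).coeff d = 0 := by
  rw [Tm_coeff, Multiset.count_eq_zero_of_notMem]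
  · simp
  · intro hm; have := h d hm; omega

theorem Tm_dvd {K : Multiset ℕ} {e : ℕ} (h : ∀ k ∈ K, e ≤ k) : X ^ e ∣ Tm K :=
  X_pow_dvd_iff.2 (Tm_low h)

theorem prod_cy (K : Multiset ℕ) {e : ℕ} (h : ∀ k ∈ K, e ≤ k) :
    X ^ (2 * e) ∣ (K.map cy).prod - (1 + 2 * Tm K) := by
  induction K using Multiset.induction with
  | empty => simp [Tm]
  | cons a K ih =>
    have h' : ∀ k ∈ K, e ≤ k := fun k hk => h k (Multiset.mem_cons_of_mem hk)
    obtain ⟨r, hr⟩ := ih h'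
    obtain ⟨s, hs⟩ := Tm_dvd h'
    obtain ⟨b, rfl⟩ := Nat.exists_eq_add_of_le (h a (Multiset.mem_cons_self a K))
    have hT : Tm ((e + b) ::ₘ K) = X ^ (e + b) + Tm K := by simp [Tm]
    rw [hT, Multiset.map_cons, Multiset.prod_cons, sub_eq_iff_eq_add.1 hr, hs, cy]
    refine ⟨r * cy (e + b) + 4 * X ^ b * s + (-1) ^ (e + b) * X ^ (2 * b) * (1 + 2 * X ^ e * s), ?_⟩
    rw [cy, eps_pow]
    ring

/-- Square root of the product modulo 2. -/
def Pz (K : Multiset ℕ) : (ZMod 2)[X] := (K.map fun k => 1 + X ^ k).prod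

theorem Pz_low {K : Multiset ℕ} {e : ℕ} (h : ∀ k ∈ K, e ≤ k) : qm (ZMod 2) e (Pz K) = 1 := by
  unfold Pz
  induction K using Multiset.induction with
  | empty => simp
  | cons a K ih =>
    rw [Multiset.map_cons, Multiset.prod_cons, map_mul,
      ih fun k hk => h k (Multiset.mem_cons_of_mem hk), map_add, map_pow,
      qm_pow (h a (Multiset.mem_cons_self a K))]
    simp

def r2 : ℤ[X] →+* (ZMod 2)[X] := mapRingHom (Int.castRingHom (ZMod 2))

theorem two0 : (2 : (ZMod 2)[X]) = 0 := by
  exact CharTwo.two_eq_zero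

theorem r2_X : r2 X = X := by simp [r2]

theorem sq_inj {a b : (ZMod 2)[X]} (h : a ^ 2 = b ^ 2) : a = b := by
  have : (a - b) ^ 2 = 0 := by linear_combination h - b * (a - b) * two0
  exact sub_eq_zero.1 (pow_eq_zero_iff (two_ne_zero) |>.1 this)

theorem eps2 (k : ℕ) : (-(X : (ZMod 2)[X]) ^ 2) ^ k = (X ^ k) ^ 2 := by
  have : -(X : (ZMod 2)[X]) ^ 2 = X ^ 2 := by linear_combination - X ^ 2 * two0
  rw [this]; ring

theorem r2_cy (k : ℕ) : r2 (cy k) = (1 + X ^ k) ^ 2 := by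
  simp only [cy, map_add, map_mul, map_pow, map_one, map_neg, map_ofNat, r2_X, eps2]
  ring

theorem r2_prod (K : Multiset ℕ) : r2 (K.map cy).prod = Pz K ^ 2 := by
  unfold Pz
  induction K using Multiset.induction with
  | empty => simp
  | cons a K ih =>
    rw [Multiset.map_cons, Multiset.prod_cons, Multiset.map_cons, Multiset.prod_cons, map_mul, ih,
      r2_cy, mul_pow]

theorem r2_hA (p : ℕ) : r2 (hA p) = (1 + X) * (1 + X ^ p) ^ 2 := by
  simp only [hA, map_add, map_mul, map_pow, map_one, map_neg, map_sub, map_ofNat, r2_X, eps2]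
  linear_combination (X ^ 2 - X * (X ^ p) ^ 2 + (X ^ 2 - X) * X ^ p) * two0

theorem r2_hB (p : ℕ) : r2 (hB p) = X * (1 + X) * (1 + X ^ p) ^ 2 := by
  simp only [hB, map_add, map_mul, map_pow, map_one, map_neg, map_sub, map_ofNat, r2_X, eps2]
  linear_combination ((1 - X) * X ^ p + (1 - X) * (X ^ p) ^ 2) * two0

theorem r2_hD (p q L : ℕ) :
    r2 (hD p q L) = ((1 + X) * (1 + X ^ p) * (1 + X ^ q) * (1 + X ^ (L + 1))) ^ 2 := by
  simp only [hD, map_mul, map_sub, map_pow, map_neg, r2_hA, r2_hB, r2_X, eps2]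
  linear_combination -(((1 + X) * (1 + X ^ p) * (1 + X ^ q)) ^ 2 * (X ^ (L + 1) * (1 + X ^ (L + 1)))) * two0

theorem r2_hT (a b c : ℕ) :
    r2 (hT a b c) = ((1 + X) * (1 + X ^ (a + 1) + X ^ (b + 1) + X ^ (c + 1) + X ^ (a + b) +
      X ^ (a + c) + X ^ (b + c) + X ^ (a + b + c + 1))) ^ 2 := by
  simp only [hT, map_mul, map_sub, map_add, map_pow, map_neg, map_one, map_ofNat, r2_X, eps2]
  have sq : ∀ a b : (ZMod 2)[X], (a + b) ^ 2 = a ^ 2 + b ^ 2 := fun a b => by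
    linear_combination (a * b) * two0
  have mn : ∀ a b : (ZMod 2)[X], a - b = a + b := fun a b => by
    linear_combination (-b) * two0
  simp only [mn, sq, two0, mul_pow]
  ring

theorem exists_min (a : ℕ) (K : Multiset ℕ) : ∃ e ∈ a ::ₘ K, ∀ k ∈ a ::ₘ K, e ≤ k := by
  have h : ∃ n, n ∈ a ::ₘ K := ⟨a, Multiset.mem_cons_self a K⟩
  exact ⟨Nat.find h, Nat.find_spec h, fun k hk => Nat.find_min' h hk⟩

theorem one_X_ne {S : Type} [CommRing S] [IsDomain S] {p : ℕ} (hp : 1 ≤ p) :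
    (1 + X ^ p : S[X]).coeff 0 ≠ 0 := by
  rw [coeff_add, coeff_X_pow, if_neg (by omega)]; simp

theorem f2_d {p q L p' q' L' : ℕ} {K : Multiset ℕ}
    (H : hD p q L = hD p' q' L' * (K.map cy).prod) :
    (1 + X ^ p) * (1 + X ^ q) * (1 + X ^ (L + 1)) =
      (1 + X ^ p') * (1 + X ^ q') * (1 + X ^ (L' + 1)) * Pz K := by
  have h := congrArg r2 H
  rw [map_mul, r2_hD, r2_hD, r2_prod, ← mul_pow] at h
  have h := sq_inj h
  have n : (1 + X : (ZMod 2)[X]) ≠ 0 := by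
    intro h0
    have := one_X_ne (S := ZMod 2) (p := 1) le_rfl
    rw [pow_one, h0] at this
    simp at this
  refine mul_left_cancel₀ n ?_
  linear_combination h

theorem f2_t {p q L a b c : ℕ} {K : Multiset ℕ}
    (H : hD p q L = hT a b c * (K.map cy).prod) :
    (1 + X ^ p) * (1 + X ^ q) * (1 + X ^ (L + 1)) =
      (1 + X ^ (a + 1) + X ^ (b + 1) + X ^ (c + 1) + X ^ (a + b) +
      X ^ (a + c) + X ^ (b + c) + X ^ (a + b + c + 1)) * Pz K := by
  have h := congrArg r2 H
  rw [map_mul, r2_hD, r2_hT, r2_prod, ← mul_pow] at h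
  have h := sq_inj h
  have n : (1 + X : (ZMod 2)[X]) ≠ 0 := by
    intro h0
    have := one_X_ne (S := ZMod 2) (p := 1) le_rfl
    rw [pow_one, h0] at this
    simp at this
  refine mul_left_cancel₀ n ?_
  linear_combination h

theorem pow_eq_low {e a b : ℕ} (h : (qm (ZMod 2) e X) ^ a = (qm (ZMod 2) e X) ^ b) :
    a = b ∨ (e ≤ a ∧ e ≤ b) := by
  rw [← map_pow, ← map_pow, qm_eq] at h
  by_contra hc
  have ha := h a
  have hb := h b
  simp only [coeff_X_pow] at ha hb
  by_cases hab : a = b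
  · exact hc (Or.inl hab)
  · simp [hab, Ne.symm hab] at ha hb
    omega


/-! ### Arithmetic: comparison with another dumbbell -/

def hb (p : ℕ) : ℤ[X] := (1 + X) + 2 * (1 + X ^ 2) * X ^ (p - 1) +
  (2 - X + X ^ 2) * ((-1) ^ p * X ^ (2 * p - 1))

theorem hB_eq {p : ℕ} (hp : 1 ≤ p) : hB p = X * hb p := by
  obtain ⟨k, rfl⟩ : ∃ k, p = k + 1 := ⟨p - 1, by omega⟩
  rw [hB, hb, eps_pow, show 2 * (k + 1) - 1 = 2 * k + 1 by omega, show k + 1 - 1 = k by omega]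
  ring

theorem qm_hb {m p : ℕ} (h : m + 1 ≤ p) : qm ℤ m (hb p) = 1 + qm ℤ m X := by
  simp only [hb, map_add, map_mul, map_pow, map_one, map_neg, map_sub, map_ofNat]
  rw [qm_pow (show m ≤ p - 1 by omega), qm_pow (show m ≤ 2 * p - 1 by omega)]
  ring

theorem qm_hA {m p : ℕ} (h : m ≤ 2 * p) : qm ℤ m (hA p) =
    (1 + qm ℤ m X + 2 * qm ℤ m X ^ 2) + 2 * (1 + qm ℤ m X ^ 2) * qm ℤ m X ^ p := by
  simp only [hA, map_add, map_mul, map_pow, map_one, map_neg, map_sub, map_ofNat]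
  rw [qm_eps h]
  ring

theorem qm_prod {m e : ℕ} {K : Multiset ℕ} (hK : ∀ k ∈ K, e ≤ k) (h : m ≤ 2 * e) :
    qm ℤ m (K.map cy).prod = 1 + 2 * qm ℤ m (Tm K) := by
  have := qm_zero (S := ℤ) (dvd_trans (pow_dvd_pow X h) (prod_cy K hK))
  rw [map_sub, sub_eq_zero] at this
  rw [this]
  simp only [map_add, map_mul, map_one, map_ofNat]

theorem qm_Tm {m e : ℕ} {K : Multiset ℕ} (hK : ∀ k ∈ K, e ≤ k) :
    ∃ t, qm ℤ m (Tm K) = qm ℤ m X ^ e * t := by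
  obtain ⟨t, ht⟩ := Tm_dvd hK
  exact ⟨qm ℤ m t, by rw [ht, map_mul, map_pow]⟩

theorem pow_split {R : Type*} [CommRing R] (x : R) {e p : ℕ} (h : e ≤ p) :
    x ^ p = x ^ e * x ^ (p - e) := by
  rw [← pow_add]; congr 1; omega

theorem path_eq {e L L' : ℕ} (he : 3 ≤ e) (hL : 1 ≤ L) {P Q : ℤ[X]}
    (hPQ : qm ℤ (e - 1) P = qm ℤ (e - 1) Q) (h : L + 1 = L' + 1 ∨ (e ≤ L + 1 ∧ e ≤ L' + 1)) :
    qm ℤ (e + 3) ((-X ^ 2) ^ L * (X ^ 2 * P)) = qm ℤ (e + 3) ((-X ^ 2) ^ L' * (X ^ 2 * Q)) := by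
  rw [← sub_eq_zero, ← map_sub]
  apply qm_zero
  rcases h with h | h
  · obtain rfl : L = L' := by omega
    rw [← sub_eq_zero, ← map_sub] at hPQ
    obtain ⟨r, hr⟩ := qm_dvd hPQ
    have e1 : (-X ^ 2) ^ L * (X ^ 2 * P) - (-X ^ 2) ^ L * (X ^ 2 * Q) =
        (-1) ^ L * X ^ (2 * L) * X ^ 2 * (P - Q) := by rw [eps_pow]; ring
    rw [e1, hr]
    have e2 : (-1) ^ L * X ^ (2 * L) * X ^ 2 * (X ^ (e - 1) * r) =
      X ^ (2 * L + 2 + (e - 1)) * ((-1) ^ L * r) := by rw [pow_add, pow_add]; ring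
    rw [e2]
    exact Dvd.dvd.mul_right (pow_dvd_pow X (by omega)) _
  · apply dvd_sub
    · rw [eps_pow, show (-1) ^ L * X ^ (2 * L) * (X ^ 2 * P) = X ^ (2 * L + 2) * ((-1) ^ L * P) by ring]
      exact Dvd.dvd.mul_right (pow_dvd_pow X (by omega)) _
    · rw [eps_pow, show (-1) ^ L' * X ^ (2 * L') * (X ^ 2 * Q) = X ^ (2 * L' + 2) * ((-1) ^ L' * Q) by ring]
      exact Dvd.dvd.mul_right (pow_dvd_pow X (by omega)) _

theorem hD_eq {p q L : ℕ} (hp : 1 ≤ p) (hq : 1 ≤ q) :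
    hD p q L = hA p * hA q - (-X ^ 2) ^ L * (X ^ 2 * (hb p * hb q)) := by
  rw [hD, hB_eq hp, hB_eq hq]; ring

theorem d_core {p q L p' q' L' e : ℕ} {K : Multiset ℕ} (he : 3 ≤ e)
    (hp : 1 ≤ p) (hq : 1 ≤ q) (hp' : 1 ≤ p') (hq' : 1 ≤ q') (hL : 1 ≤ L)
    (hb1 : qm ℤ (e - 1) (hb p * hb q) = qm ℤ (e - 1) (hb p' * hb q' * (K.map cy).prod))
    (hc : L + 1 = L' + 1 ∨ (e ≤ L + 1 ∧ e ≤ L' + 1))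
    (H : hD p q L = hD p' q' L' * (K.map cy).prod) :
    qm ℤ (e + 3) (hA p * hA q) = qm ℤ (e + 3) (hA p' * hA q' * (K.map cy).prod) := by
  have h1 := path_eq he hL hb1 hc
  rw [hD_eq hp hq, hD_eq hp' hq'] at H
  have h2 := congrArg (qm ℤ (e + 3)) H
  have e1 : (hA p' * hA q' - (-X ^ 2) ^ L' * (X ^ 2 * (hb p' * hb q'))) * (K.map cy).prod =
    hA p' * hA q' * (K.map cy).prod - (-X ^ 2) ^ L' * (X ^ 2 * (hb p' * hb q' * (K.map cy).prod)) := by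
    ring
  rw [e1, map_sub, map_sub, h1] at h2
  exact sub_left_injective h2

theorem ab0 : ((2 : ℤ[X]) * (1 + X + 2 * X ^ 2)).coeff 0 ≠ 0 := by
  rw [coeff_zero_eq_eval_zero]; simp

theorem d_stage1 {p q L p' q' L' e : ℕ} {K : Multiset ℕ} (he : 3 ≤ e)
    (hp : e ≤ p) (hq : e ≤ q) (hp' : e ≤ p') (hq' : e ≤ q') (hL : 1 ≤ L) (hK : ∀ k ∈ K, e ≤ k)
    (H : hD p q L = hD p' q' L' * (K.map cy).prod) (d : ℕ) (hd : d < e + 3) :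
    ((1 + X ^ 2) * (X ^ p + X ^ q - X ^ p' - X ^ q') : ℤ[X]).coeff d =
      ((1 + X + 2 * X ^ 2) * Tm K).coeff d := by
  have hc : L + 1 = L' + 1 ∨ (e ≤ L + 1 ∧ e ≤ L' + 1) := by
    apply pow_eq_low
    have h := congrArg (qm (ZMod 2) e) (f2_d H)
    simp only [map_add, map_mul, map_pow, map_one, Pz_low hK, qm_pow hp, qm_pow hq, qm_pow hp',
      qm_pow hq'] at h
    linear_combination h
  have h1 := d_core he (by omega) (by omega) (by omega) (by omega) hL (by
    obtain ⟨t, ht⟩ := qm_Tm (m := e - 1) hK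
    rw [map_mul, map_mul, map_mul, qm_hb (by omega), qm_hb (by omega), qm_hb (by omega),
      qm_hb (by omega), qm_prod hK (by omega), ht, qm_pow (by omega)]
    ring) hc H
  have hee : (qm ℤ (e + 3) X) ^ e * (qm ℤ (e + 3) X) ^ e = 0 := by
    rw [← pow_add]; exact qm_pow (by omega)
  obtain ⟨t, ht⟩ := qm_Tm (m := e + 3) hK
  have h2 : qm ℤ (e + 3) ((2 * (1 + X + 2 * X ^ 2)) *
      ((1 + X ^ 2) * (X ^ p + X ^ q - X ^ p' - X ^ q') - (1 + X + 2 * X ^ 2) * Tm K)) = 0 := by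
    rw [map_mul, map_mul, map_mul, qm_hA (by omega), qm_hA (by omega), qm_hA (by omega),
      qm_hA (by omega), qm_prod hK (by omega), ht] at h1
    simp only [map_add, map_mul, map_pow, map_one, map_sub, map_ofNat, ht]
    rw [pow_split _ hp, pow_split _ hq, pow_split _ hp', pow_split _ hq'] at h1 ⊢
    generalize qm ℤ (e + 3) X ^ e = z at *
    generalize qm ℤ (e + 3) X ^ (p - e) = a at *
    generalize qm ℤ (e + 3) X ^ (q - e) = b at *
    generalize qm ℤ (e + 3) X ^ (p' - e) = c at *
    generalize qm ℤ (e + 3) X ^ (q' - e) = f at *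
    generalize qm ℤ (e + 3) X = x at *
    linear_combination h1 + (-4 * (1 + x ^ 2) ^ 2 * a * b + 4 * (1 + x ^ 2) ^ 2 * c * f +
      4 * (1 + x + 2 * x ^ 2) * (1 + x ^ 2) * (c + f) * t + 8 * (1 + x ^ 2) ^ 2 * c * f * z * t) * hee
  have h3 := qm_cancel ab0 h2
  rw [map_sub, sub_eq_zero, qm_eq] at h3
  exact h3 d hd

theorem d_stage2 {p q L q' L' e : ℕ} {K : Multiset ℕ} (he : 3 ≤ e)
    (hp : 3 ≤ p) (hq : e ≤ q) (hq' : e ≤ q') (hL : 1 ≤ L) (hK : ∀ k ∈ K, e ≤ k)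
    (H : hD p q L = hD p q' L' * (K.map cy).prod) (d : ℕ) (hd : d < e + 3) :
    ((1 + X ^ 2) * (X ^ q - X ^ q') : ℤ[X]).coeff d =
      ((1 + X + 2 * X ^ 2) * Tm K).coeff d := by
  have hc : L + 1 = L' + 1 ∨ (e ≤ L + 1 ∧ e ≤ L' + 1) := by
    apply pow_eq_low
    have h0 := f2_d H
    have h : qm (ZMod 2) e ((1 + X ^ p) * ((1 + X ^ q) * (1 + X ^ (L + 1)) -
        (1 + X ^ q') * (1 + X ^ (L' + 1)) * Pz K)) = 0 := by
      rw [show (1 + X ^ p) * ((1 + X ^ q) * (1 + X ^ (L + 1)) -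
        (1 + X ^ q') * (1 + X ^ (L' + 1)) * Pz K) = 0 by linear_combination h0, map_zero]
    have h := qm_cancel (one_X_ne (by omega)) h
    simp only [map_add, map_mul, map_pow, map_one, map_sub, Pz_low hK, qm_pow hq,
      qm_pow hq'] at h
    linear_combination h
  have h1 := d_core he (by omega) (by omega) (by omega) (by omega) hL (by
    obtain ⟨t, ht⟩ := qm_Tm (m := e - 1) hK
    rw [map_mul, map_mul, map_mul, qm_hb (p := q) (by omega), qm_hb (p := q') (by omega),
      qm_prod hK (by omega), ht, qm_pow (by omega)]
    ring) hc H
  have hA0 : (2 * hA p).coeff 0 ≠ 0 := by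
    rw [coeff_zero_eq_eval_zero]
    simp [hA, show p ≠ 0 by omega]
  have hee : (qm ℤ (e + 3) X) ^ e * (qm ℤ (e + 3) X) ^ e = 0 := by
    rw [← pow_add]; exact qm_pow (by omega)
  obtain ⟨t, ht⟩ := qm_Tm (m := e + 3) hK
  have h2 : qm ℤ (e + 3) ((2 * hA p) *
      ((1 + X ^ 2) * (X ^ q - X ^ q') - (1 + X + 2 * X ^ 2) * Tm K)) = 0 := by
    rw [map_mul, map_mul, map_mul, qm_hA (p := q) (by omega),
      qm_hA (p := q') (by omega), qm_prod hK (by omega), ht] at h1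
    simp only [map_add, map_mul, map_pow, map_one, map_sub, map_ofNat, ht]
    rw [pow_split _ hq, pow_split _ hq'] at h1 ⊢
    generalize qm ℤ (e + 3) X ^ e = z at *
    generalize qm ℤ (e + 3) X ^ (q - e) = b at *
    generalize qm ℤ (e + 3) X ^ (q' - e) = f at *
    generalize qm ℤ (e + 3) X = x at *
    linear_combination h1 + (qm ℤ (e + 3) (hA p) * 4 * (1 + x ^ 2) * f * t) * hee
  have h3 := qm_cancel hA0 h2
  rw [map_sub, sub_eq_zero, qm_eq] at h3
  exact h3 d hd

theorem sum_pos_of {K : Multiset ℕ} {k : ℕ} (hk : k ∈ K) : k ≤ K.sum :=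
  Multiset.single_le_sum (fun _ _ => Nat.zero_le _) _ hk

theorem d_stage3 {p q L L' : ℕ} {K : Multiset ℕ}
    (hp : 3 ≤ p) (hq : 3 ≤ q) (hL : 1 ≤ L) (hK : ∀ k ∈ K, 3 ≤ k) (hs : L = L' + K.sum)
    (H : hD p q L = hD p q L' * (K.map cy).prod) : K = 0 := by
  by_contra h0
  obtain ⟨a, ha⟩ := Multiset.exists_mem_of_ne_zero h0
  obtain ⟨K0, rfl⟩ := Multiset.exists_cons_of_mem ha
  obtain ⟨e, he, hmin⟩ := exists_min a K0
  generalize a ::ₘ K0 = K at *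
  have h3 := hK e he
  have hs1 := sum_pos_of he
  have hc : L + 1 = L' + 1 ∨ (e ≤ L + 1 ∧ e ≤ L' + 1) := by
    apply pow_eq_low
    have h0 := f2_d H
    have h : qm (ZMod 2) e ((1 + X ^ p) * ((1 + X ^ q) * ((1 + X ^ (L + 1)) -
        (1 + X ^ (L' + 1)) * Pz K))) = 0 := by
      rw [show (1 + X ^ p) * ((1 + X ^ q) * ((1 + X ^ (L + 1)) -
        (1 + X ^ (L' + 1)) * Pz K)) = 0 by linear_combination h0, map_zero]
    have h := qm_cancel (one_X_ne (by omega)) (qm_cancel (one_X_ne (by omega)) h)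
    simp only [map_add, map_mul, map_pow, map_one, map_sub, Pz_low hmin] at h
    linear_combination h
  have hc : e ≤ L + 1 ∧ e ≤ L' + 1 := by omega
  have hA0 : (2 * (hA p * hA q)).coeff 0 ≠ 0 := by
    rw [coeff_zero_eq_eval_zero]
    simp [hA, show p ≠ 0 by omega, show q ≠ 0 by omega]
  have h2 : qm ℤ (e + 1) ((2 * (hA p * hA q)) * Tm K) = 0 := by
    have h := congrArg (qm ℤ (e + 1)) H
    simp only [hD, map_mul, map_sub, map_pow, map_neg] at h
    rw [qm_eps (by omega), qm_eps (by omega), qm_prod hmin (by omega)] at h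
    simp only [map_mul, map_ofNat]
    linear_combination -h
  have h3 := qm_cancel hA0 h2
  rw [← map_zero (qm ℤ (e + 1)), qm_eq] at h3
  have := h3 e (by omega)
  rw [Tm_coeff] at this
  have h4 := Multiset.count_pos.2 he
  rw [coeff_zero] at this
  omega

theorem coe_b : (1 + X ^ 2 : ℤ[X]).coeff 0 = 1 ∧ (1 + X ^ 2 : ℤ[X]).coeff 1 = 0 ∧
    (1 + X ^ 2 : ℤ[X]).coeff 2 = 1 := by
  refine ⟨?_, ?_, ?_⟩ <;> simp [coeff_one, coeff_X_pow]

theorem two_eqC : (2 : ℤ[X]) = C 2 := by simp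

theorem coe_a : (1 + X + 2 * X ^ 2 : ℤ[X]).coeff 0 = 1 ∧ (1 + X + 2 * X ^ 2 : ℤ[X]).coeff 1 = 1 ∧
    (1 + X + 2 * X ^ 2: ℤ[X]).coeff 2 = 2 := by
  rw [two_eqC]
  refine ⟨?_, ?_, ?_⟩ <;> simp only [coeff_add, coeff_one, coeff_X, coeff_C_mul, coeff_X_pow] <;> norm_num

theorem arith_d' {p q L p' q' L' : ℕ} {K : Multiset ℕ}
    (hp : 3 ≤ p) (hq : 3 ≤ q) (hq' : 3 ≤ q') (hL : 1 ≤ L)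
    (hK : ∀ k ∈ K, 3 ≤ k) (hs : p + q + L = p' + q' + L' + K.sum) (hpp : p = p')
    (H : hD p q L = hD p' q' L' * (K.map cy).prod) : K = 0 ∧ L = L' ∧ q = q' := by
  subst hpp
  have hqq : q = q' := by
    obtain ⟨e, he, hmin⟩ := exists_min q (q' ::ₘ K)
    simp only [Multiset.mem_cons, forall_eq_or_imp] at he hmin
    obtain ⟨m1, m2, m3⟩ := hmin
    have he3 : 3 ≤ e := by
      rcases he with rfl | rfl | h
      · exact hq
      · exact hq'
      · exact hK e h
    have h := d_stage2 he3 hp m1 m2 hL m3 H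
    have l1 : ∀ d, d < e → (X ^ q - X ^ q' : ℤ[X]).coeff d = 0 := by
      intro d hd
      simp only [coeff_sub, coeff_X_pow]
      rw [if_neg (by omega), if_neg (by omega)]; rfl
    have c1 := mul_coeffs (1 + X ^ 2) _ l1
    have c2 := mul_coeffs (1 + X + 2 * X ^ 2) _ (Tm_low m3)
    have g0 := h e (by omega)
    have g1 := h (e + 1) (by omega)
    rw [c1.1, c2.1] at g0
    rw [c1.2.1, c2.2.1] at g1
    simp only [coe_a, coe_b, coeff_sub, coeff_X_pow, Tm_coeff] at g0 g1
    have hce : e ∈ K → 0 < K.count e := fun h => Multiset.count_pos.2 h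
    by_cases heK : e ∈ K
    · have := hce heK
      split_ifs at g0 g1 <;> omega
    · have := Multiset.count_eq_zero_of_notMem heK
      simp only [heK, or_false] at he
      split_ifs at g0 g1 <;> omega
  subst hqq
  have hK0 := d_stage3 hp hq hL hK (by omega) H
  refine ⟨hK0, ?_, rfl⟩
  rw [hK0] at hs
  simp at hs
  omega

theorem hD_comm (p q L : ℕ) : hD p q L = hD q p L := by unfold hD; ring

theorem arith_d {p q L p' q' L' : ℕ} {K : Multiset ℕ}
    (hp : 3 ≤ p) (hq : 3 ≤ q) (hp' : 3 ≤ p') (hq' : 3 ≤ q') (hL : 1 ≤ L)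
    (hK : ∀ k ∈ K, 3 ≤ k) (hs : p + q + L = p' + q' + L' + K.sum)
    (H : hD p q L = hD p' q' L' * (K.map cy).prod) :
    K = 0 ∧ L = L' ∧ (p = p' ∧ q = q' ∨ p = q' ∧ q = p') := by
  obtain ⟨e, he, hmin⟩ := exists_min p (q ::ₘ p' ::ₘ q' ::ₘ K)
  simp only [Multiset.mem_cons, forall_eq_or_imp] at he hmin
  obtain ⟨m1, m2, m3, m4, m5⟩ := hmin
  have he3 : 3 ≤ e := by
    rcases he with rfl | rfl | rfl | rfl | h
    · exact hp
    · exact hq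
    · exact hp'
    · exact hq'
    · exact hK e h
  have h := d_stage1 he3 m1 m2 m3 m4 hL m5 H
  have l1 : ∀ d, d < e → (X ^ p + X ^ q - X ^ p' - X ^ q' : ℤ[X]).coeff d = 0 := by
    intro d hd
    simp only [coeff_sub, coeff_add, coeff_X_pow]
    rw [if_neg (by omega), if_neg (by omega), if_neg (by omega), if_neg (by omega)]; rfl
  have c1 := mul_coeffs (1 + X ^ 2) _ l1
  have c2 := mul_coeffs (1 + X + 2 * X ^ 2) _ (Tm_low m5)
  have g0 := h e (by omega)
  have g1 := h (e + 1) (by omega)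
  have g2 := h (e + 2) (by omega)
  rw [c1.1, c2.1] at g0
  rw [c1.2.1, c2.2.1] at g1
  rw [c1.2.2.1, c2.2.2.1] at g2
  simp only [coe_a, coe_b] at g0 g1 g2
  simp only [coeff_sub, coeff_add, coeff_X_pow, Tm_coeff] at g0 g1 g2
  have key : (p = e ∨ q = e) ∧ (p' = e ∨ q' = e) := by
    have bd : ∀ x : ℕ, ((if e = x then (1 : ℤ) else 0) = 0 ∨ x = e ∧ (if e = x then (1 : ℤ) else 0) = 1) ∧
        0 ≤ (if e + 1 = x then (1 : ℤ) else 0) ∧ 0 ≤ (if e + 2 = x then (1 : ℤ) else 0) ∧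
        (if e = x then (1 : ℤ) else 0) + (if e + 1 = x then (1 : ℤ) else 0) +
        (if e + 2 = x then (1 : ℤ) else 0) ≤ 1 ∧ (x = e → (if e = x then (1 : ℤ) else 0) = 1):= by
      intro x
      split_ifs <;> omega
    have b1 := bd p
    have b2 := bd q
    have b3 := bd p'
    have b4 := bd q'
    generalize (if e = p then (1 : ℤ) else 0) = x1 at *
    generalize (if e = q then (1 : ℤ) else 0) = x2 at *
    generalize (if e = p' then (1 : ℤ) else 0) = x3 at *
    generalize (if e = q' then (1 : ℤ) else 0) = x4 at *
    generalize (if e + 1 = p then (1 : ℤ) else 0) = x5 at *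
    generalize (if e + 1 = q then (1 : ℤ) else 0) = x6 at *
    generalize (if e + 1 = p' then (1 : ℤ) else 0) = x7 at *
    generalize (if e + 1 = q' then (1 : ℤ) else 0) = x8 at *
    generalize (if e + 2 = p then (1 : ℤ) else 0) = x9 at *
    generalize (if e + 2 = q then (1 : ℤ) else 0) = x10 at *
    generalize (if e + 2 = p' then (1 : ℤ) else 0) = x11 at *
    generalize (if e + 2 = q' then (1 : ℤ) else 0) = x12 at *
    clear bd h c1 c2 l1
    have hN : K.count e = 0 := by
      omega
    have heK : e ∉ K := Multiset.count_eq_zero.1 hN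
    simp only [heK, or_false] at he
    rw [hN] at g0
    clear g1 g2
    omega
  rcases key with ⟨k1 | k1, k2 | k2⟩
  · obtain ⟨r1, r2, r3⟩ := arith_d' hp hq hq' hL hK hs (by omega) H
    exact ⟨r1, r2, Or.inl ⟨by omega, r3⟩⟩
  · obtain ⟨r1, r2, r3⟩ := arith_d' (p' := q') (q' := p') (L' := L') hp hq hp' hL hK (by omega) (by omega)
      (by rw [hD_comm q']; exact H)
    exact ⟨r1, r2, Or.inr ⟨by omega, r3⟩⟩
  · obtain ⟨r1, r2, r3⟩ := arith_d' (p := q) (q := p) (L := L) (p' := p') (q' := q') (L' := L') hq hp hq' hL hK (by omega) (by omega)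
      (by rw [hD_comm q]; exact H)
    exact ⟨r1, r2, Or.inr ⟨r3, by omega⟩⟩
  · obtain ⟨r1, r2, r3⟩ := arith_d' (p := q) (q := p) (L := L) (p' := q') (q' := p') (L' := L') hq hp hp' hL hK (by omega) (by omega)
      (by rw [hD_comm q, hD_comm q']; exact H)
    exact ⟨r1, r2, Or.inl ⟨r3, by omega⟩⟩


/-! ### Arithmetic: comparison with a theta graph -/

def wT (l : ℕ) : ℤ[X] := X ^ 2 * (1 + X) ^ 2 * (-X ^ 2) ^ l

theorem qm_hB {m p : ℕ} (h : m ≤ 2 * p) : qm ℤ m (hB p) =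
    qm ℤ m X * (1 + qm ℤ m X) + 2 * (1 + qm ℤ m X ^ 2) * qm ℤ m X ^ p := by
  simp only [hB, map_add, map_mul, map_pow, map_one, map_neg, map_sub, map_ofNat]
  rw [qm_eps h]
  ring

theorem eps_four {m l : ℕ} (hl : 2 ≤ l) :
    ∃ f, (-(qm ℤ m X) ^ 2) ^ l = (qm ℤ m X) ^ 4 * f := by
  refine ⟨(-1) ^ l * qm ℤ m X ^ (2 * l - 4), ?_⟩
  rw [eps_pow, pow_split (qm ℤ m X) (show 4 ≤ 2 * l by omega)]
  ring

theorem t_star {p q L a b c e m : ℕ} {K : Multiset ℕ} (hm1 : m ≤ 2 * e) (hm2 : m ≤ e + 4)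
    (hp : e ≤ p) (hq : e ≤ q) (hK : ∀ k ∈ K, e ≤ k) (hab : e ≤ a + b) (hac : e ≤ a + c)
    (hbc : e ≤ b + c) (ha : 2 ≤ a) (hb : 2 ≤ b) (hc : 2 ≤ c) (hL : 2 ≤ L)
    (H : hD p q L = hT a b c * (K.map cy).prod) :
    qm ℤ m (2 * ((1 + X + 2 * X ^ 2) * (1 + X ^ 2)) * (X ^ p + X ^ q) - wT L) =
    qm ℤ m (2 * (1 + X + 2 * X ^ 2) ^ 2 * Tm K - (wT a + wT b + wT c) +
      2 * (1 + X ^ 2) ^ 2 * (X ^ (a + b) + X ^ (a + c) + X ^ (b + c))) := by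
  have h1 := congrArg (qm ℤ m) H
  have hz : (qm ℤ m X) ^ e * (qm ℤ m X) ^ e = 0 := by
    rw [← pow_add]; exact qm_pow (by omega)
  have h4 : (qm ℤ m X) ^ 4 * (qm ℤ m X) ^ e = 0 := by
    rw [← pow_add]; exact qm_pow (by omega)
  obtain ⟨t, ht⟩ := qm_Tm (m := m) hK
  obtain ⟨g, hg⟩ := eps_four (m := m) hL
  obtain ⟨f1, hf1⟩ := eps_four (m := m) ha
  obtain ⟨f2, hf2⟩ := eps_four (m := m) hb
  obtain ⟨f3, hf3⟩ := eps_four (m := m) hc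
  simp only [hD, hT, map_add, map_mul, map_pow, map_one, map_neg, map_sub, map_ofNat,
    qm_hA (show m ≤ 2 * p by omega), qm_hA (show m ≤ 2 * q by omega),
    qm_hB (show m ≤ 2 * p by omega), qm_hB (show m ≤ 2 * q by omega), qm_prod hK hm1, ht,
    hg, hf1, hf2, hf3, qm_eps (show m ≤ 2 * (a + b) by omega),
    qm_eps (show m ≤ 2 * (a + c) by omega), qm_eps (show m ≤ 2 * (b + c) by omega),
    qm_eps (show m ≤ 2 * (a + b + c) by omega)] at h1
  simp only [wT, map_add, map_mul, map_pow, map_one, map_neg, map_sub, map_ofNat, ht,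
    hg, hf1, hf2, hf3]
  rw [pow_split _ hp, pow_split _ hq, pow_split _ hab, pow_split _ hac, pow_split _ hbc] at h1 ⊢
  generalize qm ℤ m X ^ (p - e) = u at *
  generalize qm ℤ m X ^ (q - e) = v at *
  generalize qm ℤ m X ^ (a + b - e) = s1 at *
  generalize qm ℤ m X ^ (a + c - e) = s2 at *
  generalize qm ℤ m X ^ (b + c - e) = s3 at *
  generalize qm ℤ m X ^ e = z at *
  generalize qm ℤ m X = x at *
  linear_combination h1 + (-4 * (1 + x ^ 2) ^ 2 * u * v + 4 * (1 + x ^ 2) ^ 2 * t * (s1 + s2 + s3)) * hz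
    + (g * (2 * (1 + x ^ 2) * x * (1 + x) * (u + v) + 4 * (1 + x ^ 2) ^ 2 * z * u * v)
      - 2 * (1 + x ^ 2) ^ 2 * (s1 * f3 + s2 * f2 + s3 * f1)
      - 2 * t * x ^ 2 * (1 + x) ^ 2 * (f1 + f2 + f3)
      - 4 * (1 + x ^ 2) ^ 2 * t * (s1 * f3 + s2 * f2 + s3 * f1) * z) * h4

theorem qm_wT {m l : ℕ} (h : m ≤ 2 * l + 2) : qm ℤ m (wT l) = 0 := by
  apply qm_zero
  rw [wT, eps_pow, show (X : ℤ[X]) ^ 2 * (1 + X) ^ 2 * ((-1) ^ l * X ^ (2 * l)) =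
    X ^ (2 * l + 2) * ((1 + X) ^ 2 * (-1) ^ l) by ring]
  exact Dvd.dvd.mul_right (pow_dvd_pow X h) _

/-- Indicator. -/
def dl (a j : ℕ) : ℤ := if j = a then 1 else 0

theorem coeff_ab : ((1 + X + 2 * X ^ 2) * (1 + X ^ 2) : ℤ[X]).coeff 0 = 1 ∧
    ((1 + X + 2 * X ^ 2) * (1 + X ^ 2) : ℤ[X]).coeff 1 = 1 ∧
    ((1 + X + 2 * X ^ 2) * (1 + X ^ 2) : ℤ[X]).coeff 2 = 3 ∧
    ((1 + X + 2 * X ^ 2) * (1 + X ^ 2) : ℤ[X]).coeff 3 = 1 := by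
  have : ((1 + X + 2 * X ^ 2) * (1 + X ^ 2) : ℤ[X]) = 1 + X + C 3 * X ^ 2 + X ^ 3 + C 2 * X ^ 4 := by
    have h3 : (C 3 : ℤ[X]) = 3 := by simp
    rw [h3, ← two_eqC]; ring
  rw [this]
  refine ⟨?_, ?_, ?_, ?_⟩ <;>
    simp only [coeff_add, coeff_one, coeff_X, coeff_C_mul, coeff_X_pow] <;> norm_num

theorem coeff_aa : ((1 + X + 2 * X ^ 2) ^ 2 : ℤ[X]).coeff 0 = 1 ∧
    ((1 + X + 2 * X ^ 2) ^ 2 : ℤ[X]).coeff 1 = 2 ∧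
    ((1 + X + 2 * X ^ 2) ^ 2 : ℤ[X]).coeff 2 = 5 ∧
    ((1 + X + 2 * X ^ 2) ^ 2 : ℤ[X]).coeff 3 = 4 := by
  have : ((1 + X + 2 * X ^ 2) ^ 2 : ℤ[X]) = 1 + C 2 * X + C 5 * X ^ 2 + C 4 * X ^ 3 + C 4 * X ^ 4 := by
    have h3 : (C 5 : ℤ[X]) = 5 := by simp
    have h4 : (C 4 : ℤ[X]) = 4 := by simp
    rw [h3, h4, ← two_eqC]; ring
  rw [this]
  refine ⟨?_, ?_, ?_, ?_⟩ <;>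
    simp only [coeff_add, coeff_one, coeff_X, coeff_C_mul, coeff_X_pow] <;> norm_num

theorem coeff_bb : ((1 + X ^ 2) ^ 2 : ℤ[X]).coeff 0 = 1 ∧
    ((1 + X ^ 2) ^ 2 : ℤ[X]).coeff 1 = 0 ∧
    ((1 + X ^ 2) ^ 2 : ℤ[X]).coeff 2 = 2 ∧
    ((1 + X ^ 2) ^ 2 : ℤ[X]).coeff 3 = 0 := by
  have : ((1 + X ^ 2) ^ 2 : ℤ[X]) = 1 + C 2 * X ^ 2 + X ^ 4 := by
    rw [← two_eqC]; ring
  rw [this]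
  refine ⟨?_, ?_, ?_, ?_⟩ <;>
    simp only [coeff_add, coeff_one, coeff_X, coeff_C_mul, coeff_X_pow] <;> norm_num

theorem coeff_ww (k : ℤ) : (X ^ 2 * (1 + X) ^ 2 * C k : ℤ[X]).coeff 0 = 0 ∧
    (X ^ 2 * (1 + X) ^ 2 * C k : ℤ[X]).coeff 1 = 0 ∧
    (X ^ 2 * (1 + X) ^ 2 * C k : ℤ[X]).coeff 2 = k ∧
    (X ^ 2 * (1 + X) ^ 2 * C k : ℤ[X]).coeff 3 = 2 * k := by
  have : (X ^ 2 * (1 + X) ^ 2 * C k : ℤ[X]) = C k * X ^ 2 + C (2 * k) * X ^ 3 + C k * X ^ 4 := by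
    rw [C_mul, ← two_eqC]; ring
  rw [this]
  refine ⟨?_, ?_, ?_, ?_⟩ <;>
    simp only [coeff_add, coeff_one, coeff_X, coeff_C_mul, coeff_X_pow] <;> norm_num

theorem t_eqs {p q L a b c e m : ℕ} {K : Multiset ℕ} (hm1 : m ≤ 2 * e) (hm2 : m ≤ e + 4)
    (hp : e ≤ p) (hq : e ≤ q) (hK : ∀ k ∈ K, e ≤ k) (hab : e ≤ a + b) (hac : e ≤ a + c)
    (hbc : e ≤ b + c) (ha : 2 ≤ a) (hb : 2 ≤ b) (hc : 2 ≤ c) (hL : 2 ≤ L) (k : ℤ)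
    (hk : qm ℤ m (wT a + wT b + wT c - wT L) = qm ℤ m (2 * (X ^ 2 * (1 + X) ^ 2 * C k) * X ^ e))
    (H : hD p q L = hT a b c * (K.map cy).prod) :
    (e < m → dl p e + dl q e = K.count e + (dl (a + b) e + dl (a + c) e + dl (b + c) e)) ∧
    (e + 1 < m → (dl p (e + 1) + dl q (e + 1)) + (dl p e + dl q e) =
      K.count (e + 1) + 2 * K.count e +
        (dl (a + b) (e + 1) + dl (a + c) (e + 1) + dl (b + c) (e + 1))) ∧
    (e + 2 < m → (dl p (e + 2) + dl q (e + 2)) + (dl p (e + 1) + dl q (e + 1)) +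
        3 * (dl p e + dl q e) =
      K.count (e + 2) + 2 * K.count (e + 1) + 5 * K.count e +
        (dl (a + b) (e + 2) + dl (a + c) (e + 2) + dl (b + c) (e + 2)) +
        2 * (dl (a + b) e + dl (a + c) e + dl (b + c) e) - k) ∧
    (e + 3 < m → (dl p (e + 3) + dl q (e + 3)) + (dl p (e + 2) + dl q (e + 2)) +
        3 * (dl p (e + 1) + dl q (e + 1)) + (dl p e + dl q e) =
      K.count (e + 3) + 2 * K.count (e + 2) + 5 * K.count (e + 1) + 4 * K.count e +
        (dl (a + b) (e + 3) + dl (a + c) (e + 3) + dl (b + c) (e + 3)) +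
        2 * (dl (a + b) (e + 1) + dl (a + c) (e + 1) + dl (b + c) (e + 1)) - 2 * k) := by
  have h1 := t_star hm1 hm2 hp hq hK hab hac hbc ha hb hc hL H
  have h2 : qm ℤ m (2 * (((1 + X + 2 * X ^ 2) * (1 + X ^ 2)) * (X ^ p + X ^ q) -
      ((1 + X + 2 * X ^ 2) ^ 2 * Tm K +
      (1 + X ^ 2) ^ 2 * (X ^ (a + b) + X ^ (a + c) + X ^ (b + c)) -
      (X ^ 2 * (1 + X) ^ 2 * C k) * X ^ e))) = 0 := by
    have e1 : (2 * (((1 + X + 2 * X ^ 2) * (1 + X ^ 2)) * (X ^ p + X ^ q) -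
      ((1 + X + 2 * X ^ 2) ^ 2 * Tm K +
      (1 + X ^ 2) ^ 2 * (X ^ (a + b) + X ^ (a + c) + X ^ (b + c)) -
      (X ^ 2 * (1 + X) ^ 2 * C k) * X ^ e)) : ℤ[X]) =
      ((2 * ((1 + X + 2 * X ^ 2) * (1 + X ^ 2)) * (X ^ p + X ^ q) - wT L) -
      (2 * (1 + X + 2 * X ^ 2) ^ 2 * Tm K - (wT a + wT b + wT c) +
      2 * (1 + X ^ 2) ^ 2 * (X ^ (a + b) + X ^ (a + c) + X ^ (b + c)))) -
      ((wT a + wT b + wT c - wT L) - 2 * (X ^ 2 * (1 + X) ^ 2 * C k) * X ^ e) := by ring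
    rw [e1, map_sub, map_sub, h1, map_sub _ (wT a + wT b + wT c - wT L), hk]
    simp
  have h3 := qm_cancel (by rw [two_eqC]; simp) h2
  rw [map_sub, sub_eq_zero, qm_eq] at h3
  have l1 : ∀ d, d < e → (X ^ p + X ^ q : ℤ[X]).coeff d = 0 := by
    intro d hd
    simp only [coeff_add, coeff_X_pow]
    rw [if_neg (by omega), if_neg (by omega)]; rfl
  have l2 : ∀ d, d < e → (X ^ (a + b) + X ^ (a + c) + X ^ (b + c) : ℤ[X]).coeff d = 0 := by
    intro d hd
    simp only [coeff_add, coeff_X_pow]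
    rw [if_neg (by omega), if_neg (by omega), if_neg (by omega)]; rfl
  have l3 : ∀ d, d < e → (X ^ e : ℤ[X]).coeff d = 0 := by
    intro d hd
    simp only [coeff_X_pow]
    rw [if_neg (by omega)]
  have c1 := mul_coeffs ((1 + X + 2 * X ^ 2) * (1 + X ^ 2)) _ l1
  have c2 := mul_coeffs ((1 + X + 2 * X ^ 2) ^ 2) _ (Tm_low hK)
  have c3 := mul_coeffs ((1 + X ^ 2) ^ 2) _ l2
  have c4 := mul_coeffs (X ^ 2 * (1 + X) ^ 2 * C k) _ l3
  simp only [coeff_ab, coeff_aa, coeff_bb, coeff_ww] at c1 c2 c3 c4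
  have x0 : ∀ i j : ℕ, (X ^ i : ℤ[X]).coeff j = dl i j := fun i j => by rw [coeff_X_pow, dl]
  simp only [coeff_add, x0, Tm_coeff] at c1 c2 c3 c4
  have y0 : dl e e = 1 := by simp [dl]
  have y1 : dl e (e + 1) = 0 := by simp [dl]
  rw [y0, y1] at c4
  refine ⟨fun hm => ?_, fun hm => ?_, fun hm => ?_, fun hm => ?_⟩
  · have := h3 _ hm
    rw [coeff_sub, coeff_add, c1.1, c2.1, c3.1, c4.1] at this
    linarith
  · have := h3 _ hm
    rw [coeff_sub, coeff_add, c1.2.1, c2.2.1, c3.2.1, c4.2.1] at this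
    linarith
  · have := h3 _ hm
    rw [coeff_sub, coeff_add, c1.2.2.1, c2.2.2.1, c3.2.2.1, c4.2.2.1] at this
    linarith
  · have := h3 _ hm
    rw [coeff_sub, coeff_add, c1.2.2.2, c2.2.2.2, c3.2.2.2, c4.2.2.2] at this
    linarith

theorem t_f2 {p q L a b c e : ℕ} {K : Multiset ℕ}
    (hp : e ≤ p) (hq : e ≤ q) (hK : ∀ k ∈ K, e ≤ k) (hab : e ≤ a + b) (hac : e ≤ a + c)
    (hbc : e ≤ b + c) (H : hD p q L = hT a b c * (K.map cy).prod) (j : ℕ) (hj : j < e) :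
    ((if j = L + 1 then 1 else 0) + (if j = a + 1 then 1 else 0) + (if j = b + 1 then 1 else 0) +
      (if j = c + 1 then 1 else 0)) % 2 = 0 := by
  have h := congrArg (qm (ZMod 2) e) (f2_t H)
  have h' : qm (ZMod 2) e (1 + X ^ (L + 1)) =
      qm (ZMod 2) e (1 + X ^ (a + 1) + X ^ (b + 1) + X ^ (c + 1)) := by
    simp only [map_add, map_mul, map_pow, map_one, Pz_low hK, qm_pow hp, qm_pow hq, qm_pow hab,
      qm_pow hac, qm_pow hbc, qm_pow (show e ≤ a + b + c + 1 by omega)] at h ⊢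
    linear_combination h
  rw [qm_eq] at h'
  have h2 := h' j hj
  simp only [coeff_add, coeff_X_pow] at h2
  generalize (1 : (ZMod 2)[X]).coeff j = o at h2
  split_ifs at h2 ⊢ <;> first | rfl | (exfalso; revert h2; revert o; decide)


theorem hT_swap1 (a b c : ℕ) : hT a b c = hT b a c := by
  unfold hT
  rw [add_comm a b]; ring

theorem hT_swap2 (a b c : ℕ) : hT a b c = hT a c b := by
  unfold hT
  rw [add_comm b c, add_right_comm a b c]; ring

theorem t_final {l c L : ℕ} {K : Multiset ℕ} (hl : 2 ≤ l) (hlc : l < c)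
    (hs : (-1 : ℤ) ^ l = 1) (hK : ∀ k ∈ K, 2 * l ≤ k) (hsz : L = c + K.sum)
    (H : hD (2 * l) (2 * l) L = hT l l c * ((2 * l ::ₘ K).map cy).prod) : False := by
  have hs' : (-1 : ℤ[X]) ^ l = 1 := by
    have := congrArg (C : ℤ → ℤ[X]) hs
    simpa using this
  set z : ℤ[X] := X ^ (2 * l) with hz
  have e1 : (-X ^ 2 : ℤ[X]) ^ l = z := by rw [eps_pow, hs', one_mul]
  have e2 : (-X ^ 2 : ℤ[X]) ^ (2 * l) = z ^ 2 := by rw [two_mul, pow_add, e1]; ring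
  have hz0 : z.coeff 0 = 0 := by rw [hz, coeff_X_pow, if_neg (by omega)]
  set U : ℤ[X] := (1 + X + 2 * X ^ 2) + (1 - X) * z with hU
  set W : ℤ[X] := X * (1 + X) + (2 - X + X ^ 2) * z with hW
  have hAe : hA (2 * l) = (1 + z) * U := by
    rw [hA, e2, ← hz, hU]; ring
  have hBe : hB (2 * l) = (1 + z) * W := by
    rw [hB, e2, ← hz, hW]; ring
  have hce : cy (2 * l) = (1 + z) ^ 2 := by
    rw [cy, e2, ← hz]; ring
  have hTe : hT l l c = U ^ 2 - (-X ^ 2) ^ c * W ^ 2 +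
      4 * (1 + X ^ 2) ^ 2 * X ^ (l + c) * (1 - z) := by
    rw [hT, pow_add (-X ^ 2 : ℤ[X]) (l + l) c, pow_add (-X ^ 2 : ℤ[X]) l l,
      pow_add (-X ^ 2 : ℤ[X]) l c, e1, ← two_mul l, ← hz, hU, hW]
    ring
  have h1z : (1 + z : ℤ[X]) ≠ 0 := by
    intro h
    have := congrArg (fun P => coeff P 0) h
    simp [hz0] at this
  have H2 : U ^ 2 - (-X ^ 2) ^ L * W ^ 2 = (U ^ 2 - (-X ^ 2) ^ c * W ^ 2 +
      4 * (1 + X ^ 2) ^ 2 * X ^ (l + c) * (1 - z)) * (K.map cy).prod := by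
    apply mul_left_cancel₀ (pow_ne_zero 2 h1z)
    rw [hD, hAe, hBe, hTe, Multiset.map_cons, Multiset.prod_cons, hce] at H
    linear_combination H
  have hU0 : U.coeff 0 = 1 := by
    rw [coeff_zero_eq_eval_zero] at hz0 ⊢
    rw [hU]; simp [hz0]
  by_cases h0 : K = 0
  · subst h0
    simp only [Multiset.sum_zero, add_zero] at hsz
    subst hsz
    simp only [Multiset.map_zero, Multiset.prod_zero, mul_one] at H2
    have h4 : (4 * (1 + X ^ 2) ^ 2 * (1 - z)) * X ^ (l + L) = 0 := by linear_combination -H2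
    have h5 := (mul_eq_zero.1 h4).resolve_right (pow_ne_zero _ X_ne_zero)
    have h6 := congrArg (fun P => coeff P 0) h5
    simp only [coeff_zero_eq_eval_zero] at h6 hz0
    simp [hz0] at h6
  · obtain ⟨a, ha⟩ := Multiset.exists_mem_of_ne_zero h0
    obtain ⟨K0, rfl⟩ := Multiset.exists_cons_of_mem ha
    obtain ⟨e, he, hmin⟩ := exists_min a K0
    generalize a ::ₘ K0 = K at *
    have h3 := hK e he
    have hs1 := sum_pos_of he
    have hc : L + 1 = c + 1 ∨ (e ≤ L + 1 ∧ e ≤ c + 1) := by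
      apply pow_eq_low
      have g := congrArg r2 H2
      have rU : r2 U = (1 + X) * (1 + X ^ (2 * l)) := by
        rw [hU, hz]
        simp only [map_add, map_mul, map_pow, map_one, map_neg, map_sub, map_ofNat, r2_X]
        linear_combination (X ^ 2 - X * X ^ (2 * l)) * two0
      have rW : r2 W = X * ((1 + X) * (1 + X ^ (2 * l))) := by
        rw [hW, hz]
        simp only [map_add, map_mul, map_pow, map_one, map_neg, map_sub, map_ofNat, r2_X]
        linear_combination ((1 - X) * X ^ (2 * l)) * two0
      have g2 : ((1 + X) * (1 + X ^ (2 * l)) * (1 + X ^ (L + 1))) ^ 2 =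
          ((1 + X) * (1 + X ^ (2 * l)) * (1 + X ^ (c + 1)) * Pz K) ^ 2 := by
        rw [map_mul, r2_prod] at g
        simp only [map_add, map_sub, map_mul, map_pow, map_neg, map_one, map_ofNat, r2_X,
          rU, rW, eps2] at g
        have h4 : (4 : (ZMod 2)[X]) = 0 := by linear_combination 2 * two0
        have hc2 : ∀ k : ℕ, ((X : (ZMod 2)[X]) ^ (k + 1)) = X * X ^ k := fun k => by ring
        rw [hc2, hc2]
        generalize r2 z = zz at *
        generalize (X : (ZMod 2)[X]) ^ L = xL at *
        generalize (X : (ZMod 2)[X]) ^ c = xc at *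
        generalize (X : (ZMod 2)[X]) ^ (l + c) = xlc at *
        generalize (X : (ZMod 2)[X]) ^ (2 * l) = x2l at *
        generalize Pz K = P at *
        generalize (X : (ZMod 2)[X]) = x at *
        linear_combination g + ((1 + x) ^ 2 * (1 + x2l) ^ 2 * (x * xL + (x * xL) ^ 2) -
          (1 + x) ^ 2 * (1 + x2l) ^ 2 * (x * xc + (x * xc) ^ 2) * P ^ 2 +
          2 * (1 + x ^ 2) ^ 2 * xlc * (1 - zz) * P ^ 2) * two0
      have g3 := sq_inj g2
      have h : qm (ZMod 2) e (((1 + X ^ 1) * ((1 + X ^ (2 * l)) * ((1 + X ^ (L + 1)) -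
          (1 + X ^ (c + 1)) * Pz K)))) = 0 := by
        rw [show (1 + X ^ 1) * ((1 + X ^ (2 * l)) * ((1 + X ^ (L + 1)) -
          (1 + X ^ (c + 1)) * Pz K)) = 0 by linear_combination g3, map_zero]
      have h := qm_cancel (one_X_ne (by omega)) (qm_cancel (one_X_ne (by omega)) h)
      simp only [map_add, map_mul, map_pow, map_one, map_sub, Pz_low hmin] at h
      linear_combination h
    have hc : e ≤ L + 1 ∧ e ≤ c + 1 := by omega
    have hA0 : (2 * U ^ 2).coeff 0 ≠ 0 := by
      rw [coeff_zero_eq_eval_zero] at hU0 ⊢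
      simp [hU0]
    have h2 : qm ℤ (e + 1) ((2 * U ^ 2) * Tm K) = 0 := by
      have h := congrArg (qm ℤ (e + 1)) H2
      simp only [map_mul, map_sub, map_add, map_pow, map_neg, map_one, map_ofNat] at h
      rw [qm_eps (k := L) (by omega), qm_eps (k := c) (by omega), qm_pow (k := l + c) (by omega),
        qm_prod hmin (by omega)] at h
      simp only [map_mul, map_ofNat, map_pow]
      linear_combination -h
    have h3 := qm_cancel hA0 h2
    rw [← map_zero (qm ℤ (e + 1)), qm_eq] at h3
    have := h3 e (by omega)
    rw [Tm_coeff] at this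
    have h4 := Multiset.count_pos.2 he
    rw [coeff_zero] at this
    omega

theorem dl_bd (x e : ℕ) : 0 ≤ dl x e ∧ 0 ≤ dl x (e + 1) ∧ 0 ≤ dl x (e + 2) ∧ 0 ≤ dl x (e + 3) ∧
    dl x e + dl x (e + 1) + dl x (e + 2) + dl x (e + 3) ≤ 1 ∧ (x = e → dl x e = 1) ∧
    (dl x e = 1 → x = e) := by
  unfold dl
  split_ifs <;> omega

theorem dl_ne {x e : ℕ} (h : x ≠ e) : dl x e = 0 := by
  unfold dl
  rw [if_neg (by omega)]

theorem dl_self (e : ℕ) : dl e e = 1 := by simp [dl]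

theorem wT_sum_zero {m : ℕ} {P : ℤ[X]} {e : ℕ} (h : qm ℤ m P = 0) :
    qm ℤ m P = qm ℤ m (2 * (X ^ 2 * (1 + X) ^ 2 * C 0) * X ^ e) := by
  rw [h]; simp

theorem arith_t {p q L a b c : ℕ} {K : Multiset ℕ} (hp : 3 ≤ p) (hq : 3 ≤ q) (hL : 2 ≤ L)
    (hK : ∀ k ∈ K, 3 ≤ k) (ha : 1 ≤ a) (hb : 2 ≤ b) (hab : a ≤ b) (hbc : b ≤ c)
    (hsz : p + q + L = a + b + c + K.sum)
    (H : hD p q L = hT a b c * (K.map cy).prod) : False := by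
  have ha2 : 2 ≤ a := by
    by_contra h
    have := t_f2 hp hq hK (by omega) (by omega) (by omega) H 2 (by omega)
    split_ifs at this <;> omega
  obtain ⟨e, he, hmin⟩ := exists_min p (q ::ₘ (a + b) ::ₘ K)
  simp only [Multiset.mem_cons, forall_eq_or_imp] at he hmin
  obtain ⟨m1, m2, m3, m4⟩ := hmin
  have he3 : 3 ≤ e := by
    rcases he with rfl | rfl | rfl | h
    · exact hp
    · exact hq
    · omega
    · exact hK e h
  have F := t_f2 m1 m2 m4 m3 (by omega) (by omega) H
  have bp := dl_bd p e
  have bq := dl_bd q e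
  rcases Nat.lt_or_ge e (a + b) with h1 | h1
  · -- first case
    have hk : qm ℤ (e + 3) (wT a + wT b + wT c - wT L) = 0 := by
      rw [map_sub, map_add, map_add, qm_wT (l := b) (by omega), qm_wT (l := c) (by omega)]
      by_cases h2 : 2 * a ≤ e
      · have f := F (a + 1) (by omega)
        have : L = a := by
          split_ifs at f <;> omega
        rw [this]; ring
      · have : ¬ 2 * L ≤ e := by
          intro h3
          have f := F (L + 1) (by omega)
          split_ifs at f <;> omega
        rw [qm_wT (l := a) (by omega), qm_wT (l := L) (by omega)]; ring
    obtain ⟨g0, g1, g2, -⟩ := t_eqs (m := e + 3) (by omega) (by omega) m1 m2 m4 m3 (by omega)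
      (by omega) ha2 hb (by omega) hL 0 (wT_sum_zero hk) H
    replace g0 := g0 (by omega)
    replace g1 := g1 (by omega)
    replace g2 := g2 (by omega)
    have b1 := dl_bd (a + b) e
    have b2 := dl_bd (a + c) e
    have b3 := dl_bd (b + c) e
    rw [dl_ne (show a + b ≠ e by omega), dl_ne (show a + c ≠ e by omega),
      dl_ne (show b + c ≠ e by omega)] at g0 g2
    have hat : p = e ∨ q = e ∨ 1 ≤ K.count e := by
      rcases he with h | h | h | h
      · exact Or.inl h.symm
      · exact Or.inr (Or.inl h.symm)
      · omega
      · exact Or.inr (Or.inr (Multiset.count_pos.2 h))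
    clear F m4 he hK H hk
    omega
  · have hee : e = a + b := by omega
    clear he
    rcases Nat.lt_or_ge a b with h2 | h2
    · -- a < b
      have f1 := F (a + 1) (by omega)
      have f2 := F (b + 1) (by omega)
      have hLa : L = a := by split_ifs at f1 <;> omega
      have hcb : c = b := by split_ifs at f2 <;> omega
      have hk : qm ℤ (e + 1) (wT a + wT b + wT c - wT L) = 0 := by
        rw [map_sub, map_add, map_add, qm_wT (l := b) (by omega), qm_wT (l := c) (by omega), hLa]
        ring
      obtain ⟨g0, -⟩ := t_eqs (m := e + 1) (by omega) (by omega) m1 m2 m4 m3 (by omega)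
        (by omega) ha2 hb (by omega) hL 0 (wT_sum_zero hk) H
      replace g0 := g0 (by omega)
      rw [dl_ne (show b + c ≠ e by omega), show a + c = e by omega, ← hee, dl_self] at g0
      have hpq : p = e ∧ q = e := by
        clear F m4 hK H hk f1 f2
        omega
      have hsum : K.sum = 2 * a := by omega
      have hK0 : K ≠ 0 := by
        rintro rfl
        simp at hsum; omega
      obtain ⟨k, hk⟩ := Multiset.exists_mem_of_ne_zero hK0
      have := m4 k hk
      have := sum_pos_of hk
      omega
    · obtain rfl : a = b := by omega
      have f1 := F (a + 1) (by omega)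
      rcases Nat.lt_or_ge a c with h3 | h3
      · have hk : qm ℤ (e + 4) (wT a + wT a + wT c - wT L) =
            qm ℤ (e + 4) (2 * (X ^ 2 * (1 + X) ^ 2 * C ((-1) ^ a)) * X ^ e) := by
          have w1 : wT a + wT a = 2 * (X ^ 2 * (1 + X) ^ 2 * C ((-1) ^ a)) * X ^ e := by
            rw [wT, eps_pow, hee, ← two_mul a, C_pow, C_neg, C_1]; ring
          rw [← w1]
          by_cases h4 : L = c
          · rw [h4]; congr 1; ring
          · have c1 : e ≤ c + 1 := by
              by_contra h5
              have f := F (c + 1) (by omega)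
              split_ifs at f <;> omega
            have c2 : e ≤ L + 1 := by
              by_contra h5
              have f := F (L + 1) (by omega)
              split_ifs at f f1 <;> omega
            rw [map_sub, map_add, qm_wT (l := L) (by omega), qm_wT (l := c) (by omega)]; ring
        obtain ⟨g0, g1, g2, g3⟩ := t_eqs (m := e + 4) (by omega) (by omega) m1 m2 m4 m3 (by omega)
          (by omega) ha2 hb (by omega) hL _ hk H
        replace g0 := g0 (by omega)
        replace g1 := g1 (by omega)
        replace g2 := g2 (by omega)
        replace g3 := g3 (by omega)
        rw [dl_ne (show a + c ≠ e by omega), ← hee, dl_self] at g0 g2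
        rw [← hee, dl_ne (show e ≠ e + 1 by omega)] at g1 g3
        rw [dl_ne (show e ≠ e + 2 by omega)] at g2
        rw [dl_ne (show e ≠ e + 3 by omega)] at g3
        have b2 := dl_bd (a + c) e
        have hsg : (-1 : ℤ) ^ a = 1 ∨ (-1 : ℤ) ^ a = -1 := neg_one_pow_eq_or ℤ a
        have res : p = e ∧ q = e ∧ K.count e = 1 ∧ (-1 : ℤ) ^ a = 1 := by
          generalize (-1 : ℤ) ^ a = s at *
          clear F m4 hK H hk f1
          rcases hsg with rfl | rfl <;> omega
        obtain ⟨r1, r2, r3, r4⟩ := res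
        have heK : e ∈ K := Multiset.count_pos.1 (by omega)
        obtain ⟨K', rfl⟩ := Multiset.exists_cons_of_mem heK
        rw [Multiset.sum_cons] at hsz
        have h2a : e = 2 * a := by omega
        refine t_final (K := K') (L := L) ha2 h3 r4 (fun k hk => ?_) (by omega) ?_
        · have := m4 k (Multiset.mem_cons_of_mem hk)
          omega
        · rw [← h2a, ← H, r1, r2]
      · have hca : c = a := by omega
        have hLa : L = a := by split_ifs at f1 <;> omega
        have hk : qm ℤ (e + 1) (wT a + wT a + wT c - wT L) = 0 := by
          rw [map_sub, map_add, map_add, qm_wT (l := a) (by omega), qm_wT (l := c) (by omega),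
            qm_wT (l := L) (by omega)]
          ring
        obtain ⟨g0, -⟩ := t_eqs (m := e + 1) (by omega) (by omega) m1 m2 m4 m3 (by omega)
          (by omega) ha2 hb (by omega) hL 0 (wT_sum_zero hk) H
        replace g0 := g0 (by omega)
        rw [hca, ← hee, dl_self] at g0
        clear F m4 hK H hk f1
        omega


/-! ### Building the isomorphism -/

section
variable {V : Type*} [Fintype V] {G : SimpleGraph V}

theorem hom_iff {W : Type*} [Fintype W] {H : SimpleGraph W} {e : W → V}
    (he : Function.Injective e)
    (hom : ∀ i j, H.Adj i j → G.Adj (e i) (e j)) (hdeg : ∀ i, G.degree (e i) = H.degree i)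
    (i j : W) : G.Adj (e i) (e j) ↔ H.Adj i j := by
  refine ⟨fun h => ?_, hom i j⟩
  have hsub : (H.neighborFinset i).image e ⊆ G.neighborFinset (e i) := by
    intro z hz
    obtain ⟨k, hk, rfl⟩ := Finset.mem_image.1 hz
    rw [SimpleGraph.mem_neighborFinset] at hk ⊢
    exact hom i k hk
  have heq := Finset.eq_of_subset_of_card_le hsub (by
    rw [Finset.card_image_of_injective _ he, SimpleGraph.card_neighborFinset_eq_degree,
      SimpleGraph.card_neighborFinset_eq_degree, hdeg])
  have hm : e j ∈ G.neighborFinset (e i) := by rwa [SimpleGraph.mem_neighborFinset]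
  rw [← heq] at hm
  obtain ⟨k, hk, hkj⟩ := Finset.mem_image.1 hm
  rw [he hkj] at hk
  rwa [SimpleGraph.mem_neighborFinset] at hk

theorem iso_core {p q r : ℕ} (hp : 3 ≤ p) (hq : 3 ≤ q) (hr : 1 ≤ r) {u v : V}
    (du : G.degree u = 3) (dvv : G.degree v = 3)
    (hd : ∀ c, c ≠ u → c ≠ v → G.degree c = 2)
    (x1 x2 x3 : ℕ → V) (h1 : ∀ i, i < p → G.Adj (x1 i) (x1 (i + 1)))
    (h1a : x1 0 = u) (h1b : x1 p = u) (h2 : ∀ i, i < q → G.Adj (x2 i) (x2 (i + 1)))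
    (h2a : x2 0 = v) (h2b : x2 q = v) (h3 : ∀ i, i ≤ r → G.Adj (x3 i) (x3 (i + 1)))
    (h3a : x3 0 = u) (h3b : x3 (r + 1) = v)
    (hcov : ∀ z, (∃ i, i < p ∧ x1 i = z) ∨ (∃ i, i < q ∧ x2 i = z) ∨
      (∃ i, 1 ≤ i ∧ i ≤ r ∧ x3 i = z)) (hcard : Fintype.card V = p + q + r) :
    Nonempty (G ≃g dGraph p q r) := by
  set f : ℕ → V := fun i => if i < p then x1 i else if i < p + q then x2 (i - p) else
    x3 (i - p - q + 1) with hf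
  have f1 : ∀ i, i < p → f i = x1 i := fun i hi => by rw [hf]; simp [hi]
  have f2 : ∀ i, p ≤ i → i < p + q → f i = x2 (i - p) := fun i hi hi' => by
    rw [hf]; simp [hi', show ¬ i < p by omega]
  have f3 : ∀ i, p + q ≤ i → f i = x3 (i - p - q + 1) := fun i hi => by
    rw [hf]; simp [show ¬ i < p by omega, show ¬ i < p + q by omega]
  set e : Fin (p + q + r) → V := fun i => f i.val with he
  have hsurj : Function.Surjective e := by
    intro z
    rcases hcov z with ⟨i, hi, rfl⟩ | ⟨i, hi, rfl⟩ | ⟨i, hi, hi', rfl⟩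
    · exact ⟨⟨i, by omega⟩, f1 i hi⟩
    · refine ⟨⟨p + i, by omega⟩, (f2 (p + i) (by omega) (by omega)).trans ?_⟩
      congr 1; omega
    · refine ⟨⟨p + q + (i - 1), by omega⟩, (f3 (p + q + (i - 1)) (by omega)).trans ?_⟩
      congr 1; omega
  have hbij : Function.Bijective e := by
    rw [Fintype.bijective_iff_surjective_and_card]
    exact ⟨hsurj, by rw [Fintype.card_fin, hcard]⟩
  have hR : ∀ i j : Fin (p + q + r),
      ((i.val + 1 = j.val ∧ j.val < p) ∨
      (i.val = p - 1 ∧ j.val = 0) ∨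
      (i.val + 1 = j.val ∧ p ≤ i.val ∧ j.val < p + q) ∨
      (i.val = p + q - 1 ∧ j.val = p) ∨
      (i.val + 1 = j.val ∧ p + q ≤ i.val) ∨
      (i.val = 0 ∧ j.val = p + q) ∨
      (i.val = p + q + r - 1 ∧ j.val = p)) → G.Adj (e i) (e j) := by
    intro i j
    have hj := j.2
    show _ → G.Adj (f i.val) (f j.val)
    generalize i.val = i at *
    generalize j.val = j at *
    rintro (h | h | h | h | h | h | h)
    · rw [f1 i (by omega), f1 j (by omega), ← h.1]; exact h1 i (by omega)
    · rw [f1 i (by omega), f1 j (by omega), h.2, h1a, ← h1b]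
      convert h1 i (by omega) using 2; omega
    · rw [f2 i (by omega) (by omega), f2 j (by omega) (by omega)]
      convert h2 (i - p) (by omega) using 2; omega
    · rw [f2 i (by omega) (by omega), f2 j (by omega) (by omega),
        show j - p = 0 by omega, h2a, ← h2b]
      convert h2 (i - p) (by omega) using 2; omega
    · rw [f3 i (by omega), f3 j (by omega)]
      convert h3 (i - p - q + 1) (by omega) using 2; omega
    · rw [f1 i (by omega), f3 j (by omega), h.1, h1a, ← h3a]
      convert h3 0 (by omega) using 2; omega
    · rw [f3 i (by omega), f2 j (by omega) (by omega), show j - p = 0 by omega, h2a, ← h3b]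
      convert h3 (i - p - q + 1) (by omega) using 2; omega
  have hom : ∀ i j, (dGraph p q r).Adj i j → G.Adj (e i) (e j) := by
    intro i j h
    rw [dG_adj] at h
    rcases h.2 with h' | h'
    · exact hR i j h'
    · exact (hR j i h').symm
  have h0 : 0 < p + q + r := by omega
  obtain ⟨I1, I2, I3, D⟩ := dG_dec hp hq hr h0
  have eu : e (dv p q r h0 0) = u := by
    show f (dv p q r h0 0).val = u
    rw [dv_val h0 h0, f1 0 (by omega), h1a]
  have ev : e (dv p q r h0 p) = v := by
    show f (dv p q r h0 p).val = v
    rw [dv_val h0 (by omega), f2 p (by omega) (by omega), show p - p = 0 by omega, h2a]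
  have hdeg : ∀ i, G.degree (e i) = (dGraph p q r).degree i := by
    intro i
    by_cases c1 : i = dv p q r h0 0
    · rw [c1, eu, du, D.1.du]
    by_cases c2 : i = dv p q r h0 p
    · rw [c2, ev, dvv, D.1.dv]
    rw [D.degs i c1 c2, hd]
    · rw [← eu]; exact fun h => c1 (hbij.1 h)
    · rw [← ev]; exact fun h => c2 (hbij.1 h)
  have key := hom_iff hbij.1 hom hdeg
  exact ⟨(RelIso.mk (Equiv.ofBijective e hbij) (fun {i j} => key i j) :
    dGraph p q r ≃g G).symm⟩

theorem UArc.pts {a b : V} {k : ℕ} {I : Finset V} (h : UArc G a b k I) : ∃ x : ℕ → V,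
    (∀ i, i ≤ k → G.Adj (x i) (x (i + 1))) ∧ x 0 = a ∧ x (k + 1) = b ∧
    ∀ z ∈ I, ∃ i, i < k ∧ x (i + 1) = z := by
  obtain ⟨x, hx, h0, h1, rfl⟩ := h
  exact ⟨x, hx.adj, h0, h1, fun z hz => mem_arcI.1 hz⟩

theorem DDec.iso {p q r : ℕ} {u v : V} {I1 I2 I3 : Finset V} (hr : 1 ≤ r)
    (h : DDec G u v p q (r + 1) I1 I2 I3 ∅) :
    Nonempty (G ≃g dGraph p q r) ∧ Nonempty (G ≃g dGraph q p r) := by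
  have hdd := h.degs
  obtain ⟨h, hp, hq, a1, a2, hL⟩ := h
  have hc := h.card
  rw [a1.card, a2.card, hL.card, Finset.card_empty] at hc
  have a3 : UArc G u v r I3 := by
    rcases hL with ⟨h, -⟩ | ⟨-, -, h⟩
    · omega
    · exact h
  obtain ⟨x1, c1, s1, t1, m1⟩ := a1.pts
  obtain ⟨x2, c2, s2, t2, m2⟩ := a2.pts
  obtain ⟨x3, c3, s3, t3, m3⟩ := a3.pts
  rw [show p - 1 + 1 = p by omega] at t1
  rw [show q - 1 + 1 = q by omega] at t2
  have hcov : ∀ z, (∃ i, i < p ∧ x1 i = z) ∨ (∃ i, i < q ∧ x2 i = z) ∨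
      (∃ i, 1 ≤ i ∧ i ≤ r ∧ x3 i = z) := by
    intro z
    have : z ∈ insert u (insert v (I1 ∪ (I2 ∪ (I3 ∪ ∅)))) := by rw [h.all]; simp
    simp only [Finset.mem_insert, Finset.mem_union, Finset.notMem_empty, or_false] at this
    rcases this with t | t | t | t | t
    · exact Or.inl ⟨0, by omega, by rw [s1, t]⟩
    · exact Or.inr (Or.inl ⟨0, by omega, by rw [s2, t]⟩)
    · obtain ⟨i, hi, hz⟩ := m1 z t
      exact Or.inl ⟨i + 1, by omega, hz⟩
    · obtain ⟨i, hi, hz⟩ := m2 z t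
      exact Or.inr (Or.inl ⟨i + 1, by omega, hz⟩)
    · obtain ⟨i, hi, hz⟩ := m3 z t
      exact Or.inr (Or.inr ⟨i + 1, by omega, by omega, hz⟩)
  refine ⟨iso_core hp hq hr h.du h.dv hdd x1 x2 x3 (fun i hi => c1 i (by omega)) s1 t1
    (fun i hi => c2 i (by omega)) s2 t2 c3 s3 t3 hcov (by omega), ?_⟩
  refine iso_core hq hp hr h.dv h.du (fun c hv hu => hdd c hu hv) x2 x1 (fun i => x3 (r + 1 - i))
    (fun i hi => c2 i (by omega)) s2 t2
    (fun i hi => c1 i (by omega)) s1 t1 ?_ t3 ?_ ?_ (by omega)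
  · intro i hi
    have := (c3 (r - i) (by omega)).symm
    convert this using 2 <;> omega
  · simpa using s3
  · intro z
    rcases hcov z with t | t | ⟨i, hi, hi', t⟩
    · exact Or.inr (Or.inl t)
    · exact Or.inl t
    · refine Or.inr (Or.inr ⟨r + 1 - i, by omega, by omega, ?_⟩)
      rw [← t]
      show x3 _ = x3 _
      congr 1; omega

end

theorem arith_t' {p q L a b c : ℕ} {K : Multiset ℕ} (hp : 3 ≤ p) (hq : 3 ≤ q) (hL : 2 ≤ L)
    (hK : ∀ k ∈ K, 3 ≤ k) (ha : 2 ≤ a) (hb : 2 ≤ b) (hc : 1 ≤ c)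
    (hsz : p + q + L = a + b + c + K.sum)
    (H : hD p q L = hT a b c * (K.map cy).prod) : False := by
  rcases le_total a b with h1 | h1 <;> rcases le_total b c with h2 | h2 <;>
    rcases le_total a c with h3 | h3
  · exact arith_t hp hq hL hK (by omega) hb h1 h2 hsz H
  · exact arith_t hp hq hL hK (by omega) hb h1 h2 hsz H
  · rw [hT_swap2] at H
    exact arith_t hp hq hL hK (by omega) (by omega) h3 h2 (by omega) H
  · rw [hT_swap2, hT_swap1] at H
    exact arith_t hp hq hL hK (by omega) (by omega) h3 h1 (by omega) H
  · rw [hT_swap1] at H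
    exact arith_t hp hq hL hK (by omega) (by omega) h1 h3 (by omega) H
  · rw [hT_swap1, hT_swap2] at H
    exact arith_t hp hq hL hK (by omega) (by omega) h2 h3 (by omega) H
  · rw [hT_swap2, hT_swap1, hT_swap2] at H
    exact arith_t hp hq hL hK (by omega) (by omega) h2 h1 (by omega) H
  · rw [hT_swap2, hT_swap1, hT_swap2] at H
    exact arith_t hp hq hL hK (by omega) (by omega) h2 h1 (by omega) H

theorem final_main
    (p q r : ℕ) (hp : 3 ≤ p) (hq : 3 ≤ q) (hr : 1 ≤ r)
    {V : Type*} [Fintype V] (G : SimpleGraph V)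
    (h : qPermPoly G = qPermPoly (dGraph p q r)) :
    Nonempty (G ≃g dGraph p q r) := by
  have h0 : 0 < p + q + r := by omega
  obtain ⟨J1, J2, J3, D0⟩ := dG_dec hp hq hr h0
  obtain ⟨hcard, hPer⟩ := qPerm_transfer G (dGraph p q r) h
  rw [Fintype.card_fin] at hcard
  obtain ⟨s1, s2⟩ := sum_aD D0.1.ne D0.1.du D0.1.dv D0.degs
  obtain ⟨t1, t2⟩ := degs_transfer G (dGraph p q r) h
  obtain ⟨u, v, huv, du, dvv, hd⟩ := degs_exist G (t1.trans s1) (t2.trans s2)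
  have F0 := D0.formula
  rw [← hPer, Per_empty, if_pos rfl, mul_one] at F0
  rcases exists_dec huv du dvv hd with ⟨p', q', L', I1, I2, I3, C, D⟩ | ⟨a, b, c, I1, I2, I3, C, D⟩
  · obtain ⟨K, hK, hsum, hPC⟩ := closed_Per _ C rfl D.1.closed
    have F1 := D.formula
    rw [F0, hPC] at F1
    have hc := D.1.card
    obtain ⟨-, hp', hq', a1, a2, hL⟩ := id D
    rw [a1.card, a2.card, hL.card, hcard] at hc
    have := hL.pos
    obtain ⟨r1, r2, r3⟩ := arith_d hp hq hp' hq' (by omega) hK (by omega) F1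
    subst r1
    rw [Multiset.sum_zero] at hsum
    obtain rfl : C = ∅ := Finset.card_eq_zero.1 hsum.symm
    subst r2
    rcases r3 with ⟨rfl, rfl⟩ | ⟨rfl, rfl⟩
    · exact (D.iso hr).1
    · exact (D.iso hr).2
  · exfalso
    obtain ⟨K, hK, hsum, hPC⟩ := closed_Per _ C rfl D.1.closed
    have F1 := D.formula
    rw [F0, hPC] at F1
    have hc := D.1.card
    obtain ⟨-, ha, hb, a1, a2, hL⟩ := id D
    rw [a1.card, a2.card, hL.card, hcard] at hc
    have := hL.pos
    exact arith_t' hp hq (by omega) hK ha hb (by omega) (by omega) F1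

/-- **Theorem 1.3.** The graph `d(p,q,r)` is determined by its signless Laplacian
permanental polynomial. -/
theorem dGraph_determined_by_qPermPoly
    (p q r : ℕ) (hp : 3 ≤ p) (hq : 3 ≤ q) (hr : 1 ≤ r)
    {V : Type*} [Fintype V] (G : SimpleGraph V)
    (h : qPermPoly G = qPermPoly (dGraph p q r)) :
    Nonempty (G ≃g dGraph p q r) := by
  exact final_main p q r hp hq hr G h
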